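/- arXiv:1412.0953 — 3 statements merged into one kernel-verified Lean document; each statement's English description precedes it below -/
import Mathlib

section
/- Let A be a Dedekind domain with fraction field K and let I be a nonzero integral ideal of A. Let A′ = { r ∈ K : v_𝔮(r) ≥ 0 for every maximal ideal 𝔮 of A not containing I }, where v_𝔮 is the discrete valuation at 𝔮. Then there exists a matrix M ∈ SL₂(K) all of whose entries lie in A′ such that H(I²) = M⁻¹ · SL₂(A) · M (with SL₂(A) viewed as a subgroup of SL₂(K)). In particular H(I²) is isomorphic to SL₂(A) as a group. -/
open Matrix IsDedekindDomain

/-- For a fractional ideal `I` of a Dedekind domain `A` with fraction field `K`, `HSet A K I`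
is the set of matrices `(a, b; c, d) ∈ SL₂(K)` with `a, d ∈ A`, `b ∈ I⁻¹` and `c ∈ I`
(the stabilizer `H(I)` of the lattice `A ⊕ I`). -/
def HSet (A K : Type*) [CommRing A] [IsDomain A] [IsDedekindDomain A] [Field K] [Algebra A K]
    [IsFractionRing A K] (I : FractionalIdeal (nonZeroDivisors A) K) :
    Set (Matrix (Fin 2) (Fin 2) K) :=
  {g | g.det = 1 ∧ g 0 0 ∈ (algebraMap A K).range ∧ g 1 1 ∈ (algebraMap A K).range ∧
    g 0 1 ∈ I⁻¹ ∧ g 1 0 ∈ I}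

/-- `SL₂(A)` viewed as a set of matrices over `K`. -/
def SLA (A K : Type*) [CommRing A] [Field K] [Algebra A K] : Set (Matrix (Fin 2) (Fin 2) K) :=
  {g | g.det = 1 ∧ ∀ i j, g i j ∈ (algebraMap A K).range}

/-- Matrices over `K` mapping `s 0 ⊕ s 1` into `r 0 ⊕ r 1`, described by their entries. -/
def IsLatticeHom {A K : Type*} [CommRing A] [IsDedekindDomain A] [Field K]
    [Algebra A K] [IsFractionRing A K]
    (r s : Fin 2 → FractionalIdeal (nonZeroDivisors A) K) (N : Matrix (Fin 2) (Fin 2) K) : Prop :=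
  ∀ i j, N i j ∈ r i * (s j)⁻¹

section

variable {A K : Type*} [CommRing A] [IsDedekindDomain A] [Field K]
  [Algebra A K] [IsFractionRing A K]

theorem IsLatticeHom.mul {r s t : Fin 2 → FractionalIdeal (nonZeroDivisors A) K}
    (hs : ∀ i, s i ≠ 0) {N P : Matrix (Fin 2) (Fin 2) K}
    (hN : IsLatticeHom r s N) (hP : IsLatticeHom s t P) : IsLatticeHom r t (N * P) := by
  intro i j
  rw [Matrix.mul_apply]
  refine Submodule.sum_mem (r i * (t j)⁻¹ : FractionalIdeal (nonZeroDivisors A) K).coeToSubmodule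
    fun k _ => ?_
  have h := FractionalIdeal.mul_mem_mul (hN i k) (hP k j)
  rwa [mul_assoc, inv_mul_cancel_left₀ (hs k)] at h

theorem mem_SLA_iff {g : Matrix (Fin 2) (Fin 2) K} :
    g ∈ SLA A K ↔
      g.det = 1 ∧ IsLatticeHom (fun _ => (1 : FractionalIdeal (nonZeroDivisors A) K)) 1 g := by
  simp [SLA, IsLatticeHom, FractionalIdeal.mem_one_iff]

theorem mem_HSet_sq_iff {J : FractionalIdeal (nonZeroDivisors A) K} (hJ : J ≠ 0)
    {g : Matrix (Fin 2) (Fin 2) K} :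
    g ∈ HSet A K (J ^ 2) ↔ g.det = 1 ∧ IsLatticeHom ![J⁻¹, J] ![J⁻¹, J] g := by
  simp [HSet, IsLatticeHom, Fin.forall_fin_two, pow_two, hJ, FractionalIdeal.mem_one_iff]
  tauto

/-- A nonzero ideal `I` of a Dedekind domain has a unimodular matrix carrying `I⁻¹ ⊕ I`
onto `A ⊕ A`. -/
theorem exists_det_eq_one_isLatticeHom (I : Ideal A) (hI : I ≠ ⊥) :
    ∃ M : Matrix (Fin 2) (Fin 2) K, M.det = 1 ∧
      IsLatticeHom 1 ![(I : FractionalIdeal (nonZeroDivisors A) K)⁻¹, I] M := by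
  obtain ⟨a, haI, ha⟩ := Submodule.exists_mem_ne_zero_of_ne_bot hI
  obtain ⟨b, hb⟩ := IsDedekindDomain.exists_sup_span_eq (I := Ideal.span {a}) (J := I)
    ((Ideal.span_singleton_le_iff_mem I).2 haI) (by simpa using ha)
  have hbI : b ∈ I := hb ▸ Ideal.mem_sup_right (Ideal.mem_span_singleton_self b)
  have hJ : (I : FractionalIdeal (nonZeroDivisors A) K) ≠ 0 :=
    FractionalIdeal.coeIdeal_ne_zero.2 hI
  have h1 : (1 : K) ∈ (I : FractionalIdeal (nonZeroDivisors A) K) *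
      (I : FractionalIdeal (nonZeroDivisors A) K)⁻¹ := by
    rw [mul_inv_cancel₀ hJ]
    exact FractionalIdeal.one_mem_one _
  have h2 : (I : FractionalIdeal (nonZeroDivisors A) K) =
      FractionalIdeal.spanSingleton _ (algebraMap A K a) +
        FractionalIdeal.spanSingleton _ (algebraMap A K b) := by
    rw [← FractionalIdeal.coeIdeal_span_singleton, ← FractionalIdeal.coeIdeal_span_singleton,
      ← FractionalIdeal.coeIdeal_sup, hb]
  nth_rw 1 [h2] at h1
  rw [add_mul, ← FractionalIdeal.mem_coe, FractionalIdeal.coe_add, Submodule.add_eq_sup,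
    Submodule.mem_sup] at h1
  obtain ⟨y, hy, z, hz, h⟩ := h1
  obtain ⟨d, hd, rfl⟩ := FractionalIdeal.mem_singleton_mul.1 hy
  obtain ⟨c, hc, rfl⟩ := FractionalIdeal.mem_singleton_mul.1 hz
  refine ⟨!![algebraMap A K a, -c; algebraMap A K b, d], ?_, ?_⟩
  · rw [Matrix.det_fin_two_of, ← h]
    ring
  · have hc' := Submodule.neg_mem
      ((I : FractionalIdeal (nonZeroDivisors A) K)⁻¹).coeToSubmodule hc
    rw [FractionalIdeal.mem_coe] at hc'
    simp only [IsLatticeHom, Fin.forall_fin_two]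
    simp [hc', hd, haI, hbI]

theorem isLatticeHom_inv {J : FractionalIdeal (nonZeroDivisors A) K}
    {M : Matrix (Fin 2) (Fin 2) K} (hM : M.det = 1) (h : IsLatticeHom 1 ![J⁻¹, J] M) :
    IsLatticeHom ![J⁻¹, J] 1 M⁻¹ := by
  have hneg {x : K} {L : FractionalIdeal (nonZeroDivisors A) K} : -x ∈ L ↔ x ∈ L :=
    Submodule.neg_mem_iff L.coeToSubmodule
  simp only [IsLatticeHom, Fin.forall_fin_two] at h ⊢
  simp [Matrix.inv_def, hM, Matrix.adjugate_fin_two, hneg] at h ⊢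
  tauto

theorem valuation_le_one_of_mem_coeIdeal_or_inv {I : Ideal A} {r : K}
    (hI : I ≠ ⊥) (hr : r ∈ (I : FractionalIdeal (nonZeroDivisors A) K) ∨
      r ∈ (I : FractionalIdeal (nonZeroDivisors A) K)⁻¹)
    (v : HeightOneSpectrum A) (hv : ¬ I ≤ v.asIdeal) : v.valuation K r ≤ 1 := by
  obtain hr | hr := hr
  · obtain ⟨x, -, rfl⟩ := (FractionalIdeal.mem_coeIdeal _).1 hr
    exact v.valuation_le_one x
  · obtain ⟨x, hx, hxv⟩ := SetLike.not_le_iff_exists.1 hv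
    rw [FractionalIdeal.mem_inv_iff (FractionalIdeal.coeIdeal_ne_zero.2 hI)] at hr
    obtain ⟨y, hy⟩ := (FractionalIdeal.mem_one_iff _).1
      (hr _ (FractionalIdeal.mem_coeIdeal_of_mem _ hx))
    have h1 : v.valuation K (algebraMap A K x) = 1 :=
      le_antisymm (v.valuation_le_one x)
        (not_lt.1 fun h => hxv ((v.valuation_lt_one_iff_mem x).1 h))
    have h2 : v.valuation K (algebraMap A K y) ≤ 1 := v.valuation_le_one y
    rwa [hy, map_mul, h1, mul_one] at h2

end

/-- For a nonzero integral ideal `I` of a Dedekind domain `A` with fraction field `K`, there is a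
matrix `M ∈ SL₂(K)`, with entries in the ring `A′` of elements integral at every maximal ideal
not containing `I`, such that `H(I²) = M⁻¹ ⬝ SL₂(A) ⬝ M`. -/
theorem stmt2 (A K : Type*) [CommRing A] [IsDomain A] [IsDedekindDomain A] [Field K] [Algebra A K]
    [IsFractionRing A K] (I : Ideal A) (hI : I ≠ ⊥) :
    ∃ M : Matrix (Fin 2) (Fin 2) K, M.det = 1 ∧
      (∀ i j, M i j ∈ {r : K | ∀ v : HeightOneSpectrum A, ¬ I ≤ v.asIdeal →
        v.valuation (K := K) r ≤ 1}) ∧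
      HSet A K ((I : FractionalIdeal (nonZeroDivisors A) K) ^ 2) =
        (fun g => M⁻¹ * g * M) '' SLA A K := by
  have hJ : (I : FractionalIdeal (nonZeroDivisors A) K) ≠ 0 :=
    FractionalIdeal.coeIdeal_ne_zero.2 hI
  obtain ⟨M, hM, hMl⟩ := exists_det_eq_one_isLatticeHom (K := K) I hI
  have hMi := isLatticeHom_inv hM hMl
  have hu : IsUnit M.det := by simp [hM]
  have hs : ∀ i, (![(I : FractionalIdeal (nonZeroDivisors A) K)⁻¹, I] : Fin 2 → _) i ≠ 0 := by
    simp [Fin.forall_fin_two, hJ]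
  refine ⟨M, hM, fun i j v hv => ?_, ?_⟩
  · refine valuation_le_one_of_mem_coeIdeal_or_inv hI ?_ v hv
    have h := hMl i j
    fin_cases j
    · exact Or.inl (by simpa using h)
    · exact Or.inr (by simpa using h)
  · ext g
    simp only [mem_HSet_sq_iff hJ, Set.mem_image, mem_SLA_iff]
    constructor
    · rintro ⟨hg, hgl⟩
      refine ⟨M * g * M⁻¹, ⟨?_, (hMl.mul hs hgl).mul hs hMi⟩, ?_⟩
      · simp [hM, hg, Matrix.det_nonsing_inv]
      · simp only [Matrix.mul_assoc, Matrix.nonsing_inv_mul M hu, Matrix.mul_one,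
          Matrix.nonsing_inv_mul_cancel_left M _ hu]
    · rintro ⟨g, ⟨hg, hgl⟩, rfl⟩
      refine ⟨by simp [hM, hg, Matrix.det_nonsing_inv], (hMi.mul ?_ hgl).mul ?_ hMl⟩ <;> simp
end

section
/- Let S be a nonempty set of prime numbers, let A = ℤ_S, and suppose there exists a unit λ ∈ A^× such that λ² − 1 ∈ A^× as well. Let q be a prime number not in S, so that qA is a nonzero prime ideal of A with residue field ℤ/qℤ. Let ρ : Γ₀(qA) → (ℤ/qℤ)^× be the map sending a matrix (a, b; c, d) to a mod q. Then ρ is a surjective group homomorphism whose kernel is exactly the commutator subgroup of Γ₀(qA); consequently ρ induces an isomorphism from the abelianization of Γ₀(qA) onto (ℤ/qℤ)^×. -/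
open Matrix





/-- `ℤ_S`: the subring of `ℚ` obtained by localizing `ℤ` at the primes in `S`, i.e. the smallest
subring of `ℚ` containing the inverses of the elements of `S`. -/
def ZS (S : Set ℕ) : Subring ℚ :=
  Subring.closure ((fun p : ℕ => (p : ℚ)⁻¹) '' S)

/-- `Γ₀(I)`: the subgroup of `SL₂(A)` of matrices whose lower-left entry lies in the ideal `I`. -/
def Gamma0 (A : Type*) [CommRing A] (I : Ideal A) :
    Subgroup (Matrix.SpecialLinearGroup (Fin 2) A) where
  carrier := {g | (↑g : Matrix (Fin 2) (Fin 2) A) 1 0 ∈ I}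
  one_mem' := by simp [Matrix.one_apply]
  mul_mem' := by
    intro g h hg hh
    have : (↑(g * h) : Matrix (Fin 2) (Fin 2) A) 1 0 =
        (↑g : Matrix (Fin 2) (Fin 2) A) 1 0 * (↑h : Matrix (Fin 2) (Fin 2) A) 0 0 +
        (↑g : Matrix (Fin 2) (Fin 2) A) 1 1 * (↑h : Matrix (Fin 2) (Fin 2) A) 1 0 := by
      simp [Matrix.SpecialLinearGroup.coe_mul, Matrix.mul_apply, Fin.sum_univ_two]
    rw [Set.mem_setOf_eq, this]
    exact add_mem (Ideal.mul_mem_right _ _ hg) (Ideal.mul_mem_left _ _ hh)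
  inv_mem' := by
    intro g hg
    rw [Set.mem_setOf_eq, Matrix.SpecialLinearGroup.SL2_inv_expl g]
    simpa using I.neg_mem hg

/-- Reduction of a rational number modulo `q`: `num · den⁻¹` in `ZMod q`. -/
def ratMod (q : ℕ) (x : ℚ) : ZMod q :=
  (x.num : ZMod q) * (x.den : ZMod q)⁻¹

theorem sq_dvd_one_add_pow_sub {R : Type*} [CommRing R] (x : R) (s : ℕ) :
    x ^ 2 ∣ (1 + x) ^ s - (1 + s * x) := by
  induction s with
  | zero => simp
  | succ s ih =>
    obtain ⟨k, hk⟩ := ih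
    refine ⟨k * (1 + x) + s, ?_⟩
    rw [pow_succ, sub_eq_iff_eq_add.mp hk]
    push_cast
    ring

theorem exists_pow_prime_pow_eq_one_add {p j : ℕ} (hp : p.Prime) (hp2 : p ≠ 2) {g : ℤ} (hj : 1 ≤ j)
    (h1 : (p : ℤ) ^ j ∣ g - 1) (h2 : ¬ (p : ℤ) ^ (j + 1) ∣ g - 1) (k : ℕ) :
    ∃ m : ℤ, g ^ p ^ k = 1 + (p : ℤ) ^ (j + k) * m ∧ ¬ (p : ℤ) ∣ m := by
  have hpg : (p : ℤ) ∣ g - 1 := (dvd_pow_self _ (by omega)).trans h1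
  have hpp := Nat.prime_iff_prime_int.mp hp
  have hndvd : ¬ (p : ℤ) ∣ g := fun h ↦ hpp.not_dvd_one (by simpa using dvd_sub h hpg)
  have key := Int.emultiplicity_pow_sub_pow hp (hp.odd_of_ne_two hp2) hpg hndvd (p ^ k)
  rw [emultiplicity_eq_coe.mpr ⟨h1, h2⟩, hp.emultiplicity_pow_self, one_pow,
    ← Nat.cast_add, emultiplicity_eq_coe] at key
  obtain ⟨⟨m, hm⟩, h⟩ := key
  refine ⟨m, by linarith, fun hd ↦ h ?_⟩
  rw [hm, pow_succ]
  exact mul_dvd_mul_left _ hd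

theorem exists_pow_dvd_pow_mul_sub {p j : ℕ} (hp : p.Prime) (hp2 : p ≠ 2) {g x y : ℤ} (hj : 1 ≤ j)
    (h1 : (p : ℤ) ^ j ∣ g - 1) (h2 : ¬ (p : ℤ) ^ (j + 1) ∣ g - 1) (hx : ¬ (p : ℤ) ∣ x)
    (hxy : (p : ℤ) ^ j ∣ x - y) (n : ℕ) : ∃ t : ℕ, (p : ℤ) ^ n ∣ g ^ t * x - y := by
  have hpp := Nat.prime_iff_prime_int.mp hp
  have hpg : (p : ℤ) ∣ g - 1 := (dvd_pow_self _ (by omega)).trans h1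
  have hndvd : ¬ (p : ℤ) ∣ g := fun h ↦ hpp.not_dvd_one (by simpa using dvd_sub h hpg)
  induction n with
  | zero => exact ⟨0, by simp⟩
  | succ n ih =>
    rcases lt_or_ge n j with hn | hn
    · exact ⟨0, by simpa using (pow_dvd_pow _ hn).trans hxy⟩
    obtain ⟨t, u, hu⟩ := ih
    obtain ⟨m, hm, hpm⟩ := exists_pow_prime_pow_eq_one_add hp hp2 hj h1 h2 (n - j)
    rw [Nat.add_sub_cancel' hn] at hm
    have hcop : IsCoprime (p : ℤ) (m * (g ^ t * x)) := by
      rw [hpp.coprime_iff_not_dvd]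
      intro h
      rcases hpp.dvd_or_dvd h with h | h
      · exact hpm h
      rcases hpp.dvd_or_dvd h with h | h
      · exact hndvd (hpp.dvd_of_dvd_pow h)
      · exact hx h
    obtain ⟨s, hs⟩ : ∃ s : ℕ, (p : ℤ) ∣ u + s * (m * (g ^ t * x)) := by
      obtain ⟨a, b, hab⟩ := hcop
      have hp0 : (p : ℤ) ≠ 0 := hpp.ne_zero
      refine ⟨((-u * b) % p).toNat, ?_⟩
      rw [Int.toNat_of_nonneg (Int.emod_nonneg _ hp0), Int.emod_def]
      refine ⟨u * a - (-u * b / p) * (m * (g ^ t * x)), ?_⟩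
      linear_combination -u * hab
    refine ⟨t + p ^ (n - j) * s, ?_⟩
    obtain ⟨v, hv⟩ := sq_dvd_one_add_pow_sub ((p : ℤ) ^ n * m) s
    have e : g ^ (t + p ^ (n - j) * s) * x - y = (p : ℤ) ^ n * (u + s * (m * (g ^ t * x)))
        + ((p : ℤ) ^ n * m) ^ 2 * v * (g ^ t * x) := by
      rw [pow_add, pow_mul, hm, sub_eq_iff_eq_add.mp hv]
      linear_combination hu
    rw [e]
    refine dvd_add ?_ ?_
    · rw [pow_succ]; exact mul_dvd_mul_left _ hs
    · refine Dvd.dvd.mul_right (Dvd.dvd.mul_right ?_ _) _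
      rw [mul_pow, ← pow_mul]
      exact Dvd.dvd.mul_right (pow_dvd_pow _ (by omega)) _

theorem exists_prime_dvd_pow_mul_sub {p q a r : ℕ} (hp : p.Prime) (hq : q.Prime) (hpq : p ≠ q)
    (hq2 : q ≠ 2) (ha : a.Prime) (haq : q ≠ a) (hqa : ¬ q ∣ a - 1) (hr : r.Prime)
    (hra : 2 * a < r) (hrp : p < r) (hrq : q < r) :
    ∃ b N t : ℕ, ∃ ε : ℤ, (ε = 1 ∨ ε = -1) ∧ (b : ℤ) ∣ (r : ℤ) ^ N - ε ∧
      (a : ℤ) ∣ (r : ℤ) ^ (N + 1) - 1 ∧ (q : ℤ) ∣ b - a ∧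
      (q : ℤ) * (r : ℤ) ^ N ∣ (p : ℤ) ^ ((q - 1) * t) * b - a := by
  have ha2 := ha.two_le
  have hq1 := hq.two_le
  have hpc {n l : ℕ} (hn : n.Prime) (hl : l.Prime) (h : n ≠ l) : (n : ℤ) ^ (l - 1) ≡ 1 [ZMOD l] :=
    Int.ModEq.pow_card_sub_one_eq_one hl
      (Nat.isCoprime_iff_coprime.mpr ((Nat.coprime_primes hn hl).mpr h))
  set g : ℤ := (p : ℤ) ^ ((q - 1) * (r - 1)) with hg
  have hgr : (r : ℤ) ∣ g - 1 := by
    have := (hpc hp hr hrp.ne).pow (q - 1)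
    rw [one_pow, ← pow_mul, mul_comm] at this
    exact this.symm.dvd
  have hg1 : g - 1 ≠ 0 := by
    have : 1 < g := one_lt_pow₀ (by exact_mod_cast hp.one_lt)
      (Nat.mul_ne_zero (by omega) (by have := hr.two_le; omega))
    omega
  have hfin : FiniteMultiplicity (r : ℤ) (g - 1) :=
    Int.finiteMultiplicity_iff.mpr ⟨by simpa using hr.ne_one, hg1⟩
  set j := multiplicity (r : ℤ) (g - 1)
  have hj1 : 1 ≤ j := by
    exact hfin.le_multiplicity_of_pow_dvd (k := 1) (by simpa using hgr)
  have h1 : (r : ℤ) ^ j ∣ g - 1 := pow_multiplicity_dvd _ _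
  have h2 : ¬ (r : ℤ) ^ (j + 1) ∣ g - 1 := hfin.not_pow_dvd_of_multiplicity_lt (by omega)
  have hrlt {m : ℕ} (hm0 : 0 < m) (hm : m < r) : Nat.Coprime r m :=
    Nat.coprime_of_lt_prime hm0.ne' hm hr
  have hcop : Nat.Coprime (q * r ^ j) (2 * (a - 1)) := by
    refine Nat.Coprime.mul_left (Nat.Coprime.mul_right ?_ ?_) ((hrlt (by omega) (by omega)).pow_left _)
    · exact (Nat.coprime_primes hq Nat.prime_two).mpr hq2
    · exact (Nat.Prime.coprime_iff_not_dvd hq).mpr hqa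
  obtain ⟨k, hk1, hk2⟩ := Nat.chineseRemainder hcop a (2 * (a - 1) - 1)
  have hac : Nat.Coprime a (q * r ^ j) := Nat.Coprime.mul_right
    ((Nat.coprime_primes ha hq).mpr haq.symm) ((hrlt (by omega) (by omega)).symm.pow_right _)
  have hkc : Nat.Coprime k (q * r ^ j * (2 * (a - 1))) := by
    refine Nat.Coprime.mul_right ?_ ?_
    · exact hk1.gcd_eq.trans hac
    · refine hk2.gcd_eq.trans ?_
      have : 2 * (a - 1) = (2 * (a - 1) - 1) + 1 := by omega
      conv_lhs => rw [this]
      simp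
  obtain ⟨b, hbr, hb, hbk⟩ := Nat.forall_exists_prime_gt_and_modEq r
    (Nat.mul_ne_zero (Nat.mul_ne_zero hq.ne_zero (pow_ne_zero _ hr.ne_zero)) (by omega)) hkc
  have hb1 : b ≡ a [MOD q * r ^ j] := (hbk.of_mul_right _).trans hk1
  have hb2 : b ≡ 2 * (a - 1) - 1 [MOD 2 * (a - 1)] := (hbk.of_mul_left _).trans hk2
  obtain ⟨l, hl⟩ : 2 * (a - 1) ∣ b + 1 := by
    have := hb2.add_right 1
    rw [Nat.sub_add_cancel (by omega)] at this
    exact (Nat.modEq_zero_iff_dvd.mp (this.trans (by simp [Nat.ModEq])))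
  obtain ⟨N, hN⟩ : ∃ N, (a - 1) * l = N + 1 := ⟨(a - 1) * l - 1, by
    have : 0 < (a - 1) * l := by
      rw [mul_assoc] at hl; omega
    omega⟩
  have hbN : b = 2 * N + 1 := by rw [mul_assoc] at hl; omega
  have hbZ : (q * r ^ j : ℤ) ∣ b - a := by exact_mod_cast hb1.symm.dvd
  have hbq : (q : ℤ) ∣ b - a := (dvd_mul_right _ _).trans hbZ
  have hrb : ¬ (r : ℤ) ∣ b := by
    intro h
    have := (Nat.prime_dvd_prime_iff_eq hr hb).mp (by exact_mod_cast h)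
    omega
  obtain ⟨t, ht⟩ := exists_pow_dvd_pow_mul_sub hr (by omega) hj1 h1 h2 hrb
    ((dvd_mul_left _ _).trans hbZ) N
  have := Fact.mk hb
  have hr0 : (r : ZMod b) ≠ 0 := by
    rw [Ne, ZMod.natCast_eq_zero_iff]
    exact fun h ↦ absurd (Nat.le_of_dvd hr.pos h) (by omega)
  have hε : ∃ ε : ℤ, (ε = 1 ∨ ε = -1) ∧ (b : ℤ) ∣ (r : ℤ) ^ N - ε := by
    have := ZMod.pow_div_two_eq_neg_one_or_one b hr0
    rw [show b / 2 = N by omega] at this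
    rcases this with h | h
    · exact ⟨1, Or.inl rfl, (ZMod.intCast_zmod_eq_zero_iff_dvd _ _).mp (by push_cast; rw [h]; simp)⟩
    · exact ⟨-1, Or.inr rfl, (ZMod.intCast_zmod_eq_zero_iff_dvd _ _).mp (by push_cast; rw [h]; simp)⟩
  obtain ⟨ε, hε1, hε2⟩ := hε
  refine ⟨b, N, (r - 1) * t, ε, hε1, hε2, ?_, hbq, ?_⟩
  · have := (hpc hr ha (by omega)).pow l
    rw [one_pow, ← pow_mul, hN] at this
    exact this.symm.dvd
  · rw [← mul_assoc, pow_mul, ← hg]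
    have hqr : IsCoprime (q : ℤ) ((r : ℤ) ^ N) :=
      (Nat.isCoprime_iff_coprime.mpr ((Nat.coprime_primes hq hr).mpr hrq.ne)).pow_right
    refine hqr.mul_dvd ?_ ht
    have hgq : (q : ℤ) ∣ g ^ t - 1 := by
      have := (hpc hp hq hpq).pow ((r - 1) * t)
      rw [one_pow, ← pow_mul, ← mul_assoc, pow_mul] at this
      exact this.symm.dvd
    have e : g ^ t * b - a = (g ^ t - 1) * b + (b - a) := by ring
    rw [e]
    exact dvd_add (hgq.mul_right _) hbq

/-- The elementary matrix `(1, x; 0, 1)`. -/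
def upperElem {A : Type*} [CommRing A] (x : A) : SpecialLinearGroup (Fin 2) A :=
  ⟨!![1, x; 0, 1], by simp [det_fin_two]⟩

/-- The elementary matrix `(1, 0; x, 1)`. -/
def lowerElem {A : Type*} [CommRing A] (x : A) : SpecialLinearGroup (Fin 2) A :=
  ⟨!![1, 0; x, 1], by simp [det_fin_two]⟩

/-- The diagonal matrix `(u, 0; 0, u⁻¹)`. -/
def diagElem {A : Type*} [CommRing A] (u : Aˣ) : SpecialLinearGroup (Fin 2) A :=
  ⟨!![(u : A), 0; 0, ((u⁻¹ : Aˣ) : A)], by simp [det_fin_two]⟩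

/-- The column `(a, c)` can be moved to `(a', c')` by an element of `K`. -/
def ColRel {A : Type*} [CommRing A] (K : Subgroup (SpecialLinearGroup (Fin 2) A))
    (a c a' c' : A) : Prop :=
  ∃ k ∈ K, (k : Matrix (Fin 2) (Fin 2) A) *ᵥ ![a, c] = ![a', c']

section ColRel

variable {A : Type*} [CommRing A] {K : Subgroup (SpecialLinearGroup (Fin 2) A)}

theorem ColRel.trans {a c a' c' a'' c'' : A} (h : ColRel K a c a' c') (h' : ColRel K a' c' a'' c'') :
    ColRel K a c a'' c'' := by
  obtain ⟨k, hk, e⟩ := h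
  obtain ⟨k', hk', e'⟩ := h'
  refine ⟨k' * k, K.mul_mem hk' hk, ?_⟩
  change ((k' : Matrix (Fin 2) (Fin 2) A) * (k : Matrix (Fin 2) (Fin 2) A)) *ᵥ ![a, c] = _
  rw [← mulVec_mulVec, e, e']

theorem ColRel.of_dvd_left (hK : ∀ x, upperElem x ∈ K) {a a' c : A} (h : c ∣ a' - a) :
    ColRel K a c a' c := by
  obtain ⟨x, hx⟩ := h
  refine ⟨upperElem x, hK x, ?_⟩
  ext i
  fin_cases i
  · simp [upperElem]; linear_combination -hx
  · simp [upperElem]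

theorem ColRel.of_dvd_right {q : A} (hK : ∀ x, lowerElem (q * x) ∈ K) {a c c' : A}
    (h : q * a ∣ c' - c) : ColRel K a c a c' := by
  obtain ⟨x, hx⟩ := h
  refine ⟨lowerElem (q * x), hK x, ?_⟩
  ext i
  fin_cases i
  · simp [lowerElem]
  · simp [lowerElem]; linear_combination -hx

theorem ColRel.of_unit_mul (u : Aˣ) {a c a' c' : A}
    (h : ColRel K (u * a) (u * c) (u * a') (u * c')) : ColRel K a c a' c' := by
  obtain ⟨k, hk, e⟩ := h
  refine ⟨k, hk, ?_⟩
  have h0 := congrFun e 0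
  have h1 := congrFun e 1
  simp [mulVec, dotProduct, Fin.sum_univ_two] at h0 h1
  ext i
  fin_cases i
  · simp [mulVec, dotProduct, Fin.sum_univ_two]
    exact u.isUnit.mul_left_cancel (by linear_combination h0)
  · simp [mulVec, dotProduct, Fin.sum_univ_two]
    exact u.isUnit.mul_left_cancel (by linear_combination h1)

theorem mem_of_colRel (hK : ∀ x, upperElem x ∈ K) {M : SpecialLinearGroup (Fin 2) A}
    (h : ColRel K (M 0 0) (M 1 0) 1 0) : M ∈ K := by
  obtain ⟨k, hk, e⟩ := h
  have h0 := congrFun e 0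
  have h1 := congrFun e 1
  simp [mulVec, dotProduct, Fin.sum_univ_two] at h0 h1
  have h00 : (k * M) 0 0 = 1 := by
    simpa [Matrix.mul_apply, Fin.sum_univ_two] using h0
  have h10 : (k * M) 1 0 = 0 := by
    simpa [Matrix.mul_apply, Fin.sum_univ_two] using h1
  have h11 : (k * M) 1 1 = 1 := by
    have := (k * M).det_coe
    rw [det_fin_two] at this
    simpa [h00, h10] using this
  have hkM : k * M = upperElem ((k * M) 0 1) := by
    ext i j
    fin_cases i <;> fin_cases j
    · exact h00
    · rfl
    · exact h10
    · exact h11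
  exact (K.mul_mem_cancel_left hk).mp (hkM ▸ hK _)

theorem diagElem_mem {q : A} (hu : ∀ x, upperElem x ∈ K) (hl : ∀ x, lowerElem (q * x) ∈ K)
    {w : Aˣ} (hw : q ∣ (w : A) - 1) : diagElem w ∈ K := by
  have hw' : q ∣ 1 - (w : A) := (dvd_sub_comm).mp hw
  refine mem_of_colRel hu (?_ : ColRel K (w : A) 0 1 0)
  refine (ColRel.of_dvd_right hl (c' := 1 - (w : A)) ?_).trans
    ((ColRel.of_dvd_left hu dvd_rfl).trans (ColRel.of_dvd_right hl ?_))
  · rw [sub_zero]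
    exact (w.isUnit.dvd_mul_right.mp (by simp) : (q * w ∣ q)).trans hw'
  · rwa [mul_one, zero_sub, dvd_neg]

theorem ColRel.of_diagElem {q : A} (hu : ∀ x, upperElem x ∈ K) (hl : ∀ x, lowerElem (q * x) ∈ K)
    {w : Aˣ} (hw : q ∣ (w : A) - 1) (a c : A) : ColRel K (w * a) c a (w * c) := by
  refine ⟨(diagElem w)⁻¹, K.inv_mem (diagElem_mem hu hl hw), ?_⟩
  rw [SpecialLinearGroup.SL2_inv_expl]
  ext i
  fin_cases i <;> simp [diagElem, mulVec, dotProduct, Fin.sum_univ_two]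

/-- Columns `(a, c)` with `a ≡ 1` and `c ≡ 0` modulo `q` are moved to `(1, 0)` by any subgroup
containing the elementary matrices of `Γ₀(q)`. -/
theorem ColRel.to_one_zero [IsDomain A] [CharZero A] {q : ℕ} (hq : q.Prime)
    (hqA : ∀ z : ℤ, (q : A) ∣ z → (q : ℤ) ∣ z)
    (dirichlet : ∀ x c : A, c ≠ 0 → IsCoprime x c →
      ∀ n : ℕ, ∃ p > n, p.Prime ∧ c ∣ x - (p : A))
    {p : ℕ} (hp : p.Prime) (hpA : IsUnit (p : A))
    (l : Aˣ) (hl1 : IsUnit ((l : A) ^ 2 - 1))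
    (hu : ∀ x, upperElem x ∈ K) (hl : ∀ x, lowerElem ((q : A) * x) ∈ K)
    {a c : A} (hac : IsCoprime a c) (hc0 : c ≠ 0) (ha : (q : A) ∣ a - 1) (hc : (q : A) ∣ c) :
    ColRel K a c 1 0 := by
  have hqu : ¬ IsUnit (q : A) := fun h ↦ by
    have := hqA 1 (h.dvd)
    exact (Nat.prime_iff_prime_int.mp hq).not_dvd_one this
  have hql : ¬ (q : A) ∣ l - 1 := fun h ↦ hqu (isUnit_of_dvd_unit
    (h.trans ⟨l + 1, by ring⟩) hl1)
  have hpq : p ≠ q := by rintro rfl; exact hqu hpA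
  have hq2 : q ≠ 2 := by
    rintro rfl
    obtain ⟨r, hr2, hr, h⟩ := dirichlet l 2 two_ne_zero
      ⟨((l⁻¹ : Aˣ) : A), 0, by simp⟩ 2
    have : (2 : A) ∣ (r : A) - 1 := by
      obtain ⟨k, hk⟩ := hr.odd_of_ne_two (by omega)
      exact ⟨k, by rw [hk]; push_cast; ring⟩
    exact hql (by simpa using dvd_add h this)
  obtain ⟨c₁, rfl⟩ := hc
  refine ColRel.of_unit_mul l ?_
  rw [mul_one, mul_zero, show (l : A) * (q * c₁) = q * (l * c₁) by ring]
  set c' : A := l * c₁ with hc'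
  have hcop : IsCoprime (l * a : A) (q * c') := by
    rw [hc', show (q : A) * (l * c₁) = l * (q * c₁) by ring]
    exact (isCoprime_mul_unit_left l.isUnit _ _).mpr hac
  have hc'0 : (q : A) * c' ≠ 0 := by
    rw [hc', show (q : A) * (l * c₁) = l * (q * c₁) by ring]
    exact mul_ne_zero l.ne_zero hc0
  obtain ⟨a₀, ha₀q, ha₀, hda₀⟩ := dirichlet _ _ hc'0 hcop q
  refine (ColRel.of_dvd_left hu (a' := (a₀ : A)) (dvd_sub_comm.mp hda₀)).trans ?_
  have hla₀ : (q : A) ∣ l - a₀ := by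
    have h1 : (q : A) ∣ l * a - a₀ := (dvd_mul_right _ _).trans hda₀
    have e : (l : A) - a₀ = (l * a - a₀) - l * (a - 1) := by ring
    rw [e]
    exact dvd_sub h1 (ha.mul_left _)
  have hqa₀ : ¬ q ∣ a₀ - 1 := by
    intro h
    have h' := (map_dvd (Nat.castRingHom A) h)
    simp only [Nat.coe_castRingHom, Nat.cast_sub ha₀.one_le, Nat.cast_one] at h'
    exact hql (by simpa using dvd_add hla₀ h')
  obtain ⟨u, v, huv⟩ : IsCoprime (a₀ : A) c' := by
    obtain ⟨k, hk⟩ := hda₀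
    have : (a₀ : A) = l * a + (q * c') * (-k) := by linear_combination -hk
    rw [this]
    exact (hcop.add_mul_left_left _).of_isCoprime_of_dvd_right (dvd_mul_left _ _)
  obtain ⟨r, hrB, hr, hvr⟩ := dirichlet v a₀ (by exact_mod_cast ha₀.ne_zero)
    ⟨c', u, by linear_combination huv⟩ (2 * a₀ + p + q)
  obtain ⟨b, N, t, ε, hε, hb, hN, hbq, hW⟩ := exists_prime_dvd_pow_mul_sub hp hq hpq hq2 ha₀
    (by omega) hqa₀ hr (by omega) (by omega) (by omega)
  have cast_dvd {m n : ℤ} (h : m ∣ n) : (m : A) ∣ n := map_dvd (Int.castRingHom A) h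
  have hb := cast_dvd hb
  have hN := cast_dvd hN
  have hbq := cast_dvd hbq
  have hW := cast_dvd hW
  push_cast at hb hN hbq hW
  obtain ⟨w, hw⟩ : IsUnit ((p : A) ^ ((q - 1) * t)) := hpA.pow _
  rw [← hw] at hW
  have hw1 : (q : A) ∣ w - 1 := by
    have h := (Int.ModEq.pow_card_sub_one_eq_one hq (Nat.isCoprime_iff_coprime.mpr
      ((Nat.coprime_primes hp hq).mpr hpq))).pow t
    rw [one_pow, ← pow_mul] at h
    have := cast_dvd h.symm.dvd
    push_cast at this
    rwa [hw]
  obtain ⟨e, he⟩ : IsUnit (ε : A) := by rcases hε with rfl | rfl <;> simp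
  rw [← he] at hb
  refine (ColRel.of_dvd_right hl (c' := (q : A) * r ^ N) ?_).trans
    ((ColRel.of_dvd_left hu hW).trans
    ((ColRel.of_diagElem hu hl hw1 _ _).trans
    ((ColRel.of_dvd_right hl (c' := (q : A) * ((e * w : Aˣ) : A)) ?_).trans
    ((ColRel.of_dvd_left hu (a' := (l : A)) ?_).trans (ColRel.of_dvd_right hl ?_)))))
  · rw [← mul_sub]
    refine mul_dvd_mul_left _ ?_
    obtain ⟨k, hk⟩ := hvr
    obtain ⟨m, hm⟩ := hN
    exact ⟨r ^ N * u + r ^ N * k * c' + c' * m, by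
      linear_combination -r ^ N * huv + r ^ N * c' * hk + c' * hm⟩
  · rw [Units.val_mul, show (q : A) * (e * w) - w * (q * r ^ N) = -(q * (r ^ N - e) * w) by ring,
      dvd_neg]
    exact (mul_dvd_mul_left _ hb).mul_right _
  · rw [Units.mul_right_dvd]
    simpa using dvd_sub hla₀ hbq
  · rw [zero_sub, dvd_neg, Units.mul_right_dvd]
    exact dvd_mul_right _ _

end ColRel

section ZS

variable {S : Set ℕ}

theorem ZS.den_induction {P : ℕ → Prop} (h1 : P 1) (hmul : ∀ m n, P m → P n → P (m * n))
    (hdvd : ∀ m n, m ∣ n → P n → P m) (hS : ∀ p ∈ S, p.Prime → P p)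
    (hSprime : ∀ p ∈ S, Nat.Prime p) {x : ℚ} (hx : x ∈ ZS S) : P x.den := by
  induction hx using Subring.closure_induction with
  | mem x hx =>
    obtain ⟨p, hp, rfl⟩ := hx
    simpa [(hSprime p hp).ne_zero] using hS p hp (hSprime p hp)
  | zero => simpa using h1
  | one => simpa using h1
  | add x y _ _ hx hy => exact hdvd _ _ (Rat.add_den_dvd x y) (hmul _ _ hx hy)
  | neg x _ hx => simpa using hx
  | mul x y _ _ hx hy => exact hdvd _ _ (Rat.mul_den_dvd x y) (hmul _ _ hx hy)

theorem ZS.isUnit_natCast_of_mem (hSprime : ∀ p ∈ S, Nat.Prime p) {p : ℕ} (hp : p ∈ S) :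
    IsUnit (p : ZS S) := by
  refine .of_mul_eq_one (⟨(p : ℚ)⁻¹, Subring.subset_closure ⟨p, hp, rfl⟩⟩ : ZS S) (Subtype.ext ?_)
  simp [(hSprime p hp).ne_zero]

theorem ZS.isUnit_den (hSprime : ∀ p ∈ S, Nat.Prime p) (x : ZS S) :
    IsUnit (((x : ℚ).den : ℕ) : ZS S) := by
  refine ZS.den_induction (P := fun n ↦ IsUnit (n : ZS S)) (by simp) ?_ ?_ ?_ hSprime x.2
  · intro m n hm hn
    rw [Nat.cast_mul]
    exact hm.mul hn
  · intro m n h hn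
    exact isUnit_of_dvd_unit (map_dvd (Nat.castRingHom (ZS S)) h) hn
  · intro p hp _
    exact ZS.isUnit_natCast_of_mem hSprime hp

theorem ZS.not_dvd_den (hSprime : ∀ p ∈ S, Nat.Prime p) {q : ℕ} (hq : q.Prime) (hqS : q ∉ S)
    (x : ZS S) : ¬ q ∣ (x : ℚ).den := by
  refine ZS.den_induction (P := fun n ↦ ¬ q ∣ n) hq.not_dvd_one ?_ ?_ ?_ hSprime x.2
  · intro m n hm hn h
    exact (hq.dvd_mul.mp h).elim hm hn
  · intro m n h hn h'
    exact hn (h'.trans h)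
  · intro p hp hp' h
    exact hqS ((Nat.prime_dvd_prime_iff_eq hq hp').mp h ▸ hp)

theorem ZS.mul_den (x : ZS S) : x * (((x : ℚ).den : ℕ) : ZS S) = (((x : ℚ).num : ℤ) : ZS S) :=
  Subtype.ext (by simp [Rat.mul_den_eq_num])

theorem ZS.dvd_of_natCast_dvd_intCast (hSprime : ∀ p ∈ S, Nat.Prime p) {q : ℕ} (hq : q.Prime)
    (hqS : q ∉ S) {z : ℤ} (h : (q : ZS S) ∣ z) : (q : ℤ) ∣ z := by
  obtain ⟨x, hx⟩ := h
  have e : z * ((x : ℚ).den : ℤ) = q * (x : ℚ).num := by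
    have : (z : ZS S) * (((x : ℚ).den : ℕ) : ZS S) = q * (((x : ℚ).num : ℤ) : ZS S) := by
      rw [hx, mul_assoc, ZS.mul_den]
    exact_mod_cast this
  refine ((Nat.prime_iff_prime_int.mp hq).dvd_or_dvd (Dvd.intro _ e.symm)).resolve_right ?_
  exact_mod_cast ZS.not_dvd_den hSprime hq hqS x

/-- Dirichlet's theorem on primes in arithmetic progressions, for the ring `ℤ_S`. -/
theorem ZS.exists_prime_gt_dvd_sub (hSprime : ∀ p ∈ S, Nat.Prime p) (x c : ZS S) (hc : c ≠ 0)
    (hxc : IsCoprime x c) (B : ℕ) : ∃ p > B, p.Prime ∧ c ∣ x - (p : ZS S) := by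
  classical
  have hex : ∃ n : ℕ, 0 < n ∧ c ∣ (n : ZS S) := by
    refine ⟨(c : ℚ).num.natAbs, by simpa using hc, ?_⟩
    have h : c ∣ (((c : ℚ).num : ℤ) : ZS S) := Dvd.intro _ (ZS.mul_den c)
    have h' := h.trans (map_dvd (Int.castRingHom (ZS S)) (Int.dvd_natAbs_self (a := (c : ℚ).num)))
    rwa [eq_intCast, Int.cast_natCast] at h'
  set n := Nat.find hex
  obtain ⟨hn0, hcn⟩ : 0 < n ∧ c ∣ (n : ZS S) := Nat.find_spec hex
  have hmin {g : ℕ} (hg : g ∣ n) (hgc : IsCoprime c (g : ZS S)) : g = 1 := by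
    obtain ⟨m, hm⟩ := hg
    have hm0 : 0 < m := Nat.pos_of_ne_zero (by rintro rfl; omega)
    have hcm : c ∣ (m : ZS S) := hgc.dvd_of_dvd_mul_left (by rw [hm] at hcn; exact_mod_cast hcn)
    have hle : n ≤ m := Nat.find_min' hex ⟨hm0, hcm⟩
    have hg0 : g ≠ 0 := by rintro rfl; omega
    have : g * m ≤ 1 * m := by omega
    have := Nat.le_of_mul_le_mul_right this hm0
    omega
  obtain ⟨u, v, huv⟩ : IsCoprime ((x : ℚ).den : ℤ) (n : ℤ) := by
    rw [Nat.isCoprime_iff_coprime]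
    refine hmin (Nat.gcd_dvd_right _ _) (IsCoprime.symm ?_)
    have := isUnit_of_dvd_unit (map_dvd (Nat.castRingHom (ZS S))
      (Nat.gcd_dvd_left (x : ℚ).den n)) (ZS.isUnit_den hSprime x)
    exact isCoprime_one_left.of_isCoprime_of_dvd_left this.dvd
  have huv' : (u : ZS S) * (((x : ℚ).den : ℕ) : ZS S) + v * n = 1 := by exact_mod_cast huv
  set k : ℤ := (x : ℚ).num * u with hk
  have hxk : c ∣ x - k := by
    have : x - k = n * (v * x) := by
      rw [hk, Int.cast_mul, ← ZS.mul_den]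
      linear_combination -x * huv'
    rw [this]
    exact hcn.mul_right _
  have hkc : IsCoprime (k : ZS S) c := by
    obtain ⟨y, hy⟩ := hxk
    have : (k : ZS S) = x + c * (-y) := by linear_combination -hy
    rw [this]
    exact hxc.add_mul_left_left _
  have hkn : IsCoprime k (n : ℤ) := by
    rw [Int.isCoprime_iff_gcd_eq_one]
    refine hmin (Int.natCast_dvd_natCast.mp (Int.gcd_dvd_right _ _))
      (hkc.symm.of_isCoprime_of_dvd_right ?_)
    simpa using map_dvd (Int.castRingHom (ZS S)) (Int.gcd_dvd_left k n)
  obtain ⟨p, hpB, hp, hpk⟩ := Nat.forall_exists_prime_gt_and_zmodEq B hn0.ne' hkn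
  refine ⟨p, hpB, hp, ?_⟩
  have h := hcn.trans (by simpa using map_dvd (Int.castRingHom (ZS S)) hpk.dvd)
  simpa using dvd_add hxk h

/-- Reduction modulo `q` as a ring homomorphism on `ℤ_S`, for a prime `q ∉ S`. -/
def ZS.reduce (hSprime : ∀ p ∈ S, Nat.Prime p) (q : ℕ) [hq : Fact q.Prime] (hqS : q ∉ S) :
    ZS S →+* ZMod q :=
  have hden (x : ZS S) : ((x : ℚ).den : ZMod q) ≠ 0 := by
    rw [Ne, ZMod.natCast_eq_zero_iff]
    exact ZS.not_dvd_den hSprime hq.out hqS x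
  { toFun := fun x ↦ ratMod q x
    map_one' := by simp [ratMod]
    map_zero' := by simp [ratMod]
    map_mul' := fun x y ↦ by
      simpa only [Rat.cast_def, ratMod, div_eq_mul_inv, Subring.coe_mul] using
        Rat.cast_mul_of_ne_zero (hden x) (hden y)
    map_add' := fun x y ↦ by
      simpa only [Rat.cast_def, ratMod, div_eq_mul_inv, Subring.coe_add] using
        Rat.cast_add_of_ne_zero (hden x) (hden y) }

theorem ZS.reduce_eq_zero_iff (hSprime : ∀ p ∈ S, Nat.Prime p) {q : ℕ} [hq : Fact q.Prime]
    (hqS : q ∉ S) (x : ZS S) : ZS.reduce hSprime q hqS x = 0 ↔ (q : ZS S) ∣ x := by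
  constructor
  · intro h
    have h' : ZS.reduce hSprime q hqS (((x : ℚ).num : ℤ) : ZS S) = 0 := by
      rw [← ZS.mul_den, map_mul, h, zero_mul]
    rw [map_intCast, ZMod.intCast_zmod_eq_zero_iff_dvd] at h'
    have h2 := map_dvd (Int.castRingHom (ZS S)) h'
    rw [eq_intCast, eq_intCast, ← ZS.mul_den] at h2
    exact (ZS.isUnit_den hSprime x).dvd_mul_right.mp (by exact_mod_cast h2)
  · rintro ⟨y, rfl⟩
    simp

end ZS

section Gamma0

open scoped commutatorElement

variable {A : Type*} [CommRing A]

theorem diagElem_commutator_upperElem (u : Aˣ) (x : A) :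
    ⁅diagElem u, upperElem x⁆ = upperElem (((u : A) ^ 2 - 1) * x) := by
  rw [commutatorElement_def, mul_inv_eq_iff_eq_mul, mul_inv_eq_iff_eq_mul]
  refine Subtype.ext ?_
  change !![(u : A), 0; 0, ((u⁻¹ : Aˣ) : A)] * !![1, x; 0, 1] =
    !![1, ((u : A) ^ 2 - 1) * x; 0, 1] * !![1, x; 0, 1] * !![(u : A), 0; 0, ((u⁻¹ : Aˣ) : A)]
  ext i j
  fin_cases i <;> fin_cases j <;> simp
  linear_combination (-(u : A) * x) * u.mul_inv

theorem diagElem_commutator_lowerElem (u : Aˣ) (x : A) :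
    ⁅diagElem u⁻¹, lowerElem x⁆ = lowerElem (((u : A) ^ 2 - 1) * x) := by
  rw [commutatorElement_def, mul_inv_eq_iff_eq_mul, mul_inv_eq_iff_eq_mul]
  refine Subtype.ext ?_
  change !![((u⁻¹ : Aˣ) : A), 0; 0, (u : A)] * !![1, 0; x, 1] =
    !![1, 0; ((u : A) ^ 2 - 1) * x, 1] * !![1, 0; x, 1] * !![((u⁻¹ : Aˣ) : A), 0; 0, (u : A)]
  ext i j
  fin_cases i <;> fin_cases j <;> simp
  linear_combination (-(u : A) * x) * u.mul_inv

theorem mem_Gamma0_span {q : A} {g : SpecialLinearGroup (Fin 2) A} :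
    g ∈ Gamma0 A (Ideal.span {q}) ↔ q ∣ g 1 0 :=
  Ideal.mem_span_singleton

theorem upperElem_mem_map_commutator (l : Aˣ) (hl : IsUnit ((l : A) ^ 2 - 1)) (I : Ideal A) (x : A) :
    upperElem x ∈ (commutator (Gamma0 A I)).map (Gamma0 A I).subtype := by
  obtain ⟨v, hv⟩ := hl
  rw [Subgroup.map_subtype_commutator,
    show x = ((l : A) ^ 2 - 1) * (((v⁻¹ : Aˣ) : A) * x) by rw [← hv, Units.mul_inv_cancel_left],
    ← diagElem_commutator_upperElem]
  refine Subgroup.commutator_mem_commutator ?_ ?_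
  · exact (by simp [diagElem] : (diagElem l) 1 0 ∈ I)
  · exact (by simp [upperElem] : (upperElem _) 1 0 ∈ I)

theorem lowerElem_mem_map_commutator (l : Aˣ) (hl : IsUnit ((l : A) ^ 2 - 1)) (I : Ideal A) {x : A}
    (hx : x ∈ I) :
    lowerElem x ∈ (commutator (Gamma0 A I)).map (Gamma0 A I).subtype := by
  obtain ⟨v, hv⟩ := hl
  rw [Subgroup.map_subtype_commutator,
    show x = ((l : A) ^ 2 - 1) * (((v⁻¹ : Aˣ) : A) * x) by rw [← hv, Units.mul_inv_cancel_left],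
    ← diagElem_commutator_lowerElem]
  refine Subgroup.commutator_mem_commutator ?_ ?_
  · exact (by simp [diagElem] : (diagElem l⁻¹) 1 0 ∈ I)
  · exact (by simpa [lowerElem] using hx : lowerElem (((v⁻¹ : Aˣ) : A) * x) 1 0 ∈ I)

/-- If `f` is a ring homomorphism killing `I`, then `g ↦ f (g 0 0)` is multiplicative on `Γ₀(I)`. -/
def Gamma0.entryHom {B : Type*} [CommRing B] {I : Ideal A} (f : A →+* B) (hf : ∀ x ∈ I, f x = 0) :
    Gamma0 A I →* B where
  toFun g := f ((g : SpecialLinearGroup (Fin 2) A) 0 0)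
  map_one' := by simp
  map_mul' g h := by
    have := hf _ h.2
    simp [Matrix.mul_apply, Fin.sum_univ_two, this]

end Gamma0

/-- let `A = ℤ_S` contain a unit `λ` with `λ² − 1` a unit, and let `q` be a prime
not in `S`.  Then the map `Γ₀(qA) → (ℤ/qℤ)^×`, `(a, b; c, d) ↦ a mod q`, is a surjective group
homomorphism whose kernel is the commutator subgroup of `Γ₀(qA)`; hence it induces an
isomorphism of the abelianization of `Γ₀(qA)` onto `(ℤ/qℤ)^×`. -/
theorem stmt8 (S : Set ℕ) (hS : S.Nonempty) (hSprime : ∀ p ∈ S, Nat.Prime p)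
    (hlam : ∃ lam : (ZS S)ˣ, IsUnit ((lam : ZS S) ^ 2 - 1))
    (q : ℕ) (hq : Nat.Prime q) (hqS : q ∉ S) :
    ∃ ρ : ↥(Gamma0 (ZS S) (Ideal.span {(q : ZS S)})) →* (ZMod q)ˣ,
      (∀ g, (ρ g : ZMod q) =
        ratMod q (((↑(↑g : Matrix.SpecialLinearGroup (Fin 2) (ZS S))
          : Matrix (Fin 2) (Fin 2) (ZS S)) 0 0 : ℚ))) ∧
      Function.Surjective ρ ∧
      ρ.ker = commutator ↥(Gamma0 (ZS S) (Ideal.span {(q : ZS S)})) := by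
  have : Fact q.Prime := ⟨hq⟩
  obtain ⟨l, hl⟩ := hlam
  obtain ⟨p, hp⟩ := hS
  have hπ := ZS.reduce_eq_zero_iff hSprime hqS
  set π := ZS.reduce hSprime q hqS
  let ρ := (Gamma0.entryHom (I := Ideal.span {(q : ZS S)}) π
    fun x hx ↦ (hπ x).mpr (Ideal.mem_span_singleton.mp hx)).toHomUnits
  have hρ (g) : (ρ g : ZMod q) = π ((g : SpecialLinearGroup (Fin 2) (ZS S)) 0 0) := rfl
  refine ⟨ρ, fun g ↦ rfl, fun t ↦ ?_, le_antisymm ?_ (Abelianization.commutator_subset_ker ρ)⟩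
  · obtain ⟨u, v, huv⟩ := Nat.isCoprime_iff_coprime.mpr (ZMod.val_coe_unit_coprime t)
    have huv' : (u : ZS S) * ((t : ZMod q).val : ZS S) + v * q = 1 := by exact_mod_cast huv
    refine ⟨⟨⟨!![((t : ZMod q).val : ZS S), -v; q, u], ?_⟩, ?_⟩, Units.ext ?_⟩
    · rw [det_fin_two_of]
      linear_combination huv'
    · exact Ideal.mem_span_singleton.mpr (by simp)
    · rw [hρ]
      simp
  · intro g hg
    have hu := upperElem_mem_map_commutator l hl (Ideal.span {(q : ZS S)})
    have hlow (x : ZS S) := lowerElem_mem_map_commutator l hl (Ideal.span {(q : ZS S)})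
      (Ideal.mem_span_singleton.mpr (dvd_mul_right (q : ZS S) x))
    obtain ⟨M, hM⟩ := g
    have hc : (q : ZS S) ∣ M 1 0 := mem_Gamma0_span.mp hM
    have ha : (q : ZS S) ∣ M 0 0 - 1 := by
      have : π (M 0 0) = 1 := congrArg Units.val (MonoidHom.mem_ker.mp hg)
      rw [← hπ, map_sub, map_one, this, sub_self]
    have hdet := M.det_coe
    rw [det_fin_two] at hdet
    have key {c : ZS S} (hac : IsCoprime (M 0 0) c) (hc0 : c ≠ 0) (hc : (q : ZS S) ∣ c) :=
      ColRel.to_one_zero hq (fun z ↦ ZS.dvd_of_natCast_dvd_intCast hSprime hq hqS)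
        (ZS.exists_prime_gt_dvd_sub hSprime) (hSprime p hp) (ZS.isUnit_natCast_of_mem hSprime hp)
        l hl hu hlow hac hc0 ha hc
    suffices h : M ∈ (commutator (Gamma0 (ZS S) (Ideal.span {(q : ZS S)}))).map
        (Gamma0 (ZS S) (Ideal.span {(q : ZS S)})).subtype by
      obtain ⟨g', hg', rfl⟩ := h
      exact hg'
    refine mem_of_colRel hu ?_
    rcases eq_or_ne (M 1 0) 0 with h0 | h0
    · rw [h0] at hdet ⊢
      have hunit : IsUnit (M 0 0) := .of_mul_eq_one (M 1 1) (by simpa using hdet)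
      refine (ColRel.of_dvd_right hlow (c' := q * M 0 0) (by simp)).trans (key ?_ ?_ ?_)
      · exact isCoprime_one_left.of_isCoprime_of_dvd_left hunit.dvd
      · exact mul_ne_zero (Nat.cast_ne_zero.mpr hq.ne_zero) hunit.ne_zero
      · exact dvd_mul_right _ _
    · exact key ⟨M 1 1, -M 0 1, by linear_combination hdet⟩ h0 hc
end

section
/- Let S be a nonempty set of prime numbers and let q be a prime number not in S. Suppose there exists λ ∈ (ℤ_{S∪{q}})^× such that λ² − 1 ∈ (ℤ_{S∪{q}})^× as well. Then the abelianization of the principal congruence subgroup Γ(q·ℤ_S) ⊆ SL₂(ℤ_S) is a finite abelian q-group (a finite group whose order is a power of q), and the same holds for the abelianization of Γ̃′(q·ℤ_S). -/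
open Matrix

/-- The principal congruence subgroup `Γ(I)` of `SL₂(A)`: the kernel of reduction mod `I`. -/
def Gamma (A : Type*) [CommRing A] (I : Ideal A) :
    Subgroup (Matrix.SpecialLinearGroup (Fin 2) A) :=
  (Matrix.SpecialLinearGroup.map (Ideal.Quotient.mk I)).ker

/-- The subgroup `Γ̃′(𝔭ⁿ)` of `SL₂(A)`: matrices `(a, b; c, d)` with `a - 1, d - 1 ∈ 𝔭ⁿ`,
`c ∈ 𝔭ⁿ⁺¹` and `b ∈ 𝔭ⁿ⁻¹`. -/
def GammaTilde' (A : Type*) [CommRing A] (p : Ideal A) (n : ℕ) :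
    Subgroup (Matrix.SpecialLinearGroup (Fin 2) A) where
  carrier := {g | (↑g : Matrix (Fin 2) (Fin 2) A) 0 0 - 1 ∈ p ^ n ∧
    (↑g : Matrix (Fin 2) (Fin 2) A) 1 1 - 1 ∈ p ^ n ∧
    (↑g : Matrix (Fin 2) (Fin 2) A) 1 0 ∈ p ^ (n + 1) ∧
    (↑g : Matrix (Fin 2) (Fin 2) A) 0 1 ∈ p ^ (n - 1)}
  one_mem' := by
    simp [Matrix.SpecialLinearGroup.coe_one, Matrix.one_apply]
  mul_mem' := by
    rintro g h ⟨ha, hd, hc, hb⟩ ⟨ha', hd', hc', hb'⟩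
    have hmul : ∀ i j, (↑(g * h) : Matrix (Fin 2) (Fin 2) A) i j =
        (↑g : Matrix (Fin 2) (Fin 2) A) i 0 * (↑h : Matrix (Fin 2) (Fin 2) A) 0 j +
        (↑g : Matrix (Fin 2) (Fin 2) A) i 1 * (↑h : Matrix (Fin 2) (Fin 2) A) 1 j := by
      intro i j
      simp [Matrix.SpecialLinearGroup.coe_mul, Matrix.mul_apply, Fin.sum_univ_two]
    have hple : p ^ (n + 1) ≤ p ^ n := Ideal.pow_le_pow_right (Nat.le_succ n)
    refine ⟨?_, ?_, ?_, ?_⟩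
    · rw [hmul]
      have : (↑g : Matrix (Fin 2) (Fin 2) A) 0 0 * (↑h : Matrix (Fin 2) (Fin 2) A) 0 0 +
          (↑g : Matrix (Fin 2) (Fin 2) A) 0 1 * (↑h : Matrix (Fin 2) (Fin 2) A) 1 0 - 1 =
          ((↑g : Matrix (Fin 2) (Fin 2) A) 0 0 - 1) * (↑h : Matrix (Fin 2) (Fin 2) A) 0 0 +
          ((↑h : Matrix (Fin 2) (Fin 2) A) 0 0 - 1) +
          (↑g : Matrix (Fin 2) (Fin 2) A) 0 1 * (↑h : Matrix (Fin 2) (Fin 2) A) 1 0 := by ring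
      rw [this]
      exact add_mem (add_mem (Ideal.mul_mem_right _ _ ha) ha')
        (Ideal.mul_mem_left _ _ (hple hc'))
    · rw [hmul]
      have : (↑g : Matrix (Fin 2) (Fin 2) A) 1 0 * (↑h : Matrix (Fin 2) (Fin 2) A) 0 1 +
          (↑g : Matrix (Fin 2) (Fin 2) A) 1 1 * (↑h : Matrix (Fin 2) (Fin 2) A) 1 1 - 1 =
          (↑g : Matrix (Fin 2) (Fin 2) A) 1 0 * (↑h : Matrix (Fin 2) (Fin 2) A) 0 1 +
          (((↑g : Matrix (Fin 2) (Fin 2) A) 1 1 - 1) * (↑h : Matrix (Fin 2) (Fin 2) A) 1 1 +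
          ((↑h : Matrix (Fin 2) (Fin 2) A) 1 1 - 1)) := by ring
      rw [this]
      exact add_mem (Ideal.mul_mem_right _ _ (hple hc))
        (add_mem (Ideal.mul_mem_right _ _ hd) hd')
    · rw [hmul]
      exact add_mem (Ideal.mul_mem_right _ _ hc) (Ideal.mul_mem_left _ _ hc')
    · rw [hmul]
      exact add_mem (Ideal.mul_mem_left _ _ hb') (Ideal.mul_mem_right _ _ hb)
  inv_mem' := by
    rintro g ⟨ha, hd, hc, hb⟩
    rw [Matrix.SpecialLinearGroup.SL2_inv_expl g]
    refine ⟨?_, ?_, ?_, ?_⟩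
    · simpa using hd
    · simpa using ha
    · simpa using neg_mem hc
    · simpa using neg_mem hb

/-- `sl₂(k)`, the additive group of trace-zero `2 × 2` matrices over `k`. -/
def sl2 (k : Type*) [CommRing k] : AddSubgroup (Matrix (Fin 2) (Fin 2) k) where
  carrier := {m | Matrix.trace m = 0}
  zero_mem' := by simp
  add_mem' := by
    intro a b ha hb
    simp only [Set.mem_setOf_eq, Matrix.trace_add] at *
    rw [ha, hb, add_zero]
  neg_mem' := by
    intro a ha
    simp only [Set.mem_setOf_eq, Matrix.trace_neg] at *
    rw [ha, neg_zero]

open scoped commutatorElement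

/-- The upper unitriangular matrix `(1, a; 0, 1)`. -/
def upper {A : Type*} [CommRing A] (a : A) : SpecialLinearGroup (Fin 2) A :=
  ⟨!![1, a; 0, 1], by simp [Matrix.det_fin_two]⟩

/-- The lower unitriangular matrix `(1, 0; a, 1)`. -/
def lower {A : Type*} [CommRing A] (a : A) : SpecialLinearGroup (Fin 2) A :=
  ⟨!![1, 0; a, 1], by simp [Matrix.det_fin_two]⟩

/-- The Weyl element `(0, 1; -1, 0)`. -/
def weyl (A : Type*) [CommRing A] : SpecialLinearGroup (Fin 2) A :=
  ⟨!![0, 1; -1, 0], by simp [Matrix.det_fin_two]⟩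

/-- The diagonal matrix `(u, 0; 0, u⁻¹)`. -/
def torus {A : Type*} [CommRing A] (u : Aˣ) : SpecialLinearGroup (Fin 2) A :=
  ⟨!![(u : A), 0; 0, ((u⁻¹ : Aˣ) : A)], by simp [Matrix.det_fin_two]⟩

section Matrices

variable {A : Type*} [CommRing A]

lemma SL2_ext {g h : SpecialLinearGroup (Fin 2) A} (h00 : g.1 0 0 = h.1 0 0)
    (h01 : g.1 0 1 = h.1 0 1) (h10 : g.1 1 0 = h.1 1 0) (h11 : g.1 1 1 = h.1 1 1) : g = h := by
  ext i j
  fin_cases i <;> fin_cases j <;> assumption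

lemma SL2_mul (g h : SpecialLinearGroup (Fin 2) A) (i j : Fin 2) :
    (g * h).1 i j = g.1 i 0 * h.1 0 j + g.1 i 1 * h.1 1 j := by
  simp [Matrix.mul_apply, Fin.sum_univ_two]

lemma SL2_det (g : SpecialLinearGroup (Fin 2) A) :
    g.1 0 0 * g.1 1 1 - g.1 0 1 * g.1 1 0 = 1 := by
  rw [← Matrix.det_fin_two]; exact g.2

@[simp] lemma upper_val (a : A) : (upper a).1 = !![1, a; 0, 1] := rfl
@[simp] lemma lower_val (a : A) : (lower a).1 = !![1, 0; a, 1] := rfl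
@[simp] lemma weyl_val : (weyl A).1 = !![0, 1; -1, 0] := rfl
@[simp] lemma torus_val (u : Aˣ) : (torus u).1 = !![(u : A), 0; 0, ((u⁻¹ : Aˣ) : A)] := rfl

lemma upper_zero : upper (0 : A) = 1 := by apply SL2_ext <;> simp

lemma upper_add (a b : A) : upper (a + b) = upper a * upper b := by
  apply SL2_ext <;> simp [add_comm]

lemma lower_add (a b : A) : lower (a + b) = lower a * lower b := by
  apply SL2_ext <;> simp

lemma upper_neg (a : A) : upper (-a) = (upper a)⁻¹ := by
  rw [eq_inv_iff_mul_eq_one, ← upper_add, neg_add_cancel, upper_zero]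

lemma lower_zero : lower (0 : A) = 1 := by apply SL2_ext <;> simp

lemma lower_neg (a : A) : lower (-a) = (lower a)⁻¹ := by
  rw [eq_inv_iff_mul_eq_one, ← lower_add, neg_add_cancel, lower_zero]

lemma upper_nsmul (n : ℕ) (a : A) : upper (n * a) = upper a ^ n := by
  induction n with
  | zero => simp [upper_zero]
  | succ n ih => rw [pow_succ, ← ih, ← upper_add]; push_cast; ring_nf

lemma weyl_conj_upper (a : A) : weyl A * upper a * (weyl A)⁻¹ = lower (-a) := by
  rw [mul_inv_eq_iff_eq_mul]; apply SL2_ext <;> simp [SL2_mul]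

lemma weyl_conj_lower (a : A) : weyl A * lower a * (weyl A)⁻¹ = upper (-a) := by
  rw [mul_inv_eq_iff_eq_mul]; apply SL2_ext <;> simp [SL2_mul]

lemma weyl_eq : weyl A = upper 1 * lower (-1) * upper 1 := by
  apply SL2_ext <;> simp [SL2_mul]

lemma torus_conj_upper (u : Aˣ) (a : A) :
    torus u * upper a * (torus u)⁻¹ = upper ((u : A) ^ 2 * a) := by
  rw [mul_inv_eq_iff_eq_mul]; apply SL2_ext <;> simp [SL2_mul]
  rw [mul_comm ((u : A) ^ 2), pow_two, mul_assoc, mul_assoc, Units.mul_inv, mul_one, mul_comm]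

lemma torus_conj_lower (u : Aˣ) (a : A) :
    torus u * lower a * (torus u)⁻¹ = lower (((u⁻¹ : Aˣ) : A) ^ 2 * a) := by
  rw [mul_inv_eq_iff_eq_mul]; apply SL2_ext <;> simp [SL2_mul]
  rw [pow_two, mul_assoc, mul_assoc, mul_comm a, Units.inv_mul_cancel_left, mul_comm]

lemma torus_eq (u : Aˣ) : torus u =
    upper (u : A) * lower (-((u⁻¹ : Aˣ) : A)) * upper (u : A) * (weyl A)⁻¹ := by
  rw [eq_mul_inv_iff_mul_eq]; apply SL2_ext <;> simp [SL2_mul]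

end Matrices

section Steinberg

variable {F Q : Type*} [Field F] [Group Q]

/-- The element `x(r) y(-r⁻¹) x(r) w⁻¹` where `y(t) = w x(-t) w⁻¹`. -/
def steinbergH (x : F → Q) (w : Q) (r : F) : Q := x r * (w * x r⁻¹ * w⁻¹) * x r * w⁻¹

variable {x : F → Q} {w : Q} (hx : ∀ s t, x (s + t) = x s * x t)
  (hw : w = x 1 * (w * x 1 * w⁻¹) * x 1)

include hx in
lemma x_zero : x 0 = 1 := by simpa using hx 0 0

include hx in
lemma x_neg (t : F) : x (-t) = (x t)⁻¹ := by
  rw [eq_inv_iff_mul_eq_one, ← hx, neg_add_cancel, x_zero hx]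

include hw in
lemma steinbergH_one : steinbergH x w 1 = 1 := by
  unfold steinbergH; rw [inv_one, ← hw, mul_inv_cancel]

include hx hw in
lemma steinbergH_neg_one : steinbergH x w (-1) = w⁻¹ * w⁻¹ := by
  unfold steinbergH
  rw [inv_neg, inv_one, x_neg hx]
  have h : w⁻¹ = (x 1)⁻¹ * (w * (x 1)⁻¹ * w⁻¹) * (x 1)⁻¹ := by
    rw [inv_eq_iff_eq_inv]; exact hw.trans (by group)
  rw [mul_left_inj, ← h]

/-- `w(r)⁻¹ = w(-r)` -/
lemma steinbergH_neg (hx : ∀ s t, x (s + t) = x s * x t) (r : F) :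
    steinbergH x w (-r) * w = (steinbergH x w r * w)⁻¹ := by
  unfold steinbergH
  rw [inv_neg, x_neg hx, x_neg hx]
  group

variable (h2 : ∀ r t : F, r ≠ 0 → steinbergH x w r * x t = x (r ^ 2 * t) * steinbergH x w r)
  (h5 : ∀ r s : F, r ≠ 0 → s ≠ 0 → steinbergH x w (r * s) = steinbergH x w r * steinbergH x w s)

include hx hw h5 in
lemma weyl_sq : w * w = steinbergH x w (-1) := by
  have h1 := h5 (-1) (-1) (by simp) (by simp)
  rw [neg_one_mul, neg_neg, steinbergH_one hw] at h1
  rw [← inv_eq_of_mul_eq_one_left h1.symm, steinbergH_neg_one hx hw, _root_.mul_inv_rev, inv_inv]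

include hx hw h5 in
lemma weyl_steinbergH (r : F) (hr : r ≠ 0) :
    w * steinbergH x w r = steinbergH x w r⁻¹ * w := by
  have hww := weyl_sq hx hw h5
  have h1 := steinbergH_neg (w := w) hx r
  rw [← mul_neg_one, h5 r (-1) hr (by simp), ← hww] at h1
  have h2 : steinbergH x w r⁻¹ * steinbergH x w r = 1 := by
    rw [← h5 _ _ (inv_ne_zero hr) hr, inv_mul_cancel₀ hr, steinbergH_one hw]
  have h4 : w * w * (w * w) = 1 := by
    rw [hww, ← h5 _ _ (by simp) (by simp)]; simp [steinbergH_one hw]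
  have h3 : steinbergH x w r * w * steinbergH x w r = w := by
    rw [eq_inv_iff_mul_eq_one] at h1
    have h1' : steinbergH x w r * (w * w) * w * (steinbergH x w r * w) = 1 := h1
    have : (w * w) * w = w⁻¹ := by
      rw [eq_inv_iff_mul_eq_one]; rw [← h4]; group
    rw [mul_assoc (steinbergH x w r), this] at h1'
    have h6 : w⁻¹ = (w * w) * w := this.symm
    have h7 := weyl_sq hx hw h5
    have h8 : steinbergH x w (-1) * steinbergH x w r = steinbergH x w r * steinbergH x w (-1) := by
      rw [← h5 _ _ (by simp) hr, ← h5 _ _ hr (by simp), mul_comm]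
    rw [← h7] at h8
    calc steinbergH x w r * w * steinbergH x w r
        = steinbergH x w r * w⁻¹ * ((w * w) * steinbergH x w r) := by group
      _ = (steinbergH x w r * w⁻¹ * (steinbergH x w r * w)) * w := by rw [h8]; group
      _ = w := by rw [h1', one_mul]
  calc w * steinbergH x w r
      = (steinbergH x w r⁻¹ * steinbergH x w r) * w * steinbergH x w r := by rw [h2, one_mul]
    _ = steinbergH x w r⁻¹ * (steinbergH x w r * w * steinbergH x w r) := by group
    _ = _ := by rw [h3]

include hx hw h2 h5 in
/-- The Bruhat decomposition. -/
lemma bruhat (g : Q) (hg : g ∈ Subgroup.closure (Set.range x ∪ {w})) :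
    ∃ s r : F, r ≠ 0 ∧ (g = x s * steinbergH x w r ∨
      ∃ t, g = x s * steinbergH x w r * w * x t) := by
  have hww := weyl_sq hx hw h5
  have hwh := weyl_steinbergH hx hw h5
  have hcl : ∀ (a : Q), (∃ s r : F, r ≠ 0 ∧ (a = x s * steinbergH x w r ∨
      ∃ t, a = x s * steinbergH x w r * w * x t)) → ∃ s r : F, r ≠ 0 ∧
      (w * a = x s * steinbergH x w r ∨ ∃ t, w * a = x s * steinbergH x w r * w * x t) := by
    rintro a ⟨s, r, hr, rfl | ⟨t, rfl⟩⟩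
    · refine ⟨0, r⁻¹, inv_ne_zero hr, Or.inr ⟨(r⁻¹) ^ 2 * s, ?_⟩⟩
      have h1 : x s * steinbergH x w r = steinbergH x w r * x (r⁻¹ ^ 2 * s) := by
        rw [h2 _ _ hr]; congr 2; field_simp
      rw [h1, x_zero hx, one_mul, ← mul_assoc, hwh r hr]
    · by_cases hs : s = 0
      · refine ⟨((-r⁻¹)) ^ 2 * t, -r⁻¹, by simpa, Or.inl ?_⟩
        rw [hs, x_zero hx, one_mul, ← h2 _ _ (by simpa), ← mul_assoc, ← mul_assoc, hwh r hr,
          mul_assoc (steinbergH x w r⁻¹), hww, ← h5 _ _ (by simpa) (by simp)]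
        simp
      · have h6 : w * x s * w⁻¹ = x (-s⁻¹) * steinbergH x w s⁻¹ * w * x (-s⁻¹) := by
          unfold steinbergH; rw [inv_inv, x_neg hx]; group
        have h7 : w * x s = x (-s⁻¹) * steinbergH x w s⁻¹ * w * x (-s⁻¹) * w := by
          rw [← h6]; group
        refine ⟨-s⁻¹, s⁻¹ * (-r⁻¹)⁻¹, by simp [hs, hr], Or.inr ⟨(-r⁻¹)⁻¹ ^ 2 * -s⁻¹ + t, ?_⟩⟩
        rw [h5 _ _ (by simpa) (by simpa)]
        calc w * (x s * steinbergH x w r * w * x t)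
            = w * x s * (steinbergH x w r * w * x t) := by group
          _ = x (-s⁻¹) * steinbergH x w s⁻¹ * w * x (-s⁻¹) *
              ((w * steinbergH x w r) * w) * x t := by rw [h7]; group
          _ = x (-s⁻¹) * steinbergH x w s⁻¹ * w * x (-s⁻¹) *
              (steinbergH x w r⁻¹ * (w * w)) * x t := by rw [hwh r hr]; group
          _ = x (-s⁻¹) * steinbergH x w s⁻¹ * w * (x (-s⁻¹) *
              steinbergH x w (-r⁻¹)) * x t := by
                rw [hww, ← h5 _ _ (by simpa) (by simp), mul_neg_one]; group
          _ = x (-s⁻¹) * steinbergH x w s⁻¹ * w * (steinbergH x w (-r⁻¹) *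
              x ((-r⁻¹)⁻¹ ^ 2 * -s⁻¹)) * x t := by
                rw [h2 _ _ (by simpa)]
                congr 4
                field_simp
          _ = x (-s⁻¹) * steinbergH x w s⁻¹ * (w * steinbergH x w (-r⁻¹)) *
              (x ((-r⁻¹)⁻¹ ^ 2 * -s⁻¹) * x t) := by group
          _ = _ := by rw [hwh _ (by simpa), hx]; group
  have hwinv : w⁻¹ = w * w * w := by
    rw [inv_eq_iff_mul_eq_one, mul_assoc w w w, ← mul_assoc w w (w * w), hww, ← h5 _ _ (by simp) (by simp)]
    simp [steinbergH_one hw]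
  have hxl : ∀ (u : F) (a : Q), (∃ s r : F, r ≠ 0 ∧ (a = x s * steinbergH x w r ∨
      ∃ t, a = x s * steinbergH x w r * w * x t)) → ∃ s r : F, r ≠ 0 ∧
      (x u * a = x s * steinbergH x w r ∨ ∃ t, x u * a = x s * steinbergH x w r * w * x t) := by
    rintro u a ⟨s, r, hr, rfl | ⟨t, rfl⟩⟩
    · exact ⟨u + s, r, hr, Or.inl (by rw [hx]; group)⟩
    · exact ⟨u + s, r, hr, Or.inr ⟨t, by rw [hx]; group⟩⟩
  induction hg using Subgroup.closure_induction_left with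
  | one => exact ⟨0, 1, one_ne_zero, Or.inl (by rw [x_zero hx, steinbergH_one hw, one_mul])⟩
  | mul_left a ha y _ ih =>
    rcases ha with ⟨u, rfl⟩ | rfl
    · exact hxl u y ih
    · exact hcl y ih
  | inv_mul_cancel a ha y _ ih =>
    rcases ha with ⟨u, rfl⟩ | h
    · rw [← x_neg hx]; exact hxl _ y ih
    · rw [Set.mem_singleton_iff] at h
      rw [h, hwinv, mul_assoc, mul_assoc]
      exact hcl _ (hcl _ (hcl _ ih))

variable {π : Q →* SpecialLinearGroup (Fin 2) F} (hπx : ∀ t, π (x t) = upper t)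
  (hπw : π w = weyl F)

include hπx hπw in
lemma map_steinbergH (r : F) (hr : r ≠ 0) : π (steinbergH x w r) = torus (Units.mk0 r hr) := by
  unfold steinbergH
  rw [torus_eq]
  simp only [map_mul, map_inv, hπx, hπw, weyl_conj_upper]
  simp

include hx hw h2 h5 hπx hπw in
lemma injective_of_relations (hgen : Subgroup.closure (Set.range x ∪ {w}) = ⊤) :
    Function.Injective π := by
  rw [injective_iff_map_eq_one]
  intro g hg
  obtain ⟨s, r, hr, rfl | ⟨t, rfl⟩⟩ := bruhat hx hw h2 h5 g (hgen ▸ Subgroup.mem_top g)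
  · rw [map_mul, hπx, map_steinbergH hπx hπw r hr] at hg
    have h00 := congrArg (fun g => g.1 0 0) hg
    have h01 := congrArg (fun g => g.1 0 1) hg
    simp [SL2_mul] at h00 h01
    subst h00
    rcases h01 with rfl | h01
    · rw [x_zero hx, steinbergH_one hw, one_mul]
    · simp at h01
  · rw [map_mul, map_mul, map_mul, hπx, hπx, hπw, map_steinbergH hπx hπw r hr] at hg
    have h10 := congrArg (fun g => g.1 1 0) hg
    simp [SL2_mul, hr] at h10

end Steinberg

section SteinbergFinite

variable {F Q : Type*} [Field F] [Group Q] {x : F → Q} {w : Q}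
  (hx : ∀ s t, x (s + t) = x s * x t) (hw : w = x 1 * (w * x 1 * w⁻¹) * x 1)
  {π : Q →* SpecialLinearGroup (Fin 2) F} (hπx : ∀ t, π (x t) = upper t)
  (hπw : π w = weyl F) (hker : ∀ k, π k = 1 → ∀ g, k * g = g * k)
  {η : Q} {μ : F} (hμ0 : μ ≠ 0) (hμ : μ ^ 2 ≠ 1)
  (hη : π η = torus (Units.mk0 μ hμ0)) (hηx : ∀ t, η * x t * η⁻¹ = x (μ ^ 2 * t))

lemma torus_mul {A : Type*} [CommRing A] (u v : Aˣ) : torus (u * v) = torus u * torus v := by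
  apply SL2_ext <;> simp [SL2_mul, mul_comm]

lemma torus_one {A : Type*} [CommRing A] : torus (1 : Aˣ) = 1 := by
  apply SL2_ext <;> simp

lemma torus_inv {A : Type*} [CommRing A] (u : Aˣ) : torus u⁻¹ = (torus u)⁻¹ := by
  rw [eq_inv_iff_mul_eq_one, ← torus_mul, inv_mul_cancel, torus_one]

lemma torus_pow {A : Type*} [CommRing A] (u : Aˣ) (n : ℕ) : torus (u ^ n) = torus u ^ n := by
  induction n with
  | zero => simp [torus_one]
  | succ n ih => rw [pow_succ, torus_mul, ih, pow_succ]

lemma weyl_conj_torus {A : Type*} [CommRing A] (u : Aˣ) :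
    (weyl A)⁻¹ * torus u * weyl A = torus u⁻¹ := by
  rw [mul_assoc, inv_mul_eq_iff_eq_mul]
  apply SL2_ext <;> simp [SL2_mul]

include hx hπx hker hμ0 hμ hη hηx in
lemma conj_x_of_map_eq_torus {g : Q} {u : Fˣ} (hg : π g = torus u) (t : F) :
    g * x t * g⁻¹ = x (u ^ 2 * t) := by
  let c : F → Q := fun t => g * x t * g⁻¹ * (x (u ^ 2 * t))⁻¹
  have hcπ : ∀ t, π (c t) = 1 := by
    intro t
    simp only [c, map_mul, map_inv, hπx, hg, torus_conj_upper, mul_inv_cancel]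
  have hadd : ∀ s t, c (s + t) = c s * c t := by
    intro s t
    calc c (s + t) = g * x s * g⁻¹ * c t * (x (u ^ 2 * s))⁻¹ := by
          simp only [c]
          rw [hx, mul_add, hx]; group
      _ = c t * (g * x s * g⁻¹) * (x (u ^ 2 * s))⁻¹ := by rw [hker _ (hcπ t)]
      _ = c t * c s := by simp only [c]; group
      _ = c s * c t := hker _ (hcπ t) _
  have hz : π (η * g * η⁻¹ * g⁻¹) = 1 := by
    rw [map_mul, map_mul, map_mul, map_inv, map_inv, hη, hg, ← torus_mul, mul_comm, torus_mul]
    group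
  have hη' : ∀ t, c (μ ^ 2 * t) = c t := by
    intro t
    have h1 : η * c t * η⁻¹ = c t := by rw [← hker _ (hcπ t)]; group
    rw [← h1]
    have h2 : η * g * η⁻¹ = (η * g * η⁻¹ * g⁻¹) * g := by group
    calc c (μ ^ 2 * t) = g * x (μ ^ 2 * t) * g⁻¹ * (x (μ ^ 2 * (u ^ 2 * t)))⁻¹ := by
          simp only [c]; ring_nf
      _ = (η * g * η⁻¹ * g⁻¹) * (g * x (μ ^ 2 * t) * g⁻¹) * (η * g * η⁻¹ * g⁻¹)⁻¹
            * (x (μ ^ 2 * (u ^ 2 * t)))⁻¹ := by rw [hker _ hz]; group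
      _ = η * c t * η⁻¹ := by
          rw [← hηx t, ← hηx (u ^ 2 * t)]; simp only [c]; group
  have hc : c t = 1 := by
    have h1 := hadd ((μ ^ 2 - 1) * ((μ ^ 2 - 1)⁻¹ * t)) ((μ ^ 2 - 1)⁻¹ * t)
    rw [← add_one_mul, sub_add_cancel, hη', right_eq_mul,
      mul_inv_cancel_left₀ (sub_ne_zero.mpr hμ)] at h1
    exact h1
  exact mul_inv_eq_one.mp hc

include hx hπx hπw hker hμ0 hμ hη hηx in
lemma conj_y_of_map_eq_torus {g : Q} {u : Fˣ} (hg : π g = torus u) (t : F) :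
    g * (w * x t * w⁻¹) * g⁻¹ = w * x ((u : F)⁻¹ ^ 2 * t) * w⁻¹ := by
  have h1 := conj_x_of_map_eq_torus hx hπx hker hμ0 hμ hη hηx (g := w⁻¹ * g * w) (u := u⁻¹)
    (by rw [map_mul, map_mul, map_inv, hπw, hg, weyl_conj_torus]) t
  rw [Units.val_inv_eq_inv_val] at h1
  rw [← h1]; group

include hx hπx hπw hker hμ0 hμ hη hηx in
lemma conj_weyl_of_map_eq_torus {g : Q} {u : Fˣ} (hg : π g = torus u) (s : F) :
    g * (steinbergH x w s * w) * g⁻¹ = steinbergH x w ((u : F) ^ 2 * s) * w := by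
  have h1 := conj_x_of_map_eq_torus hx hπx hker hμ0 hμ hη hηx hg s
  have h2 := conj_y_of_map_eq_torus hx hπx hπw hker hμ0 hμ hη hηx hg s⁻¹
  unfold steinbergH
  calc _ = (g * x s * g⁻¹) * (g * (w * x s⁻¹ * w⁻¹) * g⁻¹) * (g * x s * g⁻¹) := by group
    _ = _ := by
      rw [h1, h2, mul_inv, ← inv_pow]; group

include hker in
lemma commute_of_map_eq_torus [Finite F] {g h : Q} {u v : Fˣ}
    (hs : ∀ u : Fˣ, ∃ g, π g = torus u)
    (hg : π g = torus u) (hh : π h = torus v) : g * h = h * g := by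
  obtain ⟨ζ, hζ⟩ := IsCyclic.exists_monoid_generator (α := Fˣ)
  obtain ⟨z, hz⟩ := hs ζ
  have key : ∀ {g : Q} {u : Fˣ}, π g = torus u → ∃ k n, π k = 1 ∧ g = k * z ^ (n : ℕ) := by
    intro g u hg
    obtain ⟨n, rfl⟩ := Submonoid.mem_powers_iff _ _ |>.mp (hζ u)
    exact ⟨g * (z ^ n)⁻¹, n, by rw [map_mul, map_inv, map_pow, hg, hz, torus_pow]; group, by group⟩
  obtain ⟨k, n, hk, rfl⟩ := key hg
  obtain ⟨l, m, hl, rfl⟩ := key hh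
  have hk' : ∀ g, Commute k g := hker k hk
  have hl' : ∀ g, Commute g l := fun g => (hker l hl g).symm
  exact (hk' _).mul_left ((hl' _).mul_right (Commute.pow_pow_self z n m))

include hx hw in
lemma x_neg_one_eq (hww : w * w * x 1 * (w * w)⁻¹ = x 1) :
    x (-1) = (w * x 1 * w⁻¹) * w⁻¹ * (w * x 1 * w⁻¹) := by
  rw [x_neg hx, inv_eq_iff_eq_inv]
  have h : w = (w * x 1 * w⁻¹) * (w * w * x 1 * (w * w)⁻¹) * (w * x 1 * w⁻¹) := by
    calc w = w * w * w⁻¹ := by group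
      _ = w * (x 1 * (w * x 1 * w⁻¹) * x 1) * w⁻¹ := by rw [← hw]
      _ = _ := by group
  rw [hww] at h
  calc x 1 = (w * x 1 * w⁻¹)⁻¹ * ((w * x 1 * w⁻¹) * x 1 * (w * x 1 * w⁻¹)) *
        (w * x 1 * w⁻¹)⁻¹ := by group
    _ = _ := by rw [← h]; group

include hx hw hπx hπw hker hμ0 hμ hη hηx in
lemma steinbergH_mul_of_add_eq_one {u v : F} (hu : u ≠ 0) (hv : v ≠ 0) (huv : u + v = 1) :
    steinbergH x w (u * v) = steinbergH x w u * steinbergH x w v := by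
  have cy : ∀ (u : F) (hu : u ≠ 0) t, steinbergH x w u * (w * x t * w⁻¹) * (steinbergH x w u)⁻¹ =
      w * x (u⁻¹ ^ 2 * t) * w⁻¹ := fun u hu t => by
    simpa using conj_y_of_map_eq_torus hx hπx hπw hker hμ0 hμ hη hηx
      (map_steinbergH hπx hπw u hu) t
  have cx : ∀ (u : F) (hu : u ≠ 0) t, steinbergH x w u * x t * (steinbergH x w u)⁻¹ =
      x (u ^ 2 * t) := fun u hu t => by
    simpa using conj_x_of_map_eq_torus hx hπx hker hμ0 hμ hη hηx
      (map_steinbergH hπx hπw u hu) t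
  have hww : ∀ t, (w * w) * x t * (w * w)⁻¹ = x t := fun t => by
    have := conj_x_of_map_eq_torus hx hπx hker hμ0 hμ hη hηx (g := w * w) (u := -1) (by
      rw [map_mul, hπw]; apply SL2_ext <;> simp [SL2_mul, inv_neg]) t
    simpa using this
  have hy : ∀ u, w * x u⁻¹ * w⁻¹ = x (-u) * (steinbergH x w u * w) * x (-u) := fun u => by
    rw [x_neg hx]; unfold steinbergH; group
  have h1 : steinbergH x w u * w * (w * x 1 * w⁻¹) = x (u ^ 2) * (steinbergH x w u * w) := by
    have := cx u hu 1
    rw [mul_one] at this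
    rw [← this]
    nth_rewrite 2 [← hww 1]
    group
  have h2 : (w * x 1 * w⁻¹) * (steinbergH x w v * w) = (steinbergH x w v * w) * x (v ^ 2) := by
    have := cy v hv (v ^ 2)
    rw [← mul_pow, inv_mul_cancel₀ hv, one_pow] at this
    rw [← this]; group
  have h3 : w * x (u * v)⁻¹ * w⁻¹ = (w * x u⁻¹ * w⁻¹) * (w * x v⁻¹ * w⁻¹) := by
    have : (u * v)⁻¹ = u⁻¹ + v⁻¹ := by field_simp; rw [add_comm, huv]
    rw [this, hx]; group
  have h4 : (w * x u⁻¹ * w⁻¹) * (w * x v⁻¹ * w⁻¹) =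
      x (-(u * v)) * (steinbergH x w u * steinbergH x w v * w) * x (-(u * v)) := by
    calc (w * x u⁻¹ * w⁻¹) * (w * x v⁻¹ * w⁻¹)
        = x (-u) * (steinbergH x w u * w) * (x (-u) * x (-v)) * (steinbergH x w v * w) * x (-v) := by
          rw [hy, hy v]; group
      _ = x (-u) * (steinbergH x w u * w * (w * x 1 * w⁻¹)) * w⁻¹ *
            ((w * x 1 * w⁻¹) * (steinbergH x w v * w)) * x (-v) := by
          rw [← hx, ← neg_add, huv, x_neg_one_eq hx hw (hww 1)]; group
      _ = (x (-u) * x (u ^ 2)) * (steinbergH x w u * steinbergH x w v * w) *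
            (x (v ^ 2) * x (-v)) := by rw [h1, h2]; group
      _ = _ := by
          rw [← hx, ← hx]
          obtain rfl : v = 1 - u := by rw [← huv]; ring
          ring_nf
  have h5 := hy (u * v)
  rw [h3, h4, mul_left_inj, mul_right_inj, mul_left_inj] at h5
  exact h5.symm

include hx hw hπx hπw hker hμ0 hμ hη hηx in
/-- Over a finite field, a central extension of `SL₂` generated by root elements which lift the
additive group compatibly with a single torus element `μ`, `μ² ≠ 1`, is trivial. -/
lemma injective_of_central [Finite F] (hgen : Subgroup.closure (Set.range x ∪ {w}) = ⊤) :
    Function.Injective π := by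
  have hH := map_steinbergH hπx hπw
  have h2 : ∀ r t : F, r ≠ 0 → steinbergH x w r * x t = x (r ^ 2 * t) * steinbergH x w r := by
    intro r t hr
    rw [← mul_inv_eq_iff_eq_mul]
    exact conj_x_of_map_eq_torus hx hπx hker hμ0 hμ hη hηx (hH r hr) t
  have hcomm : ∀ r s : F, r ≠ 0 → s ≠ 0 →
      steinbergH x w r * steinbergH x w s = steinbergH x w s * steinbergH x w r := by
    intro r s hr hs
    exact commute_of_map_eq_torus hker (fun u => ⟨_, by simpa using hH u u.ne_zero⟩)
      (hH r hr) (hH s hs)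
  have hsq : ∀ r s : F, r ≠ 0 → s ≠ 0 →
      steinbergH x w (r ^ 2 * s) = steinbergH x w (r ^ 2) * steinbergH x w s := by
    intro r s hr hs
    have h1 := conj_weyl_of_map_eq_torus hx hπx hπw hker hμ0 hμ hη hηx (hH r hr) s
    have h3 := conj_weyl_of_map_eq_torus hx hπx hπw hker hμ0 hμ hη hηx (hH r hr) 1
    rw [steinbergH_one hw, one_mul, Units.val_mk0, mul_one] at h3
    rw [Units.val_mk0] at h1
    rw [← mul_left_inj w, ← h1, hcomm _ s (by positivity) hs]
    calc _ = (steinbergH x w r * steinbergH x w s) * (steinbergH x w r)⁻¹ *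
          (steinbergH x w r * w * (steinbergH x w r)⁻¹) := by group
      _ = _ := by rw [h3, hcomm r s hr hs]; group
  have hns : ∀ r : F, r ≠ 0 → ¬ IsSquare r →
      steinbergH x w (r ^ 2) = steinbergH x w r * steinbergH x w r := by
    intro r hr hrs
    have hF : ringChar F ≠ 2 := fun h => hrs (FiniteField.isSquare_of_char_two h r)
    have := Fintype.ofFinite F
    obtain ⟨a, b, hab⟩ := FiniteField.exists_root_sum_quadratic
      (f := Polynomial.C r * Polynomial.X ^ 2 + Polynomial.C 0 * Polynomial.X + Polynomial.C 0)
      (g := Polynomial.C r * Polynomial.X ^ 2 + Polynomial.C 0 * Polynomial.X + Polynomial.C (-1))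
      (Polynomial.degree_quadratic hr) (Polynomial.degree_quadratic hr)
      (FiniteField.odd_card_of_char_ne_two hF)
    simp only [Polynomial.eval_add, Polynomial.eval_mul, Polynomial.eval_C, Polynomial.eval_pow,
      Polynomial.eval_X, zero_mul, add_zero] at hab
    have hab' : a ^ 2 * r + b ^ 2 * r = 1 := by linear_combination hab
    have hne : ∀ c : F, c ^ 2 * r ≠ 1 := fun c hc => hrs ⟨c⁻¹, by
      have : c ≠ 0 := by rintro rfl; simp at hc
      field_simp; linear_combination hc⟩
    have ha : a ≠ 0 := by rintro rfl; exact hne b (by linear_combination hab')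
    have hb : b ≠ 0 := by rintro rfl; exact hne a (by linear_combination hab')
    have h1 := steinbergH_mul_of_add_eq_one hx hw hπx hπw hker hμ0 hμ hη hηx
      (mul_ne_zero (pow_ne_zero 2 ha) hr) (mul_ne_zero (pow_ne_zero 2 hb) hr) hab'
    rw [show a ^ 2 * r * (b ^ 2 * r) = a ^ 2 * (b ^ 2 * r ^ 2) by ring,
      hsq _ _ ha (by positivity), hsq _ _ hb (by positivity), hsq _ _ ha hr, hsq _ _ hb hr] at h1
    have h3 := hcomm r (b ^ 2) hr (by positivity)
    rw [mul_assoc, mul_right_inj, ← mul_assoc, h3, mul_assoc, mul_right_inj] at h1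
    exact h1
  have h5 : ∀ r s : F, r ≠ 0 → s ≠ 0 →
      steinbergH x w (r * s) = steinbergH x w r * steinbergH x w s := by
    intro r s hr hs
    by_cases hrs : IsSquare r
    · obtain ⟨a, rfl⟩ := hrs
      rw [← pow_two]
      exact hsq a s (by rintro rfl; simp at hr) hs
    by_cases hss : IsSquare s
    · obtain ⟨a, rfl⟩ := hss
      rw [hcomm _ _ hr hs, mul_comm, ← pow_two]
      exact hsq a r (by rintro rfl; simp at hs) hr
    obtain ⟨b, rfl⟩ : ∃ b, s = b ^ 2 * r := by
      have := Fintype.ofFinite F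
      classical
      have h1 : quadraticChar F (s * r⁻¹) = 1 := by
        have hr' : ¬ IsSquare r⁻¹ := by rwa [isSquare_inv]
        rw [map_mul, quadraticChar_neg_one_iff_not_isSquare.mpr hss,
          quadraticChar_neg_one_iff_not_isSquare.mpr hr']
        norm_num
      obtain ⟨b, hb⟩ := (quadraticChar_one_iff_isSquare (by simp [hr, hs])).mp h1
      exact ⟨b, by rw [pow_two, ← hb, inv_mul_cancel_right₀ hr]⟩
    have hb : b ≠ 0 := by rintro rfl; simp at hs
    rw [show r * (b ^ 2 * r) = b ^ 2 * r ^ 2 by ring, hsq _ _ hb (by positivity), hsq _ _ hb hr,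
      hns r hr hrs, ← mul_assoc, ← mul_assoc, hcomm r (b ^ 2) hr (by positivity)]
  exact injective_of_relations hx hw h2 h5 hπx hπw hgen

end SteinbergFinite

section Ring

variable {S : Set ℕ}

lemma isUnit_of_mem {p : ℕ} (hS : ∀ p ∈ S, Nat.Prime p) (hp : p ∈ S) : IsUnit (p : ZS S) := by
  have hmem : (p : ℚ)⁻¹ ∈ ZS S := Subring.subset_closure ⟨p, hp, rfl⟩
  refine IsUnit.of_mul_eq_one ⟨_, hmem⟩ ?_
  ext
  have : (p : ℚ) ≠ 0 := by exact_mod_cast (hS p hp).ne_zero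
  simp [this]

lemma isUnit_of_mem_closure {d : ℕ} (hS : ∀ p ∈ S, Nat.Prime p) (hd : d ∈ Submonoid.closure S) :
    IsUnit (d : ZS S) := by
  induction hd using Submonoid.closure_induction with
  | mem p hp => exact isUnit_of_mem hS hp
  | one => simp
  | mul a b _ _ ha hb => rw [Nat.cast_mul]; exact ha.mul hb

lemma exists_mul_eq_intCast (hS : ∀ p ∈ S, Nat.Prime p) (z : ZS S) :
    ∃ d ∈ Submonoid.closure S, ∃ n : ℤ, z * (d : ZS S) = n := by
  obtain ⟨z, hz⟩ := z
  suffices ∃ d ∈ Submonoid.closure S, ∃ n : ℤ, z * (d : ℚ) = n by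
    obtain ⟨d, hd, n, h⟩ := this
    exact ⟨d, hd, n, by ext; simpa using h⟩
  induction hz using Subring.closure_induction with
  | mem x hx =>
    obtain ⟨p, hp, rfl⟩ := hx
    have : (p : ℚ) ≠ 0 := by exact_mod_cast (hS p hp).ne_zero
    exact ⟨p, Submonoid.subset_closure hp, 1, by simp [this]⟩
  | zero => exact ⟨1, one_mem _, 0, by simp⟩
  | one => exact ⟨1, one_mem _, 1, by simp⟩
  | neg x _ h =>
    obtain ⟨d, hd, n, h⟩ := h
    exact ⟨d, hd, -n, by push_cast; rw [← h]; ring⟩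
  | add x y _ _ hx hy =>
    obtain ⟨d, hd, n, h⟩ := hx
    obtain ⟨e, he, m, h'⟩ := hy
    exact ⟨d * e, mul_mem hd he, n * e + m * d, by push_cast; rw [← h, ← h']; ring⟩
  | mul x y _ _ hx hy =>
    obtain ⟨d, hd, n, h⟩ := hx
    obtain ⟨e, he, m, h'⟩ := hy
    exact ⟨d * e, mul_mem hd he, n * m, by push_cast; rw [← h, ← h']; ring⟩

lemma coprime_of_mem_closure {d m : ℕ} (hS : ∀ p ∈ S, Nat.Prime p) (hm : ∀ p ∈ S, ¬ p ∣ m)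
    (hd : d ∈ Submonoid.closure S) : m.Coprime d := by
  induction hd using Submonoid.closure_induction with
  | mem p hp => exact ((hS p hp).coprime_iff_not_dvd.mpr (hm p hp)).symm
  | one => simp
  | mul a b _ _ ha hb => exact ha.mul_right hb

lemma intCast_dvd_iff {m : ℕ} (hS : ∀ p ∈ S, Nat.Prime p) (hm : ∀ p ∈ S, ¬ p ∣ m) (n : ℤ) :
    (m : ZS S) ∣ n ↔ (m : ℤ) ∣ n := by
  constructor
  · rintro ⟨z, hz⟩
    obtain ⟨d, hd, k, h⟩ := exists_mul_eq_intCast hS z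
    have h1 : n * d = m * k := by
      have : ((n * d : ℤ) : ZS S) = (m * k : ℤ) := by push_cast; rw [hz, ← h]; ring
      exact_mod_cast this
    have h2 := (Nat.isCoprime_iff_coprime.mpr (coprime_of_mem_closure hS hm hd))
    exact h2.dvd_of_dvd_mul_right ⟨k, h1⟩
  · rintro ⟨k, rfl⟩
    exact ⟨k, by push_cast; ring⟩

lemma exists_associated {β : ZS S} (hS : ∀ p ∈ S, Nat.Prime p) (hβ : β ≠ 0) :
    ∃ m : ℕ, 0 < m ∧ (∀ p ∈ S, ¬ p ∣ m) ∧ Associated (m : ZS S) β := by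
  classical
  have hex : ∃ m : ℕ, 0 < m ∧ Associated (m : ZS S) β := by
    obtain ⟨d, hd, n, h⟩ := exists_mul_eq_intCast hS β
    have hd' := isUnit_of_mem_closure hS hd
    have h1 : Associated (n : ZS S) β := h ▸ (associated_mul_unit_left β _ hd')
    refine ⟨n.natAbs, ?_, ?_⟩
    · rw [Int.natAbs_pos]; rintro rfl
      simp [hβ, hd'.ne_zero] at h
    · rcases Int.natAbs_eq n with h2 | h2 <;> rw [h2] at h1
      · rwa [Int.cast_natCast] at h1
      · rwa [Int.cast_neg, Int.cast_natCast, Associated.neg_left_iff] at h1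
  refine ⟨Nat.find hex, (Nat.find_spec hex).1, ?_, (Nat.find_spec hex).2⟩
  rintro p hp ⟨k, hk⟩
  have hs := Nat.find_spec hex
  rw [hk] at hs
  have hk0 : 0 < k := Nat.pos_of_mul_pos_left hs.1
  refine Nat.find_min hex (m := k) ?_ ⟨hk0, ?_⟩
  · rw [hk]; nlinarith [(hS p hp).two_le]
  · have := hs.2
    rw [Nat.cast_mul, associated_isUnit_mul_left_iff (isUnit_of_mem hS hp)] at this
    exact this

lemma exists_int_dvd_sub {m : ℕ} (hS : ∀ p ∈ S, Nat.Prime p) (hm : ∀ p ∈ S, ¬ p ∣ m)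
    (α : ZS S) : ∃ k : ℤ, (m : ZS S) ∣ α - k := by
  obtain ⟨d, hd, n, h⟩ := exists_mul_eq_intCast hS α
  obtain ⟨x, y, hxy⟩ := Nat.isCoprime_iff_coprime.mpr (coprime_of_mem_closure hS hm hd)
  refine ⟨n * y, α * x, ?_⟩
  have : (x * m + y * d : ZS S) = 1 := by exact_mod_cast congrArg (Int.cast : ℤ → ZS S) hxy
  push_cast
  rw [← h]
  linear_combination (-α) * this

lemma coprime_of_isCoprime {m : ℕ} (hS : ∀ p ∈ S, Nat.Prime p) (hm : ∀ p ∈ S, ¬ p ∣ m) {k : ℤ}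
    (h : IsCoprime (m : ZS S) k) : IsCoprime (m : ℤ) k := by
  obtain ⟨a, b, hab⟩ := h
  obtain ⟨d, hd, n, hn⟩ := exists_mul_eq_intCast hS b
  obtain ⟨x, y, hxy⟩ := Nat.isCoprime_iff_coprime.mpr (coprime_of_mem_closure hS hm hd)
  have h1 : (m : ℤ) ∣ n * k - d := by
    rw [← intCast_dvd_iff hS hm]
    refine ⟨-a * d, ?_⟩
    push_cast
    rw [← hn]
    linear_combination (d : ZS S) * hab
  obtain ⟨c, hc⟩ := h1
  exact ⟨x - y * c, y * n, by linear_combination hxy + y * hc⟩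

lemma exists_prime_dvd_sub (hS : ∀ p ∈ S, Nat.Prime p) {α β : ZS S} (hβ : β ≠ 0)
    (hαβ : IsCoprime α β) {r : ℕ} (hr : r ≠ 0) (hβr : IsCoprime β ((2 * r : ℕ) : ZS S)) :
    ∃ P : ℕ, P.Prime ∧ β ∣ (P : ZS S) - α ∧ (2 * r) ∣ P + 1 := by
  obtain ⟨m, hm0, hm, hmβ⟩ := exists_associated hS hβ
  obtain ⟨k, hk⟩ := exists_int_dvd_sub hS hm α
  have hmα : IsCoprime (m : ZS S) α := (hαβ.of_isCoprime_of_dvd_right hmβ.dvd).symm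
  have hmk : IsCoprime (m : ℤ) k := by
    apply coprime_of_isCoprime hS hm
    obtain ⟨c, hc⟩ := hk
    rw [show (k : ZS S) = α + m * (-c) by linear_combination -hc]
    exact hmα.add_mul_left_right _
  have hmr : IsCoprime (m : ℤ) ((2 * r : ℕ) : ℤ) := by
    apply coprime_of_isCoprime hS hm
    have h := hβr.of_isCoprime_of_dvd_left hmβ.dvd
    rwa [← Int.cast_natCast (2 * r)] at h
  obtain ⟨x, y, hxy⟩ := id hmr
  have hc : IsCoprime (k * (y * (2 * r : ℕ)) - x * m) ((m * (2 * r) : ℕ) : ℤ) := by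
    rw [Nat.cast_mul m]
    apply IsCoprime.mul_right
    · rw [show k * (y * (2 * r : ℕ)) - x * m = k + m * (-x * (k + 1)) by
        linear_combination k * hxy]
      exact IsCoprime.add_mul_left_left hmk.symm _
    · rw [show k * (y * (2 * r : ℕ)) - x * m = -1 + (2 * r : ℕ) * (y * (k + 1)) by
        linear_combination -hxy]
      exact IsCoprime.add_mul_left_left (isCoprime_one_left (R := ℤ)).neg_left _
  obtain ⟨P, -, hP, hPc⟩ := Nat.forall_exists_prime_gt_and_zmodEq 0 (by positivity) hc
  have hd := hPc.symm.dvd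
  refine ⟨P, hP, ?_, ?_⟩
  · refine hmβ.symm.dvd.trans ?_
    have h1 : (m : ℤ) ∣ P - k := by
      have h2 : (m : ℤ) ∣ P - (k * (y * (2 * r : ℕ)) - x * m) :=
        dvd_trans ⟨(2 * r : ℕ), by push_cast; ring⟩ hd
      have h3 := dvd_add h2 (Dvd.intro (-x * (k + 1)) rfl : (m : ℤ) ∣ m * (-x * (k + 1)))
      rwa [show (P - (k * (y * (2 * r : ℕ)) - x * m) + m * (-x * (k + 1)) : ℤ) = P - k by
        linear_combination -k * hxy] at h3
    rw [← intCast_dvd_iff hS hm] at h1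
    have := dvd_sub h1 hk
    push_cast at this
    convert this using 1
    ring
  · have h2 : ((2 * r : ℕ) : ℤ) ∣ P - (k * (y * (2 * r : ℕ)) - x * m) :=
      dvd_trans ⟨m, by push_cast; ring⟩ hd
    have h3 := dvd_add h2 (Dvd.intro (y * (k + 1)) rfl : ((2 * r : ℕ) : ℤ) ∣ (2 * r : ℕ) * (y * (k + 1)))
    have : ((2 * r : ℕ) : ℤ) ∣ ((P + 1 : ℕ) : ℤ) := by
      rwa [show (P - (k * (y * (2 * r : ℕ)) - x * m) + (2 * r : ℕ) * (y * (k + 1)) : ℤ) =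
        (P + 1 : ℕ) by push_cast; push_cast at hxy; linear_combination hxy] at h3
    exact_mod_cast this

lemma mem_of_exists_unit (hS : ∀ p ∈ S, Nat.Prime p)
    (hlam : ∃ lam : (ZS S)ˣ, IsUnit ((lam : ZS S) ^ 2 - 1)) {l : ℕ} (hl : l = 2 ∨ l = 3) :
    l ∈ S := by
  obtain ⟨lam, hu⟩ := hlam
  by_contra hlS
  have hlp : l.Prime := by rcases hl with rfl | rfl <;> norm_num
  have hl1 : ∀ p ∈ S, ¬ p ∣ l := by
    intro p hp hpl
    rw [(Nat.prime_dvd_prime_iff_eq (hS p hp) hlp).mp hpl] at hp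
    exact hlS hp
  have hnu : ∀ u : ZS S, IsUnit u → ¬ (l : ZS S) ∣ u := by
    intro u hu hdvd
    have h1 : (l : ZS S) ∣ ((1 : ℤ) : ZS S) := by
      simpa using (isUnit_of_dvd_unit hdvd hu).dvd (a := 1)
    rw [intCast_dvd_iff hS hl1] at h1
    exact hlp.one_lt.ne' (by exact_mod_cast Int.eq_one_of_dvd_one (by positivity) h1)
  obtain ⟨k, c, hk⟩ := exists_int_dvd_sub hS hl1 (lam : ZS S)
  have h1 : ¬ (l : ℤ) ∣ k := by
    rw [← intCast_dvd_iff hS hl1]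
    intro h
    exact hnu _ lam.isUnit (by rw [← sub_add_cancel (lam : ZS S) k]; exact dvd_add ⟨c, hk⟩ h)
  have h2 : (l : ℤ) ∣ k ^ 2 - 1 := by
    rcases hl with rfl | rfl
    · have : k % 2 = 1 := by omega
      obtain ⟨j, rfl⟩ : ∃ j, k = 2 * j + 1 := ⟨k / 2, by omega⟩
      exact ⟨2 * j ^ 2 + 2 * j, by push_cast; ring⟩
    · rcases (by omega : k % 3 = 1 ∨ k % 3 = 2) with h | h
      · obtain ⟨j, rfl⟩ : ∃ j, k = 3 * j + 1 := ⟨k / 3, by omega⟩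
        exact ⟨3 * j ^ 2 + 2 * j, by push_cast; ring⟩
      · obtain ⟨j, rfl⟩ : ∃ j, k = 3 * j + 2 := ⟨k / 3, by omega⟩
        exact ⟨3 * j ^ 2 + 4 * j + 1, by push_cast; ring⟩
  rw [← intCast_dvd_iff hS hl1] at h2
  apply hnu _ hu
  have := dvd_add h2 (Dvd.intro (c * (lam + k)) rfl : (l : ZS S) ∣ l * (c * (lam + k)))
  convert this using 1
  push_cast
  linear_combination (lam + k : ZS S) * hk

lemma closure_upper_weyl (hS : ∀ p ∈ S, Nat.Prime p) :
    Subgroup.closure (Set.range (upper (A := ZS S)) ∪ {weyl (ZS S)}) = ⊤ := by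
  rw [eq_top_iff]
  set H := Subgroup.closure (Set.range (upper (A := ZS S)) ∪ {weyl (ZS S)})
  have hU : ∀ a, upper a ∈ H := fun a => Subgroup.subset_closure (Or.inl ⟨a, rfl⟩)
  have hW : weyl (ZS S) ∈ H := Subgroup.subset_closure (Or.inr rfl)
  have hL : ∀ a, lower a ∈ H := fun a => by
    rw [← neg_neg a, ← weyl_conj_upper]
    exact mul_mem (mul_mem hW (hU _)) (inv_mem hW)
  have hT : ∀ u, torus u ∈ H := fun u => by
    rw [torus_eq]
    exact mul_mem (mul_mem (mul_mem (hU _) (hL _)) (hU _)) (inv_mem hW)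
  have key : ∀ (n : ℕ) (g : SpecialLinearGroup (Fin 2) (ZS S)) (d : (ZS S)) (a c : ℤ),
      IsUnit d → g.1 0 0 * d = a → g.1 1 0 * d = c → c.natAbs ≤ n → g ∈ H := by
    intro n
    induction n with
    | zero =>
      intro g d a c hd ha hc hn
      obtain rfl : c = 0 := by omega
      have h10 : g.1 1 0 = 0 := by simpa [hd.ne_zero] using hc
      have hdet := SL2_det g
      rw [h10, mul_zero, sub_zero] at hdet
      have : g = torus (Units.mkOfMulEqOne _ _ hdet) * upper (g.1 1 1 * g.1 0 1) := by
        apply SL2_ext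
        · simp [SL2_mul]
        · simp only [SL2_mul, torus_val, upper_val]
          simp
          rw [← mul_assoc, hdet, one_mul]
        · simp [SL2_mul, h10]
        · simp [SL2_mul]
          rfl
      rw [this]
      exact mul_mem (hT _) (hU _)
    | succ n ih =>
      intro g d a c hd ha hc hn
      by_cases hc0 : c = 0
      · exact ih g d a c hd ha hc (by simp [hc0])
      have h1 : weyl (ZS S) * (upper (-(a / c : ℤ) : ZS S) * g) ∈ H := by
        refine ih _ d c (-(a % c)) hd ?_ ?_ ?_
        · simp [SL2_mul, hc]
        · simp only [SL2_mul, weyl_val, upper_val]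
          simp
          rw [Int.emod_def]
          push_cast
          linear_combination -ha + (a / c : ℤ) * hc
        · have := Int.emod_lt_abs a hc0
          rw [← Int.natCast_natAbs] at this
          have := Int.emod_nonneg a hc0
          omega
      exact (Subgroup.mul_mem_cancel_left _ (hU _)).mp
        ((Subgroup.mul_mem_cancel_left _ hW).mp h1)
  intro g _
  obtain ⟨d, hd, a, ha⟩ := exists_mul_eq_intCast hS (g.1 0 0)
  obtain ⟨e, he, c, hc⟩ := exists_mul_eq_intCast hS (g.1 1 0)
  refine key _ g (d * e) (a * e) (c * d)
    ((isUnit_of_mem_closure hS hd).mul (isUnit_of_mem_closure hS he)) ?_ ?_ le_rfl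
  · push_cast; rw [← ha]; ring
  · push_cast; rw [← hc]; ring

end Ring

section Groups

lemma finite_of_finiteIndex_center {Q : Type*} [Group Q] [(Subgroup.center Q).FiniteIndex]
    (hQ : commutator Q = ⊤) : Finite Q := by
  have hfin : Finite (commutatorSet Q) := by
    refine Set.Finite.subset (Set.finite_range fun p : (Q ⧸ Subgroup.center Q) ×
      (Q ⧸ Subgroup.center Q) => ⁅p.1.out, p.2.out⁆) ?_
    rintro _ ⟨a, b, rfl⟩
    refine ⟨(a, b), ?_⟩
    obtain ⟨⟨y, hy⟩, hy'⟩ := QuotientGroup.mk_out_eq_mul (Subgroup.center Q) a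
    obtain ⟨⟨z, hz⟩, hz'⟩ := QuotientGroup.mk_out_eq_mul (Subgroup.center Q) b
    rw [Subgroup.mem_center_iff] at hy hz
    simp only [hy', hz', commutatorElement_def]
    rw [_root_.mul_inv_rev, _root_.mul_inv_rev]
    calc a * y * (b * z) * (y⁻¹ * a⁻¹) * (z⁻¹ * b⁻¹)
        = a * (y * (b * z)) * (y⁻¹ * a⁻¹) * (z⁻¹ * b⁻¹) := by group
      _ = a * (b * z) * (a⁻¹) * (z⁻¹ * b⁻¹) := by rw [← hy]; group
      _ = a * b * (z * a⁻¹) * (z⁻¹ * b⁻¹) := by group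
      _ = a * b * a⁻¹ * b⁻¹ := by rw [← hz]; group
  have : Finite (commutator Q) := inferInstance
  rw [hQ] at this
  exact Finite.of_equiv _ Subgroup.topEquiv.toEquiv

/-- If `Γ` is abelian under `ρ`, the elements of `Γ` whose image under `ρ` is `q`-power torsion. -/
def powTorsion {G Q : Type*} [Group G] [Group Q] (Γ : Subgroup G) (ρ : G →* Q) (q : ℕ)
    (hρ : ∀ a ∈ Γ, ∀ b ∈ Γ, Commute (ρ a) (ρ b)) : Subgroup G where
  carrier := {g | g ∈ Γ ∧ ∃ k, ρ g ^ q ^ k = 1}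
  one_mem' := ⟨one_mem _, 0, by simp⟩
  mul_mem' := by
    rintro a b ⟨ha, k, hk⟩ ⟨hb, l, hl⟩
    refine ⟨mul_mem ha hb, k + l, ?_⟩
    rw [map_mul, (hρ a ha b hb).mul_pow, pow_add, pow_mul, hk, mul_comm, pow_mul, hl, one_pow,
      one_pow, one_mul]
  inv_mem' := by
    rintro a ⟨ha, k, hk⟩
    exact ⟨inv_mem ha, k, by rw [map_inv, inv_pow, hk, inv_one]⟩

variable {G Q : Type*} [Group G] [Group Q] {Γ : Subgroup G} {ρ : G →* Q} {q : ℕ}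
  {hρ : ∀ a ∈ Γ, ∀ b ∈ Γ, Commute (ρ a) (ρ b)}

lemma powTorsion_le : powTorsion Γ ρ q hρ ≤ Γ := fun _ h => h.1

instance powTorsion_normal [Γ.Normal] : (powTorsion Γ ρ q hρ).Normal where
  conj_mem := by
    rintro a ⟨ha, k, hk⟩ g
    refine ⟨Subgroup.Normal.conj_mem inferInstance a ha g, k, ?_⟩
    rw [map_mul, map_mul, map_inv, conj_pow, hk]; group

lemma commutator_mem_powTorsion [Γ.Normal]
    (hpow : ∀ a ∈ Γ, ∃ k, ∀ g, Commute (ρ a ^ q ^ k) (ρ g)) {a : G} (ha : a ∈ Γ) (g : G) :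
    g * a * g⁻¹ * a⁻¹ ∈ powTorsion Γ ρ q hρ := by
  have hc := Subgroup.Normal.conj_mem inferInstance a ha g
  obtain ⟨k, hk⟩ := hpow a ha
  refine ⟨mul_mem hc (inv_mem ha), k, ?_⟩
  rw [map_mul, (hρ _ hc _ (inv_mem ha)).mul_pow, map_mul, map_mul, map_inv, map_inv, conj_pow,
    ← (hk g).eq]
  group

lemma abelianization_eq_one_iff (Γ : Subgroup G) [Γ.Normal] (g : Γ) :
    Abelianization.of g = 1 ↔ (g : G) ∈ ⁅Γ, Γ⁆ := by
  rw [← MonoidHom.mem_ker, Abelianization.ker_of, ← Subgroup.map_subtype_commutator]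
  simp

lemma isPGroup_abelianization [Γ.Normal] (h : ∀ g ∈ Γ, ∃ k : ℕ, g ^ q ^ k ∈ ⁅Γ, Γ⁆) :
    IsPGroup q (Abelianization Γ) := by
  intro z
  obtain ⟨g, rfl⟩ := QuotientGroup.mk_surjective z
  obtain ⟨k, hk⟩ := h g g.2
  refine ⟨k, ?_⟩
  change Abelianization.of g ^ _ = 1
  rw [← map_pow, abelianization_eq_one_iff]
  exact hk

lemma finite_abelianization [Γ.Normal] (h : Finite (Γ.map (QuotientGroup.mk' ⁅Γ, Γ⁆))) :
    Finite (Abelianization Γ) := by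
  let f : Γ →* Γ.map (QuotientGroup.mk' ⁅Γ, Γ⁆) := (QuotientGroup.mk' ⁅Γ, Γ⁆).subgroupMap Γ
  have hf : ∀ g, f g = 1 → Abelianization.of g = 1 := by
    intro g hg
    rw [abelianization_eq_one_iff]
    have := congrArg Subtype.val hg
    exact (QuotientGroup.eq_one_iff _).mp this
  have hinj : ∀ a b : Γ, f a = f b → Abelianization.of a = Abelianization.of b := by
    intro a b hab
    rw [← mul_inv_eq_one, ← map_inv, ← map_mul]
    exact hf _ (by rw [map_mul, map_inv, hab, mul_inv_cancel])
  have hs : Function.Surjective f := (QuotientGroup.mk' ⁅Γ, Γ⁆).subgroupMap_surjective Γ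
  refine Finite.of_surjective (fun y => Abelianization.of (hs y).choose) fun z => ?_
  obtain ⟨g, rfl⟩ := QuotientGroup.mk_surjective z
  exact ⟨f g, hinj _ _ (hs (f g)).choose_spec⟩

lemma abelianization_transfer {G G' : Type*} [Group G] [Group G'] {f : G →* G'}
    (hf : Function.Surjective f) (h : Finite (Abelianization G) ∧ IsPGroup q (Abelianization G)) :
    Finite (Abelianization G') ∧ IsPGroup q (Abelianization G') := by
  have hs : Function.Surjective (Abelianization.map f) := by
    intro z
    obtain ⟨g, rfl⟩ := QuotientGroup.mk_surjective z
    obtain ⟨g, rfl⟩ := hf g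
    exact ⟨Abelianization.of g, rfl⟩
  have := h.1
  exact ⟨Finite.of_surjective _ hs, h.2.of_surjective _ hs⟩

lemma finite_closure_of_torsion {s : Set Q} (hs : s.Finite)
    (hcomm : ∀ a ∈ Subgroup.closure s, ∀ b ∈ Subgroup.closure s, Commute a b)
    (htor : ∀ a ∈ Subgroup.closure s, IsOfFinOrder a) : Finite (Subgroup.closure s) := by
  let _ : CommGroup (Subgroup.closure s) :=
    { (inferInstance : Group (Subgroup.closure s)) with
      mul_comm := fun a b => Subtype.ext (hcomm a a.2 b b.2) }
  have : Finite s := hs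
  have : Group.FG (Subgroup.closure s) := Group.closure_finite_fg s
  refine CommGroup.finite_of_fg_isMulTorsion _ fun g => Submonoid.isOfFinOrder_coe.mp (htor g g.2)

end Groups

section Congruence

variable {A : Type*} [CommRing A]

lemma mem_Gamma {I : Ideal A} {g : SpecialLinearGroup (Fin 2) A} :
    g ∈ Gamma A I ↔ g.1 0 0 - 1 ∈ I ∧ g.1 0 1 ∈ I ∧ g.1 1 0 ∈ I ∧ g.1 1 1 - 1 ∈ I := by
  unfold Gamma
  rw [MonoidHom.mem_ker]
  have hm : ∀ i j, (SpecialLinearGroup.map (Ideal.Quotient.mk I) g).1 i j =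
    Ideal.Quotient.mk I (g.1 i j) := fun i j => rfl
  have h1 : ∀ a : A, Ideal.Quotient.mk I a = 1 ↔ a - 1 ∈ I := fun a => by
    rw [← map_one (Ideal.Quotient.mk I), Ideal.Quotient.eq]
  constructor
  · intro h
    have hij := fun i j => congrArg (fun g => g.1 i j) h
    simp only [hm] at hij
    simp only [← h1, ← Ideal.Quotient.eq_zero_iff_mem, hij]
    simp
  · rintro ⟨h00, h01, h10, h11⟩
    rw [← h1] at h00 h11
    rw [← Ideal.Quotient.eq_zero_iff_mem] at h01 h10
    apply SL2_ext
    · exact h00.trans (by simp)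
    · exact h01.trans (by simp)
    · exact h10.trans (by simp)
    · exact h11.trans (by simp)

lemma mem_Gamma_span {x : A} {g : SpecialLinearGroup (Fin 2) A} :
    g ∈ Gamma A (Ideal.span {x}) ↔
      x ∣ g.1 0 0 - 1 ∧ x ∣ g.1 0 1 ∧ x ∣ g.1 1 0 ∧ x ∣ g.1 1 1 - 1 := by
  simp only [mem_Gamma, Ideal.mem_span_singleton]

instance Gamma_normal (I : Ideal A) : (Gamma A I).Normal := MonoidHom.normal_ker _

lemma upper_mem_Gamma {x t : A} : upper (x * t) ∈ Gamma A (Ideal.span {x}) := by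
  rw [mem_Gamma_span]; simp

lemma lower_mem_Gamma {x t : A} : lower (x * t) ∈ Gamma A (Ideal.span {x}) := by
  rw [mem_Gamma_span]; simp

lemma Gamma_le_of_dvd {x y : A} (h : x ∣ y) :
    Gamma A (Ideal.span {y}) ≤ Gamma A (Ideal.span {x}) := by
  intro g hg
  rw [mem_Gamma_span] at *
  exact ⟨h.trans hg.1, h.trans hg.2.1, h.trans hg.2.2.1, h.trans hg.2.2.2⟩

lemma mem_Gamma_mul {x y : A} (h : IsCoprime x y) {g : SpecialLinearGroup (Fin 2) A}
    (hx : g ∈ Gamma A (Ideal.span {x})) (hy : g ∈ Gamma A (Ideal.span {y})) :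
    g ∈ Gamma A (Ideal.span {x * y}) := by
  rw [mem_Gamma_span] at *
  exact ⟨h.mul_dvd hx.1 hy.1, h.mul_dvd hx.2.1 hy.2.1, h.mul_dvd hx.2.2.1 hy.2.2.1,
    h.mul_dvd hx.2.2.2 hy.2.2.2⟩

lemma finiteIndex_Gamma (I : Ideal A) [Finite (A ⧸ I)] : (Gamma A I).FiniteIndex := by
  have : Finite (SpecialLinearGroup (Fin 2) (A ⧸ I)) :=
    Finite.of_injective (fun g => g.1) Subtype.val_injective
  unfold Gamma
  infer_instance

lemma exists_pow_eq {x : A} {g : SpecialLinearGroup (Fin 2) A}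
    (hg : g ∈ Gamma A (Ideal.span {x})) : ∃ B : Matrix (Fin 2) (Fin 2) A, ∀ n : ℕ,
      ∃ C : Matrix (Fin 2) (Fin 2) A, (g ^ n).1 = 1 + (n * x) • B + x ^ 2 • C := by
  obtain ⟨⟨a, ha⟩, ⟨b, hb⟩, ⟨c, hc⟩, ⟨d, hd⟩⟩ := mem_Gamma_span.mp hg
  refine ⟨!![a, b; c, d], fun n => ?_⟩
  have hB : g.1 = 1 + x • !![a, b; c, d] := by
    ext i j
    fin_cases i <;> fin_cases j <;> simp [← ha, ← hb, ← hc, ← hd]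
  set B := !![a, b; c, d]
  induction n with
  | zero => exact ⟨0, by simp⟩
  | succ n ih =>
    obtain ⟨C, hC⟩ := ih
    refine ⟨(n : A) • (B * B) + C + x • (C * B), ?_⟩
    rw [pow_succ]
    change (g ^ n).1 * g.1 = _
    rw [hC, hB]
    simp only [mul_add, add_mul, mul_one, one_mul, Matrix.smul_mul, Matrix.mul_smul, smul_add,
      smul_smul, Nat.cast_add, Nat.cast_one, add_smul]
    ring_nf
    abel

lemma pow_mem_Gamma {q : ℕ} {i : ℕ} (hi : 1 ≤ i) {g : SpecialLinearGroup (Fin 2) A}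
    (hg : g ∈ Gamma A (Ideal.span {(q : A) ^ i})) :
    g ^ q ∈ Gamma A (Ideal.span {(q : A) ^ (i + 1)}) := by
  obtain ⟨B, hB⟩ := exists_pow_eq hg
  obtain ⟨C, hC⟩ := hB q
  obtain ⟨k, rfl⟩ := Nat.exists_eq_add_of_le' hi
  rw [mem_Gamma_span, hC]
  have h : ∀ i j, (q : A) ^ (k + 1 + 1) ∣ (q * q ^ (k + 1)) * B i j + (q ^ (k + 1)) ^ 2 * C i j :=
    fun i j => ⟨B i j + q ^ k * C i j, by ring⟩
  simpa [add_sub_right_comm, add_assoc] using ⟨h 0 0, h 0 1, h 1 0, h 1 1⟩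

lemma pow_pow_mem_Gamma {q : ℕ} {g : SpecialLinearGroup (Fin 2) A}
    (hg : g ∈ Gamma A (Ideal.span {(q : A)})) (k : ℕ) :
    g ^ q ^ k ∈ Gamma A (Ideal.span {(q : A) ^ (k + 1)}) := by
  induction k with
  | zero => simpa using hg
  | succ k ih => rw [pow_succ q k, pow_mul]; exact pow_mem_Gamma (by omega) ih

end Congruence

section Quotient

variable {A F : Type*} [CommRing A] [Field F] {φ : A →+* F} (hφ : Function.Surjective φ)
  {K : Subgroup (SpecialLinearGroup (Fin 2) A)} [K.Normal]
  (hK : K ≤ (SpecialLinearGroup.map φ).ker) (hU : ∀ a, φ a = 0 → upper a ∈ K)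

/-- The root subgroup in a quotient of `SL₂(A)`, parametrized by a quotient field of `A`. -/
noncomputable def rootElement (K : Subgroup (SpecialLinearGroup (Fin 2) A)) [K.Normal] (t : F) :
    SpecialLinearGroup (Fin 2) A ⧸ K :=
  QuotientGroup.mk' K (upper (Function.surjInv hφ t))

include hU in
lemma rootElement_map (a : A) : rootElement hφ K (φ a) = QuotientGroup.mk' K (upper a) := by
  refine QuotientGroup.eq.mpr ?_
  rw [← upper_neg, ← upper_add]
  apply hU
  rw [map_add, map_neg, Function.surjInv_eq hφ, neg_add_cancel]

include hU in
lemma rootElement_add (s t : F) :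
    rootElement hφ K (s + t) = rootElement hφ K s * rootElement hφ K t := by
  obtain ⟨a, rfl⟩ := hφ s
  obtain ⟨b, rfl⟩ := hφ t
  rw [← map_add, rootElement_map hφ hU, rootElement_map hφ hU, rootElement_map hφ hU, upper_add,
    map_mul]

include hU in
lemma weyl_eq_rootElement : QuotientGroup.mk' K (weyl A) = rootElement hφ K 1 *
    (QuotientGroup.mk' K (weyl A) * rootElement hφ K 1 * (QuotientGroup.mk' K (weyl A))⁻¹) *
    rootElement hφ K 1 := by
  rw [← map_one φ, rootElement_map hφ hU, ← map_inv, ← map_mul, ← map_mul, weyl_conj_upper,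
    ← map_mul, ← map_mul, ← weyl_eq]

lemma map_upper (a : A) : SpecialLinearGroup.map φ (upper a) = upper (φ a) := by
  apply SL2_ext <;> simp

lemma map_weyl : SpecialLinearGroup.map φ (weyl A) = weyl F := by
  apply SL2_ext <;> simp

lemma map_torus (u : Aˣ) :
    SpecialLinearGroup.map φ (torus u) = torus (Units.map (φ : A →* F) u) := by
  apply SL2_ext <;> simp

lemma lift_rootElement (t : F) :
    QuotientGroup.lift K (SpecialLinearGroup.map φ) hK (rootElement hφ K t) = upper t := by
  unfold rootElement
  rw [QuotientGroup.mk'_apply, QuotientGroup.lift_mk, map_upper, Function.surjInv_eq hφ]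

include hU in
lemma closure_rootElement (hgen : Subgroup.closure (Set.range (upper (A := A)) ∪ {weyl A}) = ⊤) :
    Subgroup.closure (Set.range (rootElement hφ K) ∪ {QuotientGroup.mk' K (weyl A)}) = ⊤ := by
  have h1 : Set.range (rootElement hφ K) ∪ {QuotientGroup.mk' K (weyl A)} =
      QuotientGroup.mk' K '' (Set.range (upper (A := A)) ∪ {weyl A}) := by
    rw [Set.image_union, Set.image_singleton, ← Set.range_comp]
    congr 1
    ext z
    constructor
    · rintro ⟨t, rfl⟩
      obtain ⟨a, rfl⟩ := hφ t
      exact ⟨a, (rootElement_map hφ hU a).symm⟩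
    · rintro ⟨a, rfl⟩
      exact ⟨φ a, rootElement_map hφ hU a⟩
  rw [h1, ← MonoidHom.map_closure, hgen, Subgroup.map_top_of_surjective _
    (QuotientGroup.mk'_surjective K)]

lemma ker_le_of_injective
    (h : Function.Injective (QuotientGroup.lift K (SpecialLinearGroup.map φ) hK)) :
    (SpecialLinearGroup.map φ).ker ≤ K := by
  intro g hg
  rw [← QuotientGroup.eq_one_iff]
  apply h
  rw [QuotientGroup.lift_mk, map_one]
  exact hg

include hφ hK hU in
lemma ker_le_of_units (hF : ∀ r : F, r ≠ 0 → r = 1 ∨ r = -1)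
    (hgen : Subgroup.closure (Set.range (upper (A := A)) ∪ {weyl A}) = ⊤) :
    (SpecialLinearGroup.map φ).ker ≤ K := by
  apply ker_le_of_injective hK
  have hx := rootElement_add (K := K) hφ hU
  have hw := weyl_eq_rootElement (K := K) hφ hU
  have hww : weyl A * weyl A * (weyl A * weyl A) = 1 := by
    apply SL2_ext <;> simp [SL2_mul]
  have hc : ∀ a : A, upper a * (weyl A * weyl A) = (weyl A * weyl A) * upper a := fun a => by
    apply SL2_ext <;> simp [SL2_mul]
  have h1 : steinbergH (rootElement hφ K) (QuotientGroup.mk' K (weyl A)) (-1) =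
      QuotientGroup.mk' K (weyl A * weyl A) := by
    rw [steinbergH_neg_one hx hw, ← map_inv, ← map_mul]
    congr 1
    rw [← _root_.mul_inv_rev, inv_eq_of_mul_eq_one_left hww]
  have h11 := steinbergH_one hw
  refine injective_of_relations hx hw ?_ ?_ (lift_rootElement hφ hK) ?_
    (closure_rootElement hφ hU hgen)
  · intro r t hr
    obtain ⟨a, rfl⟩ := hφ t
    rcases hF r hr with rfl | rfl
    · rw [h11]; simp
    · rw [h1, neg_one_sq, one_mul, rootElement_map hφ hU, ← map_mul, ← map_mul, hc]
  · intro r s hr hs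
    rcases hF r hr with rfl | rfl <;> rcases hF s hs with rfl | rfl
    · rw [h11, one_mul, h11, one_mul]
    · rw [h11, one_mul, one_mul]
    · rw [h11, mul_one, mul_one]
    · rw [neg_mul_neg, one_mul, h11, h1, ← map_mul, hww, map_one]
  · rw [QuotientGroup.mk'_apply, QuotientGroup.lift_mk, map_weyl]

include hφ hK hU in
lemma ker_le_of_central [Finite F]
    (hcen : ∀ a ∈ (SpecialLinearGroup.map φ).ker, ∀ g, g * a * g⁻¹ * a⁻¹ ∈ K)
    (u : Aˣ) (hu : φ u ^ 2 ≠ 1)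
    (hgen : Subgroup.closure (Set.range (upper (A := A)) ∪ {weyl A}) = ⊤) :
    (SpecialLinearGroup.map φ).ker ≤ K := by
  apply ker_le_of_injective hK
  have hu0 : φ u ≠ 0 := (u.isUnit.map φ).ne_zero
  refine injective_of_central (η := QuotientGroup.mk' K (torus u)) (μ := φ u)
    (rootElement_add hφ hU) (weyl_eq_rootElement hφ hU) (lift_rootElement hφ hK) ?_ ?_ hu0 hu ?_ ?_
    (closure_rootElement hφ hU hgen)
  · rw [QuotientGroup.mk'_apply, QuotientGroup.lift_mk, map_weyl]
  · intro k hk g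
    obtain ⟨k, rfl⟩ := QuotientGroup.mk'_surjective K k
    obtain ⟨g, rfl⟩ := QuotientGroup.mk'_surjective K g
    rw [QuotientGroup.mk'_apply, QuotientGroup.lift_mk] at hk
    have h := hcen k hk g
    rw [← QuotientGroup.eq_one_iff] at h
    have h' : QuotientGroup.mk' K (g * k * g⁻¹ * k⁻¹) = 1 := h
    simp only [map_mul, map_inv] at h'
    rw [mul_inv_eq_one, mul_inv_eq_iff_eq_mul] at h'
    exact h'.symm
  · rw [QuotientGroup.mk'_apply, QuotientGroup.lift_mk, map_torus]
    congr 1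
    ext
    rfl
  · intro t
    obtain ⟨a, rfl⟩ := hφ t
    rw [← map_pow, ← map_mul φ, rootElement_map hφ hU, rootElement_map hφ hU, ← map_inv,
      ← map_mul, ← map_mul, torus_conj_upper]

end Quotient

section LinearGroup

variable {A : Type*} [CommRing A]

lemma torus_mem_Gamma {x : A} {u : Aˣ} (hu : x ∣ (u : A) - 1) :
    torus u ∈ Gamma A (Ideal.span {x}) := by
  rw [mem_Gamma_span]
  refine ⟨by simpa using hu, by simp, by simp, ?_⟩
  obtain ⟨c, hc⟩ := hu
  refine ⟨-c * (u⁻¹ : Aˣ), ?_⟩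
  have : (((u⁻¹ : Aˣ) : A) - 1) = -((u : A) - 1) * (u⁻¹ : Aˣ) := by
    rw [neg_sub, sub_mul, Units.mul_inv, one_mul]
  simp [this, hc, mul_assoc]

lemma torus_commutator_upper (u : Aˣ) (a : A) :
    ⁅torus u, upper a⁆ = upper (((u : A) ^ 2 - 1) * a) := by
  rw [commutatorElement_def, torus_conj_upper, ← upper_neg, ← upper_add]
  ring_nf

lemma lower_eq_conj (a : A) : lower a = weyl A * upper (-a) * (weyl A)⁻¹ := by
  rw [weyl_conj_upper, neg_neg]

lemma lower_mem_of_upper_mem {K : Subgroup (SpecialLinearGroup (Fin 2) A)} [K.Normal] {a : A}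
    (h : upper a ∈ K) : lower a ∈ K := by
  rw [lower_eq_conj, upper_neg]
  exact Subgroup.Normal.conj_mem inferInstance _ (inv_mem h) _

lemma upper_mem_commutator {x : A} {u : Aˣ} (hu : x ∣ (u : A) - 1) (t : A) :
    upper (((u : A) ^ 2 - 1) * (x * t)) ∈
      ⁅Gamma A (Ideal.span {x}), Gamma A (Ideal.span {x})⁆ := by
  rw [← torus_commutator_upper]
  exact Subgroup.commutator_mem_commutator (torus_mem_Gamma hu) upper_mem_Gamma

end LinearGroup

section Localization

variable {S : Set ℕ}

lemma finite_quotient_span {m : ℕ} (hS : ∀ p ∈ S, Nat.Prime p) (hm0 : m ≠ 0)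
    (hm : ∀ p ∈ S, ¬ p ∣ m) : Finite (ZS S ⧸ Ideal.span {(m : ZS S)}) := by
  have : NeZero m := ⟨hm0⟩
  refine Finite.of_surjective
    (fun i : ZMod m => Ideal.Quotient.mk (Ideal.span {(m : ZS S)}) (i.val : ZS S)) fun z => ?_
  obtain ⟨α, rfl⟩ := Ideal.Quotient.mk_surjective z
  obtain ⟨k, hk⟩ := exists_int_dvd_sub hS hm α
  refine ⟨k, ?_⟩
  rw [Ideal.Quotient.eq, Ideal.mem_span_singleton, dvd_sub_comm]
  have h1 : (m : ZS S) ∣ ((k - (k : ZMod m).val : ℤ) : ZS S) := by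
    rw [intCast_dvd_iff hS hm, ZMod.val_intCast]
    exact Int.dvd_self_sub_emod
  convert dvd_add hk h1 using 1
  push_cast
  ring

lemma exists_int_mul_add_eq_one {q : ℕ} (hS : ∀ p ∈ S, Nat.Prime p) (hq : q.Prime)
    (hqS : ∀ p ∈ S, ¬ p ∣ q) {α : ZS S} (hα : ¬ (q : ZS S) ∣ α) :
    ∃ (y : ℤ) (c : ZS S), y * α + q * c = 1 := by
  obtain ⟨k, hk⟩ := exists_int_dvd_sub hS hqS α
  have hqk : ¬ (q : ℤ) ∣ k := by
    rw [← intCast_dvd_iff hS hqS]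
    intro h
    exact hα (by simpa using dvd_add hk h)
  obtain ⟨x, y, hxy⟩ := ((Nat.prime_iff_prime_int.mp hq).coprime_iff_not_dvd).mpr hqk
  obtain ⟨c, hc⟩ := hk
  refine ⟨y, x - y * c, ?_⟩
  have h3 : ((x * q + y * k : ℤ) : ZS S) = 1 := by rw [hxy, Int.cast_one]
  push_cast at h3
  rw [← h3]
  linear_combination y * hc

lemma isMaximal_span {q : ℕ} (hS : ∀ p ∈ S, Nat.Prime p) (hq : q.Prime)
    (hqS : ∀ p ∈ S, ¬ p ∣ q) : (Ideal.span {(q : ZS S)}).IsMaximal := by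
  rw [Ideal.isMaximal_iff]
  constructor
  · rw [Ideal.mem_span_singleton]
    intro h
    have h1 := (intCast_dvd_iff hS hqS 1).mp (by simpa using h)
    exact hq.one_lt.ne' (by exact_mod_cast Int.eq_one_of_dvd_one (by positivity) h1)
  · intro J α hJ hα hαJ
    rw [Ideal.mem_span_singleton] at hα
    obtain ⟨y, c, h⟩ := exists_int_mul_add_eq_one hS hq hqS hα
    rw [← h]
    exact add_mem (J.mul_mem_left _ hαJ)
      (J.mul_mem_right _ (hJ (Ideal.mem_span_singleton_self _)))

lemma not_dvd_of_prime {q : ℕ} (hS : ∀ p ∈ S, Nat.Prime p) (hq : q.Prime) (hqS : q ∉ S) :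
    ∀ p ∈ S, ¬ p ∣ q := by
  intro p hp h
  rw [Nat.prime_dvd_prime_iff_eq (hS p hp) hq] at h
  exact hqS (h ▸ hp)

end Localization

section Small

lemma commute_map_commutator {G : Type*} [Group G] (Γ : Subgroup G) [Γ.Normal] :
    ∀ a ∈ Γ, ∀ b ∈ Γ, Commute (QuotientGroup.mk' ⁅Γ, Γ⁆ a) (QuotientGroup.mk' ⁅Γ, Γ⁆ b) := by
  intro a ha b hb
  rw [← commutatorElement_eq_one_iff_commute, ← map_commutatorElement, QuotientGroup.mk'_apply,
    QuotientGroup.eq_one_iff]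
  exact Subgroup.commutator_mem_commutator ha hb

lemma Gamma_le_normalClosure {S : Set ℕ} {q : ℕ} (hS : ∀ p ∈ S, Nat.Prime p) (hq : q.Prime)
    (hqS : q ∉ S) (hq23 : q = 2 ∨ q = 3) : Gamma (ZS S) (Ideal.span {(q : ZS S)}) ≤
      Subgroup.normalClosure (Set.range fun t : ZS S => upper (q * t)) := by
  have hqS' := not_dvd_of_prime hS hq hqS
  have := isMaximal_span hS hq hqS'
  let _ : Field (ZS S ⧸ Ideal.span {(q : ZS S)}) := Ideal.Quotient.field _
  refine ker_le_of_units Ideal.Quotient.mk_surjective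
    (Subgroup.normalClosure_le_normal (N := Gamma (ZS S) (Ideal.span {(q : ZS S)})) ?_) ?_ ?_
    (closure_upper_weyl hS)
  · rintro _ ⟨t, rfl⟩
    exact upper_mem_Gamma
  · intro a ha
    obtain ⟨t, rfl⟩ := Ideal.mem_span_singleton.mp (Ideal.Quotient.eq_zero_iff_mem.mp ha)
    exact Subgroup.subset_normalClosure ⟨t, rfl⟩
  · intro r hr
    obtain ⟨α, rfl⟩ := Ideal.Quotient.mk_surjective r
    obtain ⟨k, hk⟩ := exists_int_dvd_sub hS hqS' α
    have h1 : ∀ n : ℤ, (q : ℤ) ∣ k - n → (q : ZS S) ∣ α - n := fun n hn => by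
      convert dvd_add hk ((intCast_dvd_iff hS hqS' _).mpr hn) using 1
      push_cast; ring
    rw [Ne, Ideal.Quotient.eq_zero_iff_mem, Ideal.mem_span_singleton] at hr
    have h0 : ¬ (q : ℤ) ∣ k - 0 := fun h => hr (by simpa using h1 0 h)
    have h2 : (q : ℤ) ∣ k - 1 ∨ (q : ℤ) ∣ k - (-1) := by
      rcases hq23 with rfl | rfl <;> push_cast at * <;> omega
    rw [← map_one (Ideal.Quotient.mk _), ← map_neg, Ideal.Quotient.eq, Ideal.Quotient.eq,
      Ideal.mem_span_singleton, Ideal.mem_span_singleton]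
    exact h2.imp (fun h => by simpa using h1 _ h) (fun h => by simpa using h1 _ h)

lemma finite_abelianization_of_unit {S : Set ℕ} {q k : ℕ} (hS : ∀ p ∈ S, Nat.Prime p)
    (hq : q.Prime) (hqS : q ∉ S) (hq23 : q = 2 ∨ q = 3) {u : (ZS S)ˣ}
    (hu : (q : ZS S) ∣ (u : ZS S) - 1) (hk : Associated ((q : ZS S) ^ k) ((u : ZS S) ^ 2 - 1)) :
    Finite (Abelianization ↥(Gamma (ZS S) (Ideal.span {(q : ZS S)}))) ∧
      IsPGroup q (Abelianization ↥(Gamma (ZS S) (Ideal.span {(q : ZS S)}))) := by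
  have hqS' := not_dvd_of_prime hS hq hqS
  have hqk : ∀ p ∈ S, ¬ p ∣ q ^ k := fun p hp h => hqS' p hp ((hS p hp).dvd_of_dvd_pow h)
  set Γ := Gamma (ZS S) (Ideal.span {(q : ZS S)}) with hΓ
  set ρ := QuotientGroup.mk' ⁅Γ, Γ⁆ with hρdef
  have hρ := commute_map_commutator Γ
  have hD : ∀ t, ρ (upper (q * (q ^ k * t))) = 1 := fun t => by
    rw [hρdef, QuotientGroup.mk'_apply, QuotientGroup.eq_one_iff]
    obtain ⟨v, hv⟩ := hk
    have h1 := upper_mem_commutator hu ((v⁻¹ : (ZS S)ˣ) * t)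
    rw [← hv] at h1
    convert h1 using 2
    linear_combination (-(q : ZS S) * q ^ k * t) * v.mul_inv
  have hUq : Subgroup.normalClosure (Set.range fun t : ZS S => upper (q * t)) ≤
      powTorsion Γ ρ q hρ := by
    refine Subgroup.normalClosure_le_normal ?_
    rintro _ ⟨t, rfl⟩
    refine ⟨upper_mem_Gamma, k, ?_⟩
    rw [← map_pow, ← upper_nsmul, ← hD t]
    congr 2
    push_cast; ring
  have hle := Gamma_le_normalClosure hS hq hqS hq23
  refine ⟨finite_abelianization ?_, isPGroup_abelianization fun g hg => ?_⟩
  · have hgen : Γ = Subgroup.closure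
        (Group.conjugatesOfSet (Set.range fun t : ZS S => upper (q * t))) :=
      le_antisymm hle (hUq.trans powTorsion_le)
    have hmap : Γ.map ρ = Subgroup.closure
        (ρ '' Group.conjugatesOfSet (Set.range fun t : ZS S => upper (q * t))) := by
      rw [← MonoidHom.map_closure, ← hgen]
    change Finite (Γ.map ρ)
    rw [hmap]
    refine finite_closure_of_torsion ?_ ?_ ?_
    · have h1 := finite_quotient_span hS (pow_ne_zero k hq.ne_zero) hqk
      have h2 := finite_quotient_span hS hq.ne_zero hqS'
      have h3 := finiteIndex_Gamma (Ideal.span {(q : ZS S)})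
      rw [← hΓ] at h3
      refine Set.Finite.subset (Set.finite_range
        fun p : (SpecialLinearGroup (Fin 2) (ZS S) ⧸ Γ) ×
          (ZS S ⧸ Ideal.span {((q ^ k : ℕ) : ZS S)}) =>
          ρ (p.1.out * upper (q * Quotient.out p.2) * p.1.out⁻¹)) ?_
      rintro _ ⟨z, hz, rfl⟩
      obtain ⟨_, ⟨t, rfl⟩, hz⟩ := Group.mem_conjugatesOfSet_iff.mp hz
      obtain ⟨g, rfl⟩ := isConj_iff.mp hz
      refine ⟨(QuotientGroup.mk g, Ideal.Quotient.mk _ t), ?_⟩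
      obtain ⟨γ, hγ⟩ := QuotientGroup.mk_out_eq_mul Γ g
      dsimp only
      have h4 : Ideal.Quotient.mk (Ideal.span {((q ^ k : ℕ) : ZS S)})
          (Quotient.out (Ideal.Quotient.mk (Ideal.span {((q ^ k : ℕ) : ZS S)}) t)) =
          Ideal.Quotient.mk (Ideal.span {((q ^ k : ℕ) : ZS S)}) t := Quotient.out_eq _
      rw [Ideal.Quotient.eq, Ideal.mem_span_singleton] at h4
      obtain ⟨c, hc⟩ := h4
      rw [sub_eq_iff_eq_add] at hc
      rw [hγ, hc, mul_add, upper_add]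
      have h5 := hD c
      have h6 : Commute (ρ γ) (ρ (upper (q * t))) := hρ γ γ.2 _ upper_mem_Gamma
      push_cast
      simp only [map_mul, map_inv, h5, one_mul, _root_.mul_inv_rev]
      rw [mul_assoc (ρ g), h6.eq]; group
    · rw [← hmap]
      rintro _ ⟨a, ha, rfl⟩ _ ⟨b, hb, rfl⟩
      exact hρ a ha b hb
    · rw [← hmap]
      rintro _ ⟨a, ha, rfl⟩
      obtain ⟨-, k, hk⟩ := hUq (hle ha)
      exact isOfFinOrder_iff_pow_eq_one.mpr ⟨q ^ k, pow_pos hq.pos k, hk⟩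
  · obtain ⟨-, k, hk⟩ := hUq (hle hg)
    refine ⟨k, ?_⟩
    rw [← map_pow] at hk
    exact (QuotientGroup.eq_one_iff _).mp hk

end Small

section Level

lemma exists_level {S : Set ℕ} {q : ℕ} (hS : ∀ p ∈ S, Nat.Prime p) (hq : q.Prime) (hqS : q ∉ S)
    (h2 : 2 ∈ S) (h3 : 3 ∈ S) (hq2 : q ≠ 2) (hq3 : q ≠ 3) :
    ∃ (m r : ℕ) (u : (ZS S)ˣ), m ≠ 0 ∧ (∀ p ∈ S, ¬ p ∣ m) ∧ r.Prime ∧ (q : ZS S) ∣ (u : ZS S) - 1 ∧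
      Associated (m : ZS S) ((u : ZS S) ^ 2 - 1) ∧ (q * m).Coprime (2 * r) ∧
      ∀ j, ¬ r ∣ j → ¬ (q : ℤ) ∣ 4 ^ j - 1 := by
  have : Fact q.Prime := ⟨hq⟩
  have hqS' := not_dvd_of_prime hS hq hqS
  have h20 : (2 : ZMod q) ≠ 0 := by
    intro h
    have : ((2 : ℕ) : ZMod q) = 0 := by exact_mod_cast h
    rw [ZMod.natCast_eq_zero_iff, Nat.prime_dvd_prime_iff_eq hq Nat.prime_two] at this
    exact hq2 this
  have h30 : (3 : ZMod q) ≠ 0 := by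
    intro h
    have : ((3 : ℕ) : ZMod q) = 0 := by exact_mod_cast h
    rw [ZMod.natCast_eq_zero_iff, Nat.prime_dvd_prime_iff_eq hq Nat.prime_three] at this
    exact hq3 this
  have h40 : (4 : ZMod q) ≠ 0 := by
    have : (4 : ZMod q) = 2 * 2 := by norm_num
    rw [this]; exact mul_ne_zero h20 h20
  have h41 : (4 : ZMod q) ≠ 1 := by
    intro h
    apply h30
    linear_combination h
  set e := orderOf (4 : ZMod q) with he
  have hpow : (4 : ZMod q) ^ e = 1 := pow_orderOf_eq_one _
  have heq : e ∣ q - 1 := orderOf_dvd_of_pow_eq_one (ZMod.pow_card_sub_one_eq_one h40)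
  have he0 : e ≠ 0 := by
    rintro h
    rw [h] at heq
    have := hq.two_le
    have := Nat.eq_zero_of_zero_dvd heq
    omega
  have he1 : e ≠ 1 := fun h => h41 (orderOf_eq_one_iff.mp h)
  have hr := Nat.minFac_prime he1
  set r := e.minFac
  have hre : r ∣ e := Nat.minFac_dvd e
  have hsq : ((2 : ZMod q) ^ e - 1) * (2 ^ e + 1) = 0 := by
    have : (4 : ZMod q) = 2 ^ 2 := by norm_num
    rw [this, ← pow_mul, mul_comm, pow_mul] at hpow
    linear_combination hpow
  have hu2 := isUnit_of_mem hS h2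
  obtain ⟨u, hu, hu4⟩ : ∃ u : (ZS S)ˣ, (q : ZS S) ∣ (u : ZS S) - 1 ∧
      (u : ZS S) ^ 2 = ((4 ^ e : ℕ) : ZS S) := by
    have hd : ∀ n : ℤ, (n : ZMod q) = 0 → (q : ZS S) ∣ n := fun n hn => by
      rw [intCast_dvd_iff hS hqS']
      exact (ZMod.intCast_zmod_eq_zero_iff_dvd _ _).mp hn
    have h42 : ((2 : ZS S) ^ e) ^ 2 = ((4 ^ e : ℕ) : ZS S) := by
      rw [← pow_mul, mul_comm, pow_mul]; push_cast; norm_num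
    rcases mul_eq_zero.mp hsq with h | h
    · refine ⟨hu2.unit ^ e, ?_, ?_⟩
      · simpa using hd (2 ^ e - 1) (by push_cast; exact h)
      · simpa using h42
    · refine ⟨-hu2.unit ^ e, ?_, ?_⟩
      · simpa [neg_add_eq_sub, dvd_sub_comm] using hd (-(2 ^ e + 1)) (by push_cast; rw [h, neg_zero])
      · simpa using h42
  have h4e : 1 < 4 ^ e := Nat.one_lt_pow he0 (by norm_num)
  have hne : ((4 ^ e - 1 : ℕ) : ZS S) ≠ 0 := by
    rw [Nat.cast_ne_zero]; omega
  obtain ⟨m, hm0, hm, hmu⟩ := exists_associated hS hne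
  refine ⟨m, r, u, hm0.ne', hm, hr, hu, ?_, ?_, ?_⟩
  · rw [hu4]
    convert hmu using 1
    rw [Nat.cast_sub h4e.le, Nat.cast_one]
  · have hcop2 : ∀ n, (∀ p ∈ S, ¬ p ∣ n) → n.Coprime 2 := fun n hn =>
      ((Nat.prime_two.coprime_iff_not_dvd).mpr (hn 2 h2)).symm
    have hqr : q.Coprime r := by
      rw [Nat.coprime_primes hq hr]
      rintro h
      have h1 := Nat.le_of_dvd (by have := hq.two_le; omega) (hre.trans heq)
      have := hq.two_le
      omega
    have hmr : m.Coprime r := by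
      rw [Nat.coprime_comm, hr.coprime_iff_not_dvd]
      intro hrm
      have hrS : ∀ p ∈ S, ¬ p ∣ r := fun p hp h => hm p hp (h.trans hrm)
      have hr4 : (r : ℤ) ∣ ((4 ^ e - 1 : ℕ) : ℤ) := by
        rw [← intCast_dvd_iff hS hrS]
        push_cast
        exact (Nat.cast_dvd_cast hrm).trans (by simpa using hmu.dvd)
      have : Fact r.Prime := ⟨hr⟩
      have h1 : (4 : ZMod r) ^ e = 1 := by
        have h := (ZMod.intCast_zmod_eq_zero_iff_dvd _ r).mpr hr4
        rw [Int.cast_natCast, Nat.cast_sub h4e.le] at h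
        push_cast at h
        exact sub_eq_zero.mp h
      have h4r : (4 : ZMod r) ≠ 0 := by
        intro h
        rw [h, zero_pow he0] at h1
        exact zero_ne_one h1
      have h2 : (4 : ZMod r) ^ (r - 1) = 1 := ZMod.pow_card_sub_one_eq_one h4r
      have hcop : e.Coprime (r - 1) := by
        have := hr.two_le
        exact Nat.coprime_of_lt_minFac (by omega) (by omega)
      have h5 : (4 : ZMod r) = 1 := by
        rw [← orderOf_eq_one_iff]
        exact Nat.eq_one_of_dvd_coprimes hcop (orderOf_dvd_of_pow_eq_one h1)
          (orderOf_dvd_of_pow_eq_one h2)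
      have h6 : ((3 : ℕ) : ZMod r) = 0 := by push_cast; linear_combination h5
      rw [ZMod.natCast_eq_zero_iff, Nat.prime_dvd_prime_iff_eq hr Nat.prime_three] at h6
      exact hrS 3 h3 (h6 ▸ dvd_rfl)
    exact Nat.Coprime.mul_left (Nat.Coprime.mul_right (hcop2 q hqS') hqr)
      (Nat.Coprime.mul_right (hcop2 m hm) hmr)
  · intro j hj h
    apply hj
    refine hre.trans (orderOf_dvd_of_pow_eq_one ?_)
    have := (ZMod.intCast_zmod_eq_zero_iff_dvd _ q).mpr h
    push_cast at this
    exact sub_eq_zero.mp this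

end Level

section Central

variable {S : Set ℕ} {Q : Type*} [Group Q] {ρ : SpecialLinearGroup (Fin 2) (ZS S) →* Q}
  {N : ℕ} (hN : ∀ t : ZS S, ρ (upper (N * t)) = 1 ∧ ρ (lower (N * t)) = 1)

include hN in
lemma map_eq_of_row_eq {y z : SpecialLinearGroup (Fin 2) (ZS S)}
    (hy : y ∈ Gamma (ZS S) (Ideal.span {(N : ZS S)}))
    (hz : z ∈ Gamma (ZS S) (Ideal.span {(N : ZS S)}))
    (h0 : y.1 0 0 = z.1 0 0) (h1 : y.1 0 1 = z.1 0 1) : ρ y = ρ z := by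
  obtain ⟨-, -, ⟨c, hc⟩, -⟩ := mem_Gamma_span.mp hy
  obtain ⟨-, -, ⟨d, hd⟩, -⟩ := mem_Gamma_span.mp hz
  have hyd := SL2_det y
  have hzd := SL2_det z
  have h : y = lower (N * (c * z.1 1 1 - y.1 1 1 * d)) * z := by
    apply SL2_ext <;> simp only [SL2_mul, lower_val, of_apply, cons_val', cons_val_zero,
      cons_val_one, cons_val_fin_one]
    · linear_combination h0
    · linear_combination h1
    · linear_combination z.1 1 0 * hyd - y.1 1 0 * hzd + z.1 1 1 * z.1 0 0 * hc
        - y.1 1 1 * z.1 0 0 * hd - z.1 1 0 * y.1 1 1 * h0 + z.1 1 0 * y.1 1 0 * h1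
    · linear_combination z.1 1 1 * hyd - y.1 1 1 * hzd + z.1 1 1 * z.1 0 1 * hc
        - y.1 1 1 * z.1 0 1 * hd - z.1 1 1 * y.1 1 1 * h0 + z.1 1 1 * y.1 1 0 * h1
  rw [h, map_mul, (hN _).2, one_mul]

include hN in
lemma commute_torus_of_dvd {g : SpecialLinearGroup (Fin 2) (ZS S)}
    (hg : g ∈ Gamma (ZS S) (Ideal.span {(N : ZS S)})) {U : (ZS S)ˣ}
    (hU : g.1 0 0 ∣ (U : ZS S) ^ 2 - 1) : Commute (ρ (torus U)) (ρ g) := by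
  obtain ⟨t, ht⟩ := hU
  obtain ⟨-, ⟨b, hb⟩, -, -⟩ := mem_Gamma_span.mp hg
  have h := map_eq_of_row_eq hN (Subgroup.Normal.conj_mem inferInstance g hg (torus U))
    (mul_mem hg (upper_mem_Gamma (t := b * t))) ?_ ?_
  · rw [map_mul, map_mul, map_mul, (hN _).1, mul_one, map_inv, mul_inv_eq_iff_eq_mul] at h
    exact h
  · rw [← torus_inv]
    simp only [SL2_mul, torus_val, upper_val, of_apply, cons_val', cons_val_zero,
      cons_val_one, cons_val_fin_one]
    linear_combination g.1 0 0 * U.mul_inv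
  · rw [← torus_inv]
    simp only [SL2_mul, torus_val, upper_val, of_apply, cons_val', cons_val_zero,
      cons_val_one, cons_val_fin_one, inv_inv]
    linear_combination g.1 0 1 * ht + g.1 0 0 * t * hb

lemma four_pow_dvd {P : ℕ} (hP : P.Prime) (hP2 : 2 ∣ P + 1) (k : ℕ) :
    (P : ℤ) ∣ 4 ^ ((P - 1) / 2 * k) - 1 := by
  have : Fact P.Prime := ⟨hP⟩
  have h2 : (2 : ZMod P) ≠ 0 := by
    intro h
    have : ((2 : ℕ) : ZMod P) = 0 := by exact_mod_cast h
    rw [ZMod.natCast_eq_zero_iff, Nat.prime_dvd_prime_iff_eq hP Nat.prime_two] at this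
    omega
  have h4 : (4 : ZMod P) = 2 ^ 2 := by norm_num
  rw [← ZMod.intCast_zmod_eq_zero_iff_dvd]
  push_cast
  rw [h4, ← pow_mul, ← mul_assoc, Nat.mul_div_cancel' (by omega), pow_mul,
    ZMod.pow_card_sub_one_eq_one h2, one_pow, sub_self]

variable {q : ℕ} (hS : ∀ p ∈ S, Nat.Prime p) (hq : q.Prime) (hqS : ∀ p ∈ S, ¬ p ∣ q) (hqN : q ∣ N)
  (hρ : ∀ a ∈ Gamma (ZS S) (Ideal.span {(q : ZS S)}),
    ∀ b ∈ Gamma (ZS S) (Ideal.span {(q : ZS S)}), Commute (ρ a) (ρ b)) (h2 : 2 ∈ S)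
  {r : ℕ} (hr : r.Prime) (hr4 : ∀ j, ¬ r ∣ j → ¬ (q : ℤ) ∣ 4 ^ j - 1)

include hN hS hq hqS hqN hρ h2 hr hr4 in
lemma commute_lower_one_of_primes {g : SpecialLinearGroup (Fin 2) (ZS S)}
    (hg : g ∈ Gamma (ZS S) (Ideal.span {(N : ZS S)})) {P P' : ℕ} (hP : P.Prime) (hP' : P'.Prime)
    (h0 : g.1 0 0 = P) (h1 : g.1 0 0 + g.1 0 1 = P') (hrP : 2 * r ∣ P + 1)
    (hrP' : 2 * r ∣ P' + 1) : Commute (ρ (lower 1)) (ρ g) := by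
  set j := (P - 1) / 2 * ((P' - 1) / 2) with hj
  have hrj : ¬ r ∣ j := by
    have key : ∀ x : ℕ, 2 * r ∣ x + 1 → x.Prime → ¬ r ∣ (x - 1) / 2 := by
      intro x hx hxp hrx
      have h2x : 2 ∣ x + 1 := (dvd_mul_right 2 r).trans hx
      have := hxp.two_le
      have h3 : r ∣ (x - 1) / 2 + 1 := by
        apply Nat.dvd_of_mul_dvd_mul_left two_pos
        convert hx using 1
        omega
      exact hr.one_lt.ne' (Nat.dvd_one.mp ((Nat.dvd_add_right hrx).mp h3))
    intro h
    exact (hr.dvd_mul.mp h).elim (key P hrP hP) (key P' hrP' hP')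
  let U : (ZS S)ˣ := (isUnit_of_mem hS h2).unit ^ j
  have hU : (U : ZS S) ^ 2 = ((4 ^ j : ℤ) : ZS S) := by
    simp only [U, Units.val_pow_eq_pow_val, IsUnit.unit_spec]
    rw [← pow_mul, mul_comm, pow_mul]; push_cast; norm_num
  have hdvd : ∀ x : ℕ, (x : ℤ) ∣ 4 ^ j - 1 → (x : ZS S) ∣ (U : ZS S) ^ 2 - 1 := fun x hx => by
    rw [hU]
    simpa using Int.cast_dvd_cast (α := ZS S) _ _ hx
  have hT := commute_torus_of_dvd hN hg (U := U)
    (h0 ▸ hdvd P (four_pow_dvd hP ((dvd_mul_right 2 r).trans hrP) _))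
  have hg4 := Subgroup.Normal.conj_mem inferInstance g hg (lower (-1))
  have hT4 := commute_torus_of_dvd hN hg4 (U := U) (by
    rw [← lower_neg, neg_neg]
    have : (lower (-1) * g * lower 1).1 0 0 = (P' : ZS S) := by
      rw [← h1]; simp [SL2_mul]
    rw [this]
    exact hdvd P' (by rw [hj, mul_comm]; exact four_pow_dvd hP' ((dvd_mul_right 2 r).trans hrP') _))
  let T : AddSubgroup (ZS S) :=
    { carrier := {t | Commute (ρ (lower t)) (ρ g)}
      zero_mem' := by simp [lower_zero]
      add_mem' := fun {a b} ha hb => by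
        simp only [Set.mem_ofPred_eq, lower_add, map_mul] at *
        exact ha.mul_left hb
      neg_mem' := fun {a} ha => by
        simp only [Set.mem_ofPred_eq, lower_neg, map_inv] at *
        exact ha.inv_left }
  have hTq : ∀ t, (q : ZS S) * t ∈ T := fun t =>
    hρ _ lower_mem_Gamma _ (Gamma_le_of_dvd (Nat.cast_dvd_cast hqN) hg)
  have hTv : 1 - ((U⁻¹ : (ZS S)ˣ) : ZS S) ^ 2 ∈ T := by
    have e : lower (1 - ((U⁻¹ : (ZS S)ˣ) : ZS S) ^ 2) =
        lower 1 * torus U * (lower 1)⁻¹ * (torus U)⁻¹ := by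
      rw [← lower_neg, mul_assoc, mul_assoc, ← mul_assoc (torus U), torus_conj_lower, ← lower_add]
      ring_nf
    change Commute (ρ (lower _)) (ρ g)
    rw [e, map_mul, map_inv ρ (torus U)]
    refine Commute.mul_left ?_ hT.inv_left
    rw [lower_neg, inv_inv, map_mul, map_mul, map_inv] at hT4
    rw [map_mul, map_mul, map_inv]
    have := hT4.map (MulAut.conj (ρ (lower 1)))
    simpa [mul_assoc] using this
  have hqv : ¬ (q : ZS S) ∣ 1 - ((U⁻¹ : (ZS S)ˣ) : ZS S) ^ 2 := by
    intro h
    apply hr4 j hrj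
    rw [← intCast_dvd_iff hS hqS]
    push_cast
    have h3 : (U : ZS S) ^ 2 * (1 - ((U⁻¹ : (ZS S)ˣ) : ZS S) ^ 2) = 4 ^ j - 1 := by
      push_cast at hU
      linear_combination hU - (U * (U⁻¹ : (ZS S)ˣ) + 1 : ZS S) * U.mul_inv
    rw [← h3]
    exact h.mul_left _
  obtain ⟨y, c, hyc⟩ := exists_int_mul_add_eq_one hS hq hqS hqv
  have h3 := T.add_mem (T.zsmul_mem hTv y) (hTq c)
  rw [zsmul_eq_mul, hyc] at h3
  exact h3

lemma isCoprime_row (g : SpecialLinearGroup (Fin 2) (ZS S)) : IsCoprime (g.1 0 0) (g.1 0 1) :=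
  ⟨g.1 1 1, -g.1 1 0, by linear_combination SL2_det g⟩

lemma isCoprime_of_isUnit_right {A : Type*} [CommRing A] {a x : A} (h : IsUnit x) :
    IsCoprime a x := by
  obtain ⟨u, rfl⟩ := h
  exact ⟨0, (u⁻¹ : Aˣ), by simp⟩

lemma isCoprime_of_dvd_sub_one {A : Type*} [CommRing A] {a x : A} (h : x ∣ a - 1) :
    IsCoprime a x := by
  obtain ⟨c, hc⟩ := h
  exact ⟨1, -c, by linear_combination hc⟩

include hS hr in
lemma exists_coprime_add {a b n : ZS S} (hab : IsCoprime a b) (ha : a ≠ 0) (hn : n ≠ 0)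
    (hnr : IsCoprime n (r : ZS S)) :
    ∃ t, b + a * n * t ≠ 0 ∧ IsCoprime (b + a * n * t) (r : ZS S) := by
  by_cases hbr : IsCoprime b (r : ZS S)
  · by_cases hb : b = 0
    · refine ⟨1, ?_, ?_⟩
      · rw [hb, zero_add, mul_one]; exact mul_ne_zero ha hn
      · rw [hb, isCoprime_zero_left] at hbr
        exact isCoprime_of_isUnit_right hbr
    · exact ⟨0, by simpa using hb, by simpa using hbr⟩
  · have hrb : (r : ZS S) ∣ b := by
      by_contra hrb
      have hrS : ∀ p ∈ S, ¬ p ∣ r := fun p hp h => hbr <| by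
        rw [Nat.prime_dvd_prime_iff_eq (hS p hp) hr] at h
        exact isCoprime_of_isUnit_right (isUnit_of_mem hS (h ▸ hp))
      obtain ⟨y, c, h⟩ := exists_int_mul_add_eq_one hS hr hrS hrb
      exact hbr ⟨y, c, by rw [← h]; ring⟩
    have h1 : IsCoprime (b + a * n * 1) (r : ZS S) := by
      obtain ⟨c, rfl⟩ := hrb
      rw [mul_one, add_comm]
      exact (IsCoprime.mul_left hab.of_mul_right_left hnr).add_mul_left_left c
    refine ⟨1, fun h => hbr ?_, h1⟩
    rw [h, isCoprime_zero_left] at h1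
    exact isCoprime_of_isUnit_right h1

include hN hS hq hqS hqN hρ h2 hr hr4 in
lemma commute_lower_one (hN0 : N ≠ 0) (hNr : N.Coprime (2 * r))
    {g : SpecialLinearGroup (Fin 2) (ZS S)} (hg : g ∈ Gamma (ZS S) (Ideal.span {(N : ZS S)})) :
    Commute (ρ (lower 1)) (ρ g) := by
  have hNr' : IsCoprime (N : ZS S) ((2 * r : ℕ) : ZS S) := hNr.cast
  have hN0' : (N : ZS S) ≠ 0 := Nat.cast_ne_zero.mpr hN0
  have hqN' : (q : ZS S) ∣ N := Nat.cast_dvd_cast hqN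
  have hu2 := isUnit_of_mem hS h2
  obtain ⟨t, ht0, htr⟩ : ∃ t, g.1 0 1 + g.1 0 0 * N * t ≠ 0 ∧
      IsCoprime (g.1 0 1 + g.1 0 0 * N * t) (r : ZS S) := by
    refine exists_coprime_add hS hr (isCoprime_row g) ?_ hN0' (hNr.coprime_mul_left_right.cast)
    intro h0
    have h1 := hqN'.trans (mem_Gamma_span.mp hg).1
    rw [h0, zero_sub] at h1
    have h3 := (intCast_dvd_iff hS hqS (-1)).mp (by simpa using h1)
    rw [Int.dvd_neg] at h3
    exact hq.one_lt.ne' (by exact_mod_cast Int.eq_one_of_dvd_one (by positivity) h3)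
  set g1 := g * upper (N * t) with hg1
  have hg1N := mul_mem hg (upper_mem_Gamma (x := (N : ZS S)) (t := t))
  rw [← hg1] at hg1N
  have hρ1 : ρ g1 = ρ g := by rw [hg1, map_mul, (hN t).1, mul_one]
  have h01 : g1.1 0 1 = g.1 0 1 + g.1 0 0 * N * t := by simp [hg1, SL2_mul]; ring
  rw [← h01] at ht0 htr
  obtain ⟨h1N, h2N, -, -⟩ := mem_Gamma_span.mp hg1N
  have hcop1 : IsCoprime (g1.1 0 0) (q * g1.1 0 1) :=
    (isCoprime_of_dvd_sub_one (hqN'.trans h1N)).mul_right (isCoprime_row g1)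
  have hcop2 : IsCoprime (q * g1.1 0 1) ((2 * r : ℕ) : ZS S) := by
    refine IsCoprime.mul_left (hNr'.of_isCoprime_of_dvd_left hqN') ?_
    push_cast
    exact IsCoprime.mul_right (isCoprime_of_isUnit_right (by exact_mod_cast hu2)) htr
  obtain ⟨P, hP, ⟨s, hs⟩, hPr⟩ := exists_prime_dvd_sub hS
    (mul_ne_zero (Nat.cast_ne_zero.mpr hq.ne_zero) ht0) hcop1 hr.ne_zero hcop2
  set x := (q : ZS S) * s with hx
  set g2 := lower (-x) * g1 * lower x with hg2
  have hg2N : g2 ∈ Gamma (ZS S) (Ideal.span {(N : ZS S)}) := by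
    have := Subgroup.Normal.conj_mem inferInstance g1 hg1N (lower (-x))
    rwa [← lower_neg, neg_neg] at this
  have h200 : g2.1 0 0 = P := by
    simp only [hg2, hx, SL2_mul, lower_val, of_apply, cons_val', cons_val_zero, cons_val_one,
      cons_val_fin_one]
    linear_combination -hs
  obtain ⟨h3N, h4N, -, -⟩ := mem_Gamma_span.mp hg2N
  have hcop3 := isCoprime_row g2
  rw [h200] at h3N hcop3
  have hcop4 : IsCoprime ((P : ZS S) + g2.1 0 1) (N * P) := by
    refine IsCoprime.mul_right (isCoprime_of_dvd_sub_one ?_) ?_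
    · convert dvd_add h3N h4N using 1; ring
    · simpa [add_comm] using (isCoprime_comm.mp hcop3).add_mul_left_left 1
  have hcop5 : IsCoprime ((N : ZS S) * P) ((2 * r : ℕ) : ZS S) := by
    refine hNr'.mul_left (Nat.Coprime.cast ?_)
    exact Nat.Coprime.coprime_dvd_right hPr (by simp)
  obtain ⟨P', hP', ⟨t', ht'⟩, hPr'⟩ := exists_prime_dvd_sub hS
    (mul_ne_zero hN0' (Nat.cast_ne_zero.mpr hP.ne_zero)) hcop4 hr.ne_zero hcop5
  have h := commute_lower_one_of_primes hN hS hq hqS hqN hρ h2 hr hr4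
    (mul_mem hg2N (upper_mem_Gamma (t := t'))) hP hP'
    (by simp [SL2_mul, h200]) (by simp [SL2_mul, h200]; linear_combination -ht') hPr hPr'
  rw [map_mul, (hN t').1, mul_one, hg2, map_mul, map_mul, hρ1, lower_neg, map_inv] at h
  have hc : Commute (ρ (lower 1)) (ρ (lower x)) := by
    unfold Commute SemiconjBy
    rw [← map_mul, ← map_mul, ← lower_add, ← lower_add, add_comm]
  have h5 := (hc.mul_right h).mul_right hc.inv_right
  simpa [mul_assoc] using h5

end Central

section Centralize

variable {S : Set ℕ} {Q : Type*} [Group Q] {ρ : SpecialLinearGroup (Fin 2) (ZS S) →* Q}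
  {N q : ℕ} (hS : ∀ p ∈ S, Nat.Prime p)

lemma upper_zsmul {A : Type*} [CommRing A] (n : ℤ) (a : A) : upper (n * a) = upper a ^ n := by
  cases n with
  | ofNat n => simpa using upper_nsmul n a
  | negSucc n =>
    rw [zpow_negSucc, ← upper_nsmul, ← upper_neg]
    congr 1
    push_cast; ring

lemma upper_eq_conj {A : Type*} [CommRing A] (a : A) :
    upper a = weyl A * lower (-a) * (weyl A)⁻¹ := by
  rw [weyl_conj_lower, neg_neg]

include hS in
lemma commute_of_commute_lower_one (hqS : ∀ p ∈ S, ¬ p ∣ q) (hqN : q ∣ N)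
    (hρ : ∀ a ∈ Gamma (ZS S) (Ideal.span {(q : ZS S)}),
      ∀ b ∈ Gamma (ZS S) (Ideal.span {(q : ZS S)}), Commute (ρ a) (ρ b))
    (h1 : ∀ g ∈ Gamma (ZS S) (Ideal.span {(N : ZS S)}), Commute (ρ (lower 1)) (ρ g))
    {g : SpecialLinearGroup (Fin 2) (ZS S)} (hg : g ∈ Gamma (ZS S) (Ideal.span {(N : ZS S)}))
    (h : SpecialLinearGroup (Fin 2) (ZS S)) : Commute (ρ h) (ρ g) := by
  let C : Subgroup (SpecialLinearGroup (Fin 2) (ZS S)) :=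
    (Subgroup.centralizer ((Gamma (ZS S) (Ideal.span {(N : ZS S)})).map ρ)).comap ρ
  have hC : ∀ x, x ∈ C ↔ ∀ g ∈ Gamma (ZS S) (Ideal.span {(N : ZS S)}), Commute (ρ x) (ρ g) := by
    intro x
    simp only [C, Subgroup.mem_comap, Subgroup.mem_centralizer_iff]
    constructor
    · exact fun h g hg => (h _ ⟨g, hg, rfl⟩).symm
    · rintro h _ ⟨g, hg, rfl⟩
      exact (h g hg).symm
  have hCn : C.Normal := ⟨fun x hx y => by
    rw [hC] at *
    intro g hg
    have h2 := (hx _ (Subgroup.Normal.conj_mem inferInstance g hg y⁻¹)).map (MulAut.conj (ρ y))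
    simpa [mul_assoc] using h2⟩
  have hl : lower 1 ∈ C := (hC _).mpr h1
  have hu : upper 1 ∈ C := by
    rw [upper_eq_conj, lower_neg]
    exact hCn.conj_mem _ (inv_mem hl) _
  suffices C = ⊤ from (hC h).mp (this ▸ Subgroup.mem_top h) g hg
  rw [eq_top_iff, ← closure_upper_weyl hS, Subgroup.closure_le]
  rintro _ (⟨a, rfl⟩ | rfl)
  · obtain ⟨k, c, hc⟩ := exists_int_dvd_sub hS hqS a
    rw [sub_eq_iff_eq_add', ← mul_one (k : ZS S)] at hc
    rw [hc, upper_add, upper_zsmul]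
    refine mul_mem (zpow_mem hu k) ((hC _).mpr fun g hg => ?_)
    exact hρ _ upper_mem_Gamma _ (Gamma_le_of_dvd (Nat.cast_dvd_cast hqN) hg)
  · rw [SetLike.mem_coe, weyl_eq, lower_neg]
    exact mul_mem (mul_mem hu (inv_mem hl)) hu

lemma upper_mem_of_three {A : Type*} [CommRing A] {K : Subgroup (SpecialLinearGroup (Fin 2) A)}
    (h2 : IsUnit (2 : A)) (h3 : IsUnit (3 : A)) {x : A}
    (h : ∀ t : A, ⁅torus h2.unit, upper (x * t)⁆ ∈ K) (t : A) : upper (x * t) ∈ K := by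
  obtain ⟨c, hc⟩ := h3.exists_right_inv
  have h1 := h (c * t)
  rw [torus_commutator_upper, IsUnit.unit_spec] at h1
  convert h1 using 2
  linear_combination (-x * t) * hc

include hS in
lemma commutator_eq_top (h2 : 2 ∈ S) (h3 : 3 ∈ S) :
    commutator (SpecialLinearGroup (Fin 2) (ZS S)) = ⊤ := by
  have hu : ∀ t : ZS S, upper t ∈ commutator (SpecialLinearGroup (Fin 2) (ZS S)) := fun t => by
    rw [← one_mul t]
    refine upper_mem_of_three (isUnit_of_mem hS h2) (isUnit_of_mem hS h3) (fun t => ?_) t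
    exact Subgroup.commutator_mem_commutator (Subgroup.mem_top _) (Subgroup.mem_top _)
  rw [eq_top_iff, ← closure_upper_weyl hS, Subgroup.closure_le]
  rintro _ (⟨a, rfl⟩ | rfl)
  · exact hu a
  · rw [SetLike.mem_coe, weyl_eq]
    exact mul_mem (mul_mem (hu _) (lower_mem_of_upper_mem (hu _))) (hu _)

include hS in
lemma exists_pow_mem (hq : q.Prime) (h2 : 2 ∈ S) (h3 : 3 ∈ S)
    (hN0 : N ≠ 0) (hqN : q ∣ N) {W : Subgroup (SpecialLinearGroup (Fin 2) (ZS S))} [W.Normal]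
    (hNW : Gamma (ZS S) (Ideal.span {(N : ZS S)}) ≤ W)
    (hDW : ⁅Gamma (ZS S) (Ideal.span {(q : ZS S)}), Gamma (ZS S) (Ideal.span {(q : ZS S)})⁆ ≤ W) :
    ∃ k : ℕ, ∀ g ∈ Gamma (ZS S) (Ideal.span {(q : ZS S)}), g ^ q ^ k ∈ W := by
  obtain ⟨k, m, hqm, rfl⟩ := Nat.exists_eq_pow_mul_and_not_dvd hN0 q hq.ne_one
  have hk : k ≠ 0 := by
    rintro rfl
    exact hqm (by simpa using hqN)
  have hcop : IsCoprime ((q : ZS S) ^ k) (m : ZS S) := by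
    have := (((Nat.Prime.coprime_iff_not_dvd hq).mpr hqm).pow_left k).cast (R := ZS S)
    simpa using this
  set X := (q : ZS S) ^ k with hX
  have hqX : (q : ZS S) ∣ X := dvd_pow_self _ hk
  set G := SpecialLinearGroup (Fin 2) (ZS S)
  have hXm : ∀ g ∈ Gamma (ZS S) (Ideal.span {X}), g ∈ Gamma (ZS S) (Ideal.span {(m : ZS S)}) →
      g ∈ W := fun g h h' => hNW (by push_cast; exact mem_Gamma_mul hcop h h')
  set L : Subgroup G := Subgroup.closure
    ((Set.range fun t : ZS S => upper (X * t)) ∪ Set.range fun t : ZS S => lower (X * t)) with hL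
  have hLX : L ≤ Gamma (ZS S) (Ideal.span {X}) := by
    rw [hL, Subgroup.closure_le]
    rintro _ (⟨t, rfl⟩ | ⟨t, rfl⟩)
    exacts [upper_mem_Gamma, lower_mem_Gamma]
  have hsup : L ⊔ Gamma (ZS S) (Ideal.span {(m : ZS S)}) = ⊤ := by
    obtain ⟨α, β, h⟩ := hcop
    have hd : ∀ a : ZS S, a = X * (α * a) + m * (β * a) := fun a => by
      linear_combination (-a) * h
    have hu : ∀ a : ZS S, upper a ∈ L ⊔ Gamma (ZS S) (Ideal.span {(m : ZS S)}) := fun a => by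
      rw [hd a, upper_add]
      exact Subgroup.mul_mem_sup (Subgroup.subset_closure (Or.inl ⟨_, rfl⟩)) upper_mem_Gamma
    have hl : ∀ a : ZS S, lower a ∈ L ⊔ Gamma (ZS S) (Ideal.span {(m : ZS S)}) := fun a => by
      rw [hd a, lower_add]
      exact Subgroup.mul_mem_sup (Subgroup.subset_closure (Or.inr ⟨_, rfl⟩)) lower_mem_Gamma
    rw [eq_top_iff, ← closure_upper_weyl hS, Subgroup.closure_le]
    rintro _ (⟨a, rfl⟩ | rfl)
    · exact hu a
    · rw [SetLike.mem_coe, weyl_eq]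
      exact mul_mem (mul_mem (hu _) (hl _)) (hu _)
  have hdec : ∀ g : G, ∃ l ∈ L, ∃ γ ∈ Gamma (ZS S) (Ideal.span {(m : ZS S)}), l * γ = g :=
    fun g => Subgroup.mem_sup_of_normal_right.mp (hsup ▸ Subgroup.mem_top g)
  have h2u : IsUnit (2 : ZS S) := isUnit_of_mem hS h2
  have hUW : ∀ t : ZS S, upper (X * t) ∈ W := by
    refine upper_mem_of_three h2u (isUnit_of_mem hS h3) fun t => ?_
    obtain ⟨l, hl, γ, hγ, h⟩ := hdec (torus h2u.unit)
    rw [← QuotientGroup.eq_one_iff, ← QuotientGroup.mk'_apply, map_commutatorElement,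
      commutatorElement_eq_one_iff_commute, ← h, map_mul]
    refine Commute.mul_left ?_ ?_ <;>
      rw [← commutatorElement_eq_one_iff_commute, ← map_commutatorElement,
        QuotientGroup.mk'_apply, QuotientGroup.eq_one_iff]
    · exact hDW (Subgroup.commutator_mem_commutator (Gamma_le_of_dvd hqX (hLX hl))
        (Gamma_le_of_dvd hqX upper_mem_Gamma))
    · exact hXm _ (Subgroup.commutator_le_right ⊤ _
          (Subgroup.commutator_mem_commutator (Subgroup.mem_top _) upper_mem_Gamma))
        (Subgroup.commutator_le_left _ ⊤
          (Subgroup.commutator_mem_commutator hγ (Subgroup.mem_top _)))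
  have hLW : L ≤ W := by
    rw [hL, Subgroup.closure_le]
    rintro _ (⟨t, rfl⟩ | ⟨t, rfl⟩)
    exacts [hUW t, lower_mem_of_upper_mem (hUW t)]
  refine ⟨k, fun g hg => ?_⟩
  obtain ⟨l, hl, γ, hγ, rfl⟩ := hdec g
  have hγq : γ ∈ Gamma (ZS S) (Ideal.span {(q : ZS S)}) :=
    ((Gamma (ZS S) (Ideal.span {(q : ZS S)})).mul_mem_cancel_left
      (Gamma_le_of_dvd hqX (hLX hl))).mp hg
  have h1 : γ ^ q ^ k ∈ W := hXm _
    (Gamma_le_of_dvd (pow_dvd_pow _ k.le_succ) (pow_pow_mem_Gamma hγq k)) (pow_mem hγ _)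
  rw [← QuotientGroup.eq_one_iff, ← QuotientGroup.mk'_apply] at h1 ⊢
  have h4 : QuotientGroup.mk' W l = 1 := (QuotientGroup.eq_one_iff l).mpr (hLW hl)
  rw [map_pow, map_mul, h4, one_mul, ← map_pow, h1]

end Centralize

section Final

variable {S : Set ℕ} {q : ℕ}

lemma finite_abelianization_of_mem (hS : ∀ p ∈ S, Nat.Prime p) (hq : q.Prime) (hqS : q ∉ S)
    (h2 : 2 ∈ S) (h3 : 3 ∈ S) (hq2 : q ≠ 2) (hq3 : q ≠ 3) :
    Finite (Abelianization ↥(Gamma (ZS S) (Ideal.span {(q : ZS S)}))) ∧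
      IsPGroup q (Abelianization ↥(Gamma (ZS S) (Ideal.span {(q : ZS S)}))) := by
  have hqS' := not_dvd_of_prime hS hq hqS
  obtain ⟨m, r, u, hm0, hmS, hr, hu, ⟨v, hv⟩, hcop, hr4⟩ := exists_level hS hq hqS h2 h3 hq2 hq3
  set Γ := Gamma (ZS S) (Ideal.span {(q : ZS S)}) with hΓ
  set ρ := QuotientGroup.mk' ⁅Γ, Γ⁆ with hρdef
  have hρ : ∀ a ∈ Γ, ∀ b ∈ Γ, Commute (ρ a) (ρ b) := commute_map_commutator Γ
  have hker : ∀ g, ρ g = 1 ↔ g ∈ ⁅Γ, Γ⁆ := fun g => QuotientGroup.eq_one_iff g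
  have hN0 : q * m ≠ 0 := mul_ne_zero hq.ne_zero hm0
  have hqN : q ∣ q * m := dvd_mul_right q m
  have hNS : ∀ p ∈ S, ¬ p ∣ q * m := fun p hp h =>
    ((hS p hp).dvd_mul.mp h).elim (hqS' p hp) (hmS p hp)
  have hUN : ∀ t : ZS S, upper (((q * m : ℕ) : ZS S) * t) ∈ ⁅Γ, Γ⁆ := fun t => by
    have h1 := upper_mem_commutator hu ((v⁻¹ : (ZS S)ˣ) * t)
    rw [← hv] at h1
    convert h1 using 2
    push_cast
    linear_combination (-(q : ZS S) * m * t) * v.mul_inv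
  have hN : ∀ t : ZS S, ρ (upper (((q * m : ℕ) : ZS S) * t)) = 1 ∧
      ρ (lower (((q * m : ℕ) : ZS S) * t)) = 1 := fun t =>
    ⟨(hker _).mpr (hUN t), (hker _).mpr (lower_mem_of_upper_mem (hUN t))⟩
  have hcenter : ∀ g ∈ Gamma (ZS S) (Ideal.span {((q * m : ℕ) : ZS S)}), ∀ h,
      Commute (ρ h) (ρ g) := fun g hg h =>
    commute_of_commute_lower_one hS hqS' hqN hρ
      (fun g hg => commute_lower_one hN hS hq hqS' hqN hρ h2 hr hr4 hN0 hcop hg) hg h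
  set W := (Subgroup.center (SpecialLinearGroup (Fin 2) (ZS S) ⧸ ⁅Γ, Γ⁆)).comap ρ with hW
  have hmemW : ∀ g, g ∈ W ↔ ∀ h, Commute (ρ h) (ρ g) := fun g => by
    rw [hW, Subgroup.mem_comap, Subgroup.mem_center_iff]
    exact (QuotientGroup.mk'_surjective _).forall
  have hNW : Gamma (ZS S) (Ideal.span {((q * m : ℕ) : ZS S)}) ≤ W := fun g hg =>
    (hmemW g).mpr (hcenter g hg)
  constructor
  · refine finite_abelianization ?_
    have h4 := finite_quotient_span hS hN0 hNS
    have h5 := finiteIndex_Gamma (Ideal.span {((q * m : ℕ) : ZS S)})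
    have h6 : W.FiniteIndex := Subgroup.finiteIndex_of_le hNW
    have h7 : (Subgroup.center (SpecialLinearGroup (Fin 2) (ZS S) ⧸ ⁅Γ, Γ⁆)).FiniteIndex := by
      constructor
      rw [← Subgroup.index_comap_of_surjective _ (QuotientGroup.mk'_surjective ⁅Γ, Γ⁆)]
      exact h6.index_ne_zero
    have h8 : Finite (SpecialLinearGroup (Fin 2) (ZS S) ⧸ ⁅Γ, Γ⁆) := by
      apply finite_of_finiteIndex_center
      have h9 := congrArg (Subgroup.map ρ) (commutator_eq_top hS h2 h3)
      rwa [commutator_def, Subgroup.map_commutator,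
        Subgroup.map_top_of_surjective _ (QuotientGroup.mk'_surjective _)] at h9
    infer_instance
  · obtain ⟨k, hk⟩ := exists_pow_mem (W := W) hS hq h2 h3 hN0 hqN hNW fun g hg =>
      (hmemW g).mpr fun h => by rw [(hker g).mpr hg]; exact Commute.one_right _
    have hcen : ∀ a ∈ Γ, ∀ g, g * a * g⁻¹ * a⁻¹ ∈ powTorsion Γ ρ q hρ := fun a ha g =>
      commutator_mem_powTorsion (fun a ha => ⟨k, fun g => by
        rw [← map_pow]
        exact ((hmemW _).mp (hk a ha) g).symm⟩) ha g
    have h2u : IsUnit (2 : ZS S) := isUnit_of_mem hS h2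
    have hle : Γ ≤ powTorsion Γ ρ q hρ := by
      have := isMaximal_span hS hq hqS'
      let _ : Field (ZS S ⧸ Ideal.span {(q : ZS S)}) := Ideal.Quotient.field _
      have := finite_quotient_span hS hq.ne_zero hqS'
      refine ker_le_of_central Ideal.Quotient.mk_surjective powTorsion_le ?_ hcen h2u.unit ?_
        (closure_upper_weyl hS)
      · intro a ha
        obtain ⟨t, rfl⟩ := Ideal.mem_span_singleton.mp (Ideal.Quotient.eq_zero_iff_mem.mp ha)
        exact upper_mem_of_three h2u (isUnit_of_mem hS h3)
          (fun t => hcen _ upper_mem_Gamma _) t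
      · intro h
        rw [IsUnit.unit_spec, ← map_pow, ← map_one (Ideal.Quotient.mk _), Ideal.Quotient.eq,
          Ideal.mem_span_singleton] at h
        have h4 : (q : ZS S) ∣ ((3 : ℤ) : ZS S) := by
          convert h using 1
          push_cast; norm_num
        rw [intCast_dvd_iff hS hqS'] at h4
        exact hq3 ((Nat.prime_dvd_prime_iff_eq hq Nat.prime_three).mp (by exact_mod_cast h4))
    refine isPGroup_abelianization fun g hg => ?_
    obtain ⟨-, k, hk⟩ := hle hg
    refine ⟨k, (hker _).mp ?_⟩
    rw [map_pow, hk]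

lemma finite_abelianization_of_exists_unit (hS : ∀ p ∈ S, Nat.Prime p) (hq : q.Prime)
    (hqS : q ∉ S)
    (hlam : ∃ lam : (ZS (insert q S))ˣ, IsUnit ((lam : ZS (insert q S)) ^ 2 - 1)) :
    Finite (Abelianization ↥(Gamma (ZS S) (Ideal.span {(q : ZS S)}))) ∧
      IsPGroup q (Abelianization ↥(Gamma (ZS S) (Ideal.span {(q : ZS S)}))) := by
  have hS' : ∀ p ∈ insert q S, Nat.Prime p := by
    rintro p (rfl | hp)
    exacts [hq, hS p hp]
  have h2 := mem_of_exists_unit hS' hlam (l := 2) (Or.inl rfl)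
  have h3 := mem_of_exists_unit hS' hlam (l := 3) (Or.inr rfl)
  by_cases hq2 : q = 2
  · subst hq2
    have h3u := isUnit_of_mem hS (h3.resolve_left (by norm_num))
    refine finite_abelianization_of_unit (k := 3) hS hq hqS (Or.inl rfl) (u := h3u.unit) ?_ ?_
    · rw [IsUnit.unit_spec]; norm_num
    · rw [IsUnit.unit_spec]; norm_num
  by_cases hq3 : q = 3
  · subst hq3
    have h2u := isUnit_of_mem hS (h2.resolve_left (by norm_num))
    refine finite_abelianization_of_unit (k := 1) hS hq hqS (Or.inr rfl) (u := -h2u.unit) ?_ ?_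
    · rw [Units.val_neg, IsUnit.unit_spec]; norm_num
    · rw [Units.val_neg, IsUnit.unit_spec]; norm_num
  exact finite_abelianization_of_mem hS hq hqS (h2.resolve_left (Ne.symm hq2))
    (h3.resolve_left (Ne.symm hq3)) hq2 hq3

variable {A : Type*} [CommRing A]

/-- Conjugation by `diag(1, x)` on the principal congruence subgroup of level `x`. -/
noncomputable def gammaConj {x : A} (g : Gamma A (Ideal.span {x})) :
    SpecialLinearGroup (Fin 2) A :=
  ⟨!![g.1.1 0 0, (mem_Gamma_span.mp g.2).2.1.choose; x * g.1.1 1 0, g.1.1 1 1], by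
    rw [Matrix.det_fin_two_of]
    linear_combination SL2_det g.1 + g.1.1 1 0 * (mem_Gamma_span.mp g.2).2.1.choose_spec⟩

lemma gammaConj_eq_iff [IsDomain A] {x : A} (hx : x ≠ 0) (g : Gamma A (Ideal.span {x}))
    (h : SpecialLinearGroup (Fin 2) A) : gammaConj g = h ↔ g.1.1 0 0 = h.1 0 0 ∧
      g.1.1 0 1 = x * h.1 0 1 ∧ x * g.1.1 1 0 = h.1 1 0 ∧ g.1.1 1 1 = h.1 1 1 := by
  have hb := (mem_Gamma_span.mp g.2).2.1.choose_spec
  constructor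
  · rintro rfl
    exact ⟨rfl, hb, rfl, rfl⟩
  · rintro ⟨h0, h1, h2, h3⟩
    exact SL2_ext h0 (mul_left_cancel₀ hx (hb.symm.trans h1)) h2 h3

/-- Conjugation by `diag(1, x)`, as a homomorphism from the principal congruence subgroup of
level `x`. -/
noncomputable def gammaToGammaTilde [IsDomain A] {x : A} (hx : x ≠ 0) :
    Gamma A (Ideal.span {x}) →* GammaTilde' A (Ideal.span {x}) 1 where
  toFun g := ⟨gammaConj g, by
    obtain ⟨h0, -, ⟨c, hc⟩, h3⟩ := mem_Gamma_span.mp g.2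
    refine ⟨by simpa [gammaConj, Ideal.mem_span_singleton] using h0,
      by simpa [gammaConj, Ideal.mem_span_singleton] using h3, ?_, by simp⟩
    rw [Ideal.span_singleton_pow, Ideal.mem_span_singleton]
    exact ⟨c, by simp [gammaConj, hc]; ring⟩⟩
  map_one' := by
    refine Subtype.ext ((gammaConj_eq_iff hx _ _).mpr ?_)
    simp
  map_mul' g h := by
    refine Subtype.ext ((gammaConj_eq_iff hx _ _).mpr ?_)
    obtain ⟨hg0, hg1, hg2, hg3⟩ := (gammaConj_eq_iff hx g _).mp rfl
    obtain ⟨hh0, hh1, hh2, hh3⟩ := (gammaConj_eq_iff hx h _).mp rfl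
    simp only [Subgroup.coe_mul, SL2_mul, ← hg0, ← hg2, ← hg3, ← hh0, ← hh2, ← hh3]
    refine ⟨?_, ?_, ?_, ?_⟩
    · linear_combination h.1.1 1 0 * hg1
    · linear_combination g.1.1 0 0 * hh1 + h.1.1 1 1 * hg1
    · ring
    · linear_combination g.1.1 1 0 * hh1

lemma gammaToGammaTilde_surjective [IsDomain A] {x : A} (hx : x ≠ 0) :
    Function.Surjective (gammaToGammaTilde hx) := by
  rintro ⟨h, h0, h3, h2, -⟩
  rw [pow_one, Ideal.mem_span_singleton] at h0 h3
  rw [Ideal.span_singleton_pow, Ideal.mem_span_singleton] at h2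
  obtain ⟨c, hc⟩ := h2
  let g : SpecialLinearGroup (Fin 2) A := ⟨!![h.1 0 0, x * h.1 0 1; x * c, h.1 1 1], by
    rw [Matrix.det_fin_two_of]
    linear_combination SL2_det h + h.1 0 1 * hc⟩
  have hmem : g ∈ Gamma A (Ideal.span {x}) := by
    rw [mem_Gamma_span]
    simpa [g] using ⟨h0, h3⟩
  refine ⟨⟨g, hmem⟩, Subtype.ext ((gammaConj_eq_iff hx _ _).mpr ?_)⟩
  refine ⟨rfl, rfl, ?_, rfl⟩
  simp [g, hc]; ring

end Final

/-- let `S` be a nonempty set of primes, `q ∉ S` a prime, and suppose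
`ℤ_{S∪{q}}` has a unit `λ` with `λ² − 1` a unit.  Then the abelianizations of the principal
congruence subgroup `Γ(q·ℤ_S)` and of `Γ̃′(q·ℤ_S)` are finite abelian `q`-groups. -/
theorem stmt9 (S : Set ℕ) (hS : S.Nonempty) (hSprime : ∀ p ∈ S, Nat.Prime p)
    (q : ℕ) (hq : Nat.Prime q) (hqS : q ∉ S)
    (hlam : ∃ lam : (ZS (insert q S))ˣ, IsUnit ((lam : ZS (insert q S)) ^ 2 - 1)) :
    (Finite (Abelianization ↥(Gamma (ZS S) (Ideal.span {(q : ZS S)}))) ∧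
      IsPGroup q (Abelianization ↥(Gamma (ZS S) (Ideal.span {(q : ZS S)})))) ∧
    (Finite (Abelianization ↥(GammaTilde' (ZS S) (Ideal.span {(q : ZS S)}) 1)) ∧
      IsPGroup q (Abelianization ↥(GammaTilde' (ZS S) (Ideal.span {(q : ZS S)}) 1))) := by
  have h := finite_abelianization_of_exists_unit hSprime hq hqS hlam
  exact ⟨h, abelianization_transfer
    (gammaToGammaTilde_surjective (Nat.cast_ne_zero.mpr hq.ne_zero)) h⟩
end
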